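/- arXiv:2207.05840 — 5 statements merged into one kernel-verified Lean document; each statement's English description precedes it below -/
import Mathlib

section
/- There exists a constant C > 0 such that for all integers r ≥ 3 one has m_{K_4^-}(r) ≤ C·r^3·(ln r / ln ln r)^3. -/
/-- A 3-graph: a finite vertex set `Fin n` together with a family of 3-element edges. -/
structure ThreeGraph where
  n : ℕ
  edges : Finset (Finset (Fin n))
  card_eq : ∀ e ∈ edges, e.card = 3

namespace ThreeGraph

/-- `G` contains a (not necessarily induced) copy of `H`. -/
def ContainsCopy (G H : ThreeGraph) : Prop :=
  ∃ f : Fin H.n ↪ Fin G.n, ∀ e ∈ H.edges, e.image f ∈ G.edges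

/-- `G` is `H`-free: it contains no subgraph isomorphic to `H`. -/
def Free (G H : ThreeGraph) : Prop := ¬ G.ContainsCopy H

/-- `G` admits a proper coloring with `r` colors: no edge is monochromatic. -/
def Colorable (G : ThreeGraph) (r : ℕ) : Prop :=
  ∃ c : Fin G.n → Fin r, ∀ e ∈ G.edges, ∃ u ∈ e, ∃ v ∈ e, c u ≠ c v

/-- `S` is an independent set in `G`: it contains no edge of `G`. -/
def IndepSet (G : ThreeGraph) (S : Finset (Fin G.n)) : Prop :=
  ∀ e ∈ G.edges, ¬ e ⊆ S

/-- The degree of a vertex: the number of edges containing it. -/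
def degree (G : ThreeGraph) (v : Fin G.n) : ℕ :=
  (G.edges.filter (fun e => v ∈ e)).card

end ThreeGraph

/-- Every 3-graph on `N` vertices contains a copy of `H` or an independent set of `t` vertices. -/
def RamseyProp (H : ThreeGraph) (t N : ℕ) : Prop :=
  ∀ G : ThreeGraph, G.n = N →
    G.ContainsCopy H ∨ ∃ S : Finset (Fin G.n), G.IndepSet S ∧ t ≤ S.card

/-- The Ramsey number `R(H, K_t)`: the least `N` such that every 3-graph on `N` vertices
contains a copy of `H` or an independent set of `t` vertices. -/
noncomputable def ramsey (H : ThreeGraph) (t : ℕ) : ℕ :=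
  sInf {N | RamseyProp H t N}

/-- `K_4^-`: the 3-graph on 4 vertices with the three edges
`{1,2,3}, {1,2,4}, {1,3,4}` (here written 0-indexed). -/
def K4minus : ThreeGraph where
  n := 4
  edges := {({0, 1, 2} : Finset (Fin 4)), {0, 1, 3}, {0, 2, 3}}
  card_eq := by decide

/-- The proportion of the elements of a finite type that satisfy `p`. -/
noncomputable def frac {α : Type*} (p : α → Prop) : ℝ := ({x | p x}.ncard : ℝ) / Nat.card α

section Frac

variable {α β ι : Type*}

lemma frac_nonneg (p : α → Prop) : 0 ≤ frac p := by unfold frac; positivity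

lemma frac_mono [Finite α] {p q : α → Prop} (h : ∀ x, p x → q x) : frac p ≤ frac q := by
  unfold frac
  gcongr
  · exact Set.toFinite _
  · exact h _

lemma frac_or_le [Finite α] (p q : α → Prop) : frac (fun x => p x ∨ q x) ≤ frac p + frac q := by
  unfold frac
  rw [← add_div]
  gcongr
  exact_mod_cast Set.ncard_union_le {x | p x} {x | q x}

lemma frac_false : frac (fun _ : α => False) = 0 := by simp [frac]

lemma frac_exists_le [Finite α] [Fintype ι] {p : ι → α → Prop} {ε : ℝ}
    (h : ∀ i, frac (p i) ≤ ε) : frac (fun x => ∃ i, p i x) ≤ Fintype.card ι * ε := by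
  have key : ∀ s : Finset ι, frac (fun x => ∃ i ∈ s, p i x) ≤ s.card * ε := by
    classical
    intro s
    induction s using Finset.induction_on with
    | empty => simp [frac_false]
    | insert a s ha ih =>
      rw [Finset.card_insert_of_notMem ha]
      push_cast
      calc frac (fun x => ∃ i ∈ insert a s, p i x)
          ≤ frac (fun x => p a x ∨ ∃ i ∈ s, p i x) := frac_mono (by simp)
        _ ≤ _ := frac_or_le _ _
        _ ≤ ε + s.card * ε := add_le_add (h a) ih
        _ = _ := by ring
  simpa using key Finset.univ

lemma frac_equiv (e : α ≃ β) (p : β → Prop) : frac (fun x => p (e x)) = frac p := by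
  unfold frac
  rw [Nat.card_congr e, ← Set.ncard_image_of_injective _ e.injective]
  congr 3
  ext y
  simp only [Set.mem_image, Set.mem_ofPred_eq]
  exact ⟨fun ⟨x, hx, h⟩ => h ▸ hx, fun h => ⟨e.symm y, by simpa using h, by simp⟩⟩

lemma ncard_eq_sum_fiber [Fintype α] [Finite β] (S : Set (α × β)) :
    S.ncard = ∑ a, {b | (a, b) ∈ S}.ncard := by
  simp only [← Nat.card_coe_set_eq]
  rw [← Nat.card_sigma]
  exact Nat.card_congr
    { toFun := fun x => ⟨x.1.1, x.1.2, x.2⟩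
      invFun := fun x => ⟨(x.1, x.2.1), x.2.2⟩
      left_inv := fun _ => rfl
      right_inv := fun _ => rfl }

lemma frac_prod_le [Finite α] [Finite β] {p : α × β → Prop} {ε : ℝ} (hε : 0 ≤ ε)
    (h : ∀ a, frac (fun b => p (a, b)) ≤ ε) : frac p ≤ ε := by
  rcases isEmpty_or_nonempty (α × β) with he | he
  · simp [frac, hε]
  have : 0 < (Nat.card (α × β) : ℝ) := by exact_mod_cast Nat.card_pos
  have hb : Nonempty β := he.map Prod.snd
  have hb' : 0 < (Nat.card β : ℝ) := by exact_mod_cast Nat.card_pos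
  unfold frac at h ⊢
  rw [div_le_iff₀ this, Nat.card_prod]
  push_cast
  have := Fintype.ofFinite α
  rw [ncard_eq_sum_fiber]
  push_cast
  calc _ ≤ ∑ _a : α, ε * Nat.card β :=
        Finset.sum_le_sum fun a _ => (div_le_iff₀ hb').1 (h a)
    _ = _ := by simp; ring

lemma frac_prod_le' [Finite α] [Finite β] {p : α × β → Prop} {ε : ℝ} (hε : 0 ≤ ε)
    (h : ∀ b, frac (fun a => p (a, b)) ≤ ε) : frac p ≤ ε := by
  rw [← frac_equiv (Equiv.prodComm β α)]
  exact frac_prod_le hε h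

lemma frac_forall_le [Finite β] [Fintype ι] {p : ι → β → Prop} {ε : ℝ}
    (J : Finset ι) (h : ∀ i ∈ J, frac (p i) ≤ ε) :
    frac (fun f : ι → β => ∀ i ∈ J, p i (f i)) ≤ ε ^ J.card := by
  classical
  have := Fintype.ofFinite β
  have hset : {f : ι → β | ∀ i ∈ J, p i (f i)} =
      (Fintype.piFinset fun i => {b | i ∈ J → p i b} : Finset (ι → β)) := by
    ext f; simp
  have hprod : frac (fun f : ι → β => ∀ i ∈ J, p i (f i)) =
      ∏ i, frac (fun b => i ∈ J → p i b) := by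
    unfold frac
    rw [hset, Set.ncard_coe_finset, Fintype.card_piFinset, Finset.prod_div_distrib, Nat.card_fun]
    push_cast
    congr 1
    · refine Finset.prod_congr rfl fun i _ => ?_
      rw [← Set.ncard_coe_finset]
      simp
    · simp
  rw [hprod]
  calc ∏ i, frac (fun b => i ∈ J → p i b) ≤ ∏ i, if i ∈ J then ε else 1 := by
        refine Finset.prod_le_prod (fun _ _ => frac_nonneg _) fun i _ => ?_
        split_ifs with hi
        · simpa [hi] using h i hi
        · unfold frac
          refine div_le_one_of_le₀ ?_ (by positivity)
          exact_mod_cast (Set.ncard_le_card _)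
    _ = ε ^ J.card := by simp

lemma frac_many_le [Finite β] [Fintype ι] {p : ι → β → Prop} {ε : ℝ} (hε : 0 ≤ ε)
    (n : ℕ) (h : ∀ i, frac (p i) ≤ ε) :
    frac (fun f : ι → β => n ≤ {i | p i (f i)}.ncard) ≤ 2 ^ Fintype.card ι * ε ^ n := by
  classical
  calc frac (fun f : ι → β => n ≤ {i | p i (f i)}.ncard)
      ≤ frac (fun f : ι → β => ∃ J : Finset ι, J.card = n ∧ ∀ i ∈ J, p i (f i)) := by
        refine frac_mono fun f hf => ?_
        rw [Set.ncard_eq_toFinset_card'] at hf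
        obtain ⟨J, hJ, hc⟩ := Finset.exists_subset_card_eq hf
        exact ⟨J, hc, fun i hi => by simpa using hJ hi⟩
    _ ≤ Fintype.card (Finset ι) * ε ^ n := by
        refine frac_exists_le fun J => ?_
        by_cases hJ : J.card = n
        · simpa [hJ] using frac_forall_le J fun i _ => h i
        · simp only [hJ, false_and, frac_false]
          positivity
    _ = _ := by simp

lemma frac_comp_le [Finite β] [Finite ι] [Finite α] {e : ι → α} (he : Function.Injective e)
    (p : (ι → β) → Prop) : frac (fun f : α → β => p (f ∘ e)) ≤ frac p := by
  classical
  let E' : (α → β) ≃ (ι → β) × ({a // a ∉ Set.range e} → β) :=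
    (Equiv.piEquivPiSubtypeProd (fun a => a ∈ Set.range e) (fun _ : α => β)).trans
      (Equiv.prodCongr ((Equiv.ofInjective e he).symm.arrowCongr (Equiv.refl β)) (Equiv.refl _))
  have h : ∀ f : α → β, f ∘ e = (E' f).1 := by
    intro f
    ext i
    simp [E', Equiv.arrowCongr]
  simp only [h]
  rw [frac_equiv E' (fun x => p x.1)]
  exact frac_prod_le' (frac_nonneg _) fun b => le_rfl

/-- Double counting: a large set of pairs has many large fibers. -/
lemma le_ncard_large_fibers [Finite α] [Finite β] (S : Set (α × β)) {m n : ℕ}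
    (h : m * Nat.card β + Nat.card α * n ≤ S.ncard) (hβ : 0 < Nat.card β) :
    m ≤ {a | n ≤ {b | (a, b) ∈ S}.ncard}.ncard := by
  classical
  have := Fintype.ofFinite α
  by_contra! hlt
  refine absurd h (not_le.2 ?_)
  rw [ncard_eq_sum_fiber]
  calc ∑ a, {b | (a, b) ∈ S}.ncard
      ≤ ∑ a, ((if n ≤ {b | (a, b) ∈ S}.ncard then Nat.card β else 0) + n) := by
        refine Finset.sum_le_sum fun a _ => ?_
        split_ifs with ha
        · exact (Set.ncard_le_card _).trans (Nat.le_add_right _ _)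
        · omega
    _ = {a | n ≤ {b | (a, b) ∈ S}.ncard}.ncard * Nat.card β + Nat.card α * n := by
        rw [Finset.sum_add_distrib, ← Finset.sum_filter, Set.ncard_eq_toFinset_card']
        simp
    _ < _ := by gcongr

end Frac
section Cube

/-- Two sets of points of the discrete cube at mutual distance at least `r` cannot both be large. -/
lemma card_mul_card_le_of_hammingDist (n r : ℕ) (A B : Finset (Fin n → Bool))
    (h : ∀ a ∈ A, ∀ b ∈ B, r ≤ hammingDist a b) :
    (A.card : ℝ) * B.card * (2 ^ r * 2 ^ n) ≤ 9 ^ n := by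
  classical
  induction n generalizing r with
  | zero =>
    rcases A.eq_empty_or_nonempty with rfl | ⟨a, ha⟩
    · simp
    rcases B.eq_empty_or_nonempty with rfl | ⟨b, hb⟩
    · simp
    have hr : r = 0 := by simpa [Subsingleton.elim a b] using h a ha b hb
    have hA : (A.card : ℝ) ≤ 1 := by exact_mod_cast Finset.card_le_one_of_subsingleton A
    have hB : (B.card : ℝ) ≤ 1 := by exact_mod_cast Finset.card_le_one_of_subsingleton B
    simpa [hr] using mul_le_one₀ hA (by positivity) hB
  | succ n ih =>
    let sec : Finset (Fin (n + 1) → Bool) → Bool → Finset (Fin n → Bool) :=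
      fun A i => Finset.univ.filter fun x => (Fin.cons i x : Fin (n + 1) → Bool) ∈ A
    let emb : Bool → (Fin n → Bool) ↪ (Fin (n + 1) → Bool) :=
      fun i => ⟨fun x => Fin.cons i x, Fin.cons_right_injective (α := fun _ => Bool) i⟩
    have hcard : ∀ A, (A.card : ℝ) = (sec A false).card + (sec A true).card := by
      intro A
      have : A = (sec A false).map (emb false) ∪ (sec A true).map (emb true) := by
        ext x
        induction x using Fin.consCases with
        | _ i x => cases i <;> simp [sec, emb, Fin.cons_inj]
      have hd : Disjoint ((sec A false).map (emb false)) ((sec A true).map (emb true)) := by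
        simp [Finset.disjoint_left, emb, Fin.cons_inj]
      have h2 := congrArg Finset.card this
      rw [Finset.card_union_of_disjoint hd, Finset.card_map, Finset.card_map] at h2
      exact_mod_cast h2
    have hdist : ∀ (i j : Bool) (x y : Fin n → Bool),
        hammingDist (Fin.cons i x : Fin (n + 1) → Bool) (Fin.cons j y) =
          (if i = j then 0 else 1) + hammingDist x y := by
      intro i j x y
      simp only [hammingDist, Finset.card_filter, Fin.sum_univ_succ, Fin.cons_zero, Fin.cons_succ]
      congr 1
      split_ifs <;> simp_all
    have same : ∀ i, ((sec A i).card : ℝ) * (sec B i).card * (2 ^ r * 2 ^ n) ≤ 9 ^ n := by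
      refine fun i => ih r _ _ fun a ha b hb => ?_
      have := h _ (by simpa [sec] using ha) _ (by simpa [sec] using hb)
      rwa [hdist, if_pos rfl, zero_add] at this
    have diff : ∀ i j, i ≠ j →
        ((sec A i).card : ℝ) * (sec B j).card * (2 ^ r * 2 ^ n) ≤ 2 * 9 ^ n := by
      intro i j hij
      have h1 := ih (r - 1) (sec A i) (sec B j) fun a ha b hb => by
        have := h _ (by simpa [sec] using ha) _ (by simpa [sec] using hb)
        rw [hdist, if_neg hij] at this
        omega
      have h2 : (2 : ℝ) ^ r ≤ 2 * 2 ^ (r - 1) := by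
        rw [← pow_succ']
        exact pow_le_pow_right₀ (by norm_num) (by omega)
      calc _ ≤ ((sec A i).card : ℝ) * (sec B j).card * (2 * 2 ^ (r - 1) * 2 ^ n) := by gcongr
        _ = 2 * (((sec A i).card : ℝ) * (sec B j).card * (2 ^ (r - 1) * 2 ^ n)) := by ring
        _ ≤ _ := by gcongr
    have optimize : ∀ K U V W Z : ℝ, 0 < K → 0 ≤ U → 0 ≤ V → U ≤ K → V ≤ K →
        W ≤ 2 * K → Z ≤ 2 * K → U * V = W * Z → 2 * (U + V + W + Z) ≤ 9 * K := by
      intro K U V W Z hK hU hV h1 h2 h3 h4 h5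
      have h6 : K * (U + V) ≤ K * K + U * V := by nlinarith
      have h7 : 2 * K * (W + Z) ≤ 4 * K * K + W * Z := by nlinarith
      have h8 : U * V ≤ K * K := by gcongr
      nlinarith
    have := optimize (9 ^ n) _ _ _ _ (by positivity) (by positivity) (by positivity)
      (same false) (same true) (diff false true (by simp)) (diff true false (by simp)) (by ring)
    rw [hcard A, hcard B, pow_succ, pow_succ]
    linarith

/-- Adjacency in the Erdős graph on the cube: distance more than two thirds of the dimension. -/
def FarApart {k : ℕ} (x y : Fin (3 * k) → Bool) : Prop := 2 * k < hammingDist x y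

lemma FarApart.symm {k : ℕ} {x y : Fin (3 * k) → Bool} (h : FarApart x y) : FarApart y x := by
  rwa [FarApart, hammingDist_comm]

lemma not_farApart_triangle {k : ℕ} {x y z : Fin (3 * k) → Bool}
    (hxy : FarApart x y) (hxz : FarApart x z) : ¬ FarApart y z := by
  unfold FarApart at *
  have : hammingDist x y + hammingDist x z + hammingDist y z ≤ 2 * (3 * k) := by
    simp only [hammingDist, Finset.card_filter, ← Finset.sum_add_distrib]
    calc _ ≤ ∑ _i : Fin (3 * k), 2 := by
          refine Finset.sum_le_sum fun i _ => ?_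
          cases x i <;> cases y i <;> cases z i <;> simp
      _ = _ := by simp; ring
  omega

lemma hammingDist_not {n : ℕ} (x y : Fin n → Bool) :
    hammingDist x (fun i => !y i) + hammingDist x y = n := by
  simp only [hammingDist, Finset.card_filter, ← Finset.sum_add_distrib]
  calc _ = ∑ _i : Fin n, 1 := by
        refine Finset.sum_congr rfl fun i _ => ?_
        cases x i <;> cases y i <;> simp
    _ = n := by simp

/-- Two sets of more than `(27/32)^k · 8^k` points span an edge of the Erdős graph. -/
lemma exists_farApart {k : ℕ} (A B : Set (Fin (3 * k) → Bool))
    (hA : (27 / 32 : ℝ) ^ k < frac (· ∈ A)) (hB : (27 / 32 : ℝ) ^ k < frac (· ∈ B)) :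
    ∃ a ∈ A, ∃ b ∈ B, FarApart a b := by
  classical
  by_contra! hno
  have inj : Function.Injective fun (x : Fin (3 * k) → Bool) i => !x i := by
    intro x y hxy
    funext i
    simpa using congrFun hxy i
  have key := card_mul_card_le_of_hammingDist (3 * k) k A.toFinset
    (B.toFinset.image fun x i => !x i) (by
      intro a ha b hb
      obtain ⟨y, hy, rfl⟩ := Finset.mem_image.1 hb
      have h1 := hno a (by simpa using ha) y (by simpa using hy)
      have h2 := hammingDist_not a y
      unfold FarApart at h1
      omega)
  rw [Finset.card_image_of_injective _ inj] at key
  have hV : (Nat.card (Fin (3 * k) → Bool) : ℝ) = 8 ^ k := by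
    simp [pow_mul]
  unfold frac at hA hB
  rw [hV, lt_div_iff₀ (by positivity)] at hA hB
  simp only [Set.ofPred_mem_eq, Set.ncard_eq_toFinset_card'] at hA hB
  have hlt := mul_lt_mul'' hA hB (by positivity) (by positivity)
  have : (9 : ℝ) ^ (3 * k) < 9 ^ (3 * k) := calc
    (9 : ℝ) ^ (3 * k) = (27 / 32 : ℝ) ^ k * 8 ^ k * ((27 / 32 : ℝ) ^ k * 8 ^ k) *
        (2 ^ k * 2 ^ (3 * k)) := by
      simp only [pow_mul, ← mul_pow]; norm_num
    _ < _ := by gcongr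
    _ ≤ _ := key
  exact lt_irrefl _ this

end Cube
section Counting

variable {Ω : Type*}

/-- Any three sets of density more than `δ` contain a triple satisfying `R`. -/
def Expanding (R : Ω → Ω → Ω → Prop) (δ : ℝ) : Prop :=
  ∀ X Y Z : Set Ω, δ < frac (· ∈ X) → δ < frac (· ∈ Y) → δ < frac (· ∈ Z) →
    ∃ x ∈ X, ∃ y ∈ Y, ∃ z ∈ Z, R x y z

/-- The elements `g` for which no `R (u j) g l` with `l ∈ Q j` holds. -/
def avoiders (R : Ω → Ω → Ω → Prop) {J : Type*} (u : J → Ω) (Q : J → Set Ω) : Set Ω :=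
  {g | ∀ j, ∀ l ∈ Q j, ¬ R (u j) g l}

variable [Finite Ω] {R : Ω → Ω → Ω → Prop} {δ : ℝ}

lemma frac_large_avoiders_le (hR : Expanding R δ) (h0 : 0 ≤ δ) (h1 : δ ≤ 1)
    {J : Type*} [Finite J] (Q : J → Set Ω) {w : ℕ} (hQ : w ≤ {j | δ < frac (· ∈ Q j)}.ncard) :
    frac (fun u : J → Ω => δ < frac (· ∈ avoiders R u Q)) ≤ 2 ^ Nat.card Ω * δ ^ w := by
  classical
  have := Fintype.ofFinite Ω
  have := Fintype.ofFinite J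
  calc frac (fun u : J → Ω => δ < frac (· ∈ avoiders R u Q))
      ≤ frac (fun u : J → Ω => ∃ K : Set Ω, δ < frac (· ∈ K) ∧ ∀ j, ∀ g ∈ K, ∀ l ∈ Q j,
          ¬ R (u j) g l) :=
        frac_mono fun u hu => ⟨avoiders R u Q, hu, fun j g hg l hl => hg j l hl⟩
    _ ≤ Fintype.card (Set Ω) * δ ^ w := by
        refine frac_exists_le fun K => ?_
        by_cases hK : δ < frac (· ∈ K)
        · rw [Set.ncard_eq_toFinset_card'] at hQ
          refine le_trans ?_ (pow_le_pow_of_le_one h0 h1 hQ)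
          refine le_trans (frac_mono fun u hu j _ => hu.2 j) (frac_forall_le
            (p := fun j x => ∀ g ∈ K, ∀ l ∈ Q j, ¬ R x g l) _ fun j hj => ?_)
          by_contra! hlt
          obtain ⟨x, hx, g, hg, l, hl, h⟩ := hR {x | ∀ g ∈ K, ∀ l ∈ Q j, ¬ R x g l} K (Q j)
            hlt hK (by simpa using hj)
          exact hx g hg l hl h
        · simp only [hK, false_and, frac_false]
          positivity
    _ = _ := by simp

variable (R δ) in
/-- Some system `Q` with many dense members has many dense sets of avoiders. -/
def Atypical {A J : Type*} (w h : ℕ) (f : A → J → Ω) : Prop :=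
  ∃ Q : J → Set Ω, w ≤ {j | δ < frac (· ∈ Q j)}.ncard ∧
    h ≤ {a | δ < frac (· ∈ avoiders R (f a) Q)}.ncard

lemma frac_atypical_le (hR : Expanding R δ) (h0 : 0 ≤ δ) (h1 : δ ≤ 1)
    {A J : Type*} [Finite A] [Finite J] (w h : ℕ) :
    frac (Atypical R δ w h : (A → J → Ω) → Prop) ≤
      (2 ^ Nat.card Ω) ^ Nat.card J * (2 ^ Nat.card A * (2 ^ Nat.card Ω * δ ^ w) ^ h) := by
  classical
  have := Fintype.ofFinite Ω
  have := Fintype.ofFinite J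
  have := Fintype.ofFinite A
  refine (frac_exists_le (ε := 2 ^ Nat.card A * (2 ^ Nat.card Ω * δ ^ w) ^ h)
    fun Q => ?_).trans_eq (by simp)
  by_cases hQ : w ≤ {j | δ < frac (· ∈ Q j)}.ncard
  · simp only [hQ, true_and]
    rw [Nat.card_eq_fintype_card (α := A)]
    exact frac_many_le (p := fun _ u => δ < frac (· ∈ avoiders R u Q)) (by positivity) h
      fun _ => frac_large_avoiders_le hR h0 h1 Q hQ
  · simp only [hQ, false_and, frac_false]
    positivity

/-- The elements `l` for which no `R (F i a j) (g a) l` holds. -/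
def allowed (R : Ω → Ω → Ω → Prop) {I A J : Type*} (F : I → A → J → Ω) (g : A → Ω)
    (p : I × J) : Set Ω :=
  {l | ∀ a, ¬ R (F p.1 a p.2) (g a) l}

lemma frac_many_allowed_le (h0 : 0 ≤ δ) (h1 : δ ≤ 1)
    {I A J : Type*} [Finite I] [Finite A] [Finite J] {w h h' n : ℕ} (F : I → A → J → Ω)
    (hF : {i | Atypical R δ w h (F i)}.ncard < w) (hJ : 0 < Nat.card J)
    (hn : w * Nat.card J + Nat.card I * w ≤ n) (hA : h + h' ≤ Nat.card A + 1) :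
    frac (fun g : A → Ω => n ≤ {p | δ < frac (· ∈ allowed R F g p)}.ncard) ≤
      Nat.card I * ((2 ^ Nat.card Ω) ^ Nat.card J * δ ^ h') := by
  classical
  have := Fintype.ofFinite Ω
  have := Fintype.ofFinite I
  have := Fintype.ofFinite J
  have := Fintype.ofFinite A
  calc _ ≤ frac (fun g : A → Ω => ∃ i, ∃ Q : J → Set Ω,
          h' ≤ {a | frac (· ∈ avoiders R (F i a) Q) ≤ δ}.ncard ∧
          ∀ a, g a ∈ avoiders R (F i a) Q) := by
        refine frac_mono fun g hg => ?_
        have hlarge := le_ncard_large_fibers _ (hn.trans hg) hJ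
        obtain ⟨i, hi, hti⟩ := Set.exists_mem_notMem_of_ncard_lt_ncard (hF.trans_le hlarge)
        refine ⟨i, fun j => allowed R F g (i, j), ?_, fun a j l hl => hl a⟩
        by_contra! hlt
        refine hti ⟨fun j => allowed R F g (i, j), hi, ?_⟩
        have := Set.ncard_add_ncard_compl
          {a | δ < frac (· ∈ avoiders R (F i a) fun j => allowed R F g (i, j))}
        have hc : {a | δ < frac (· ∈ avoiders R (F i a) fun j => allowed R F g (i, j))}ᶜ =
          {a | frac (· ∈ avoiders R (F i a) fun j => allowed R F g (i, j)) ≤ δ} := by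
          ext; simp
        rw [hc] at this
        omega
    _ ≤ Fintype.card I * ((2 ^ Nat.card Ω) ^ Nat.card J * δ ^ h') := by
        refine frac_exists_le fun i => ?_
        refine (frac_exists_le (ε := δ ^ h') fun Q => ?_).trans_eq (by simp)
        by_cases hQ : h' ≤ {a | frac (· ∈ avoiders R (F i a) Q) ≤ δ}.ncard
        · simp only [hQ, true_and]
          rw [Set.ncard_eq_toFinset_card'] at hQ
          refine le_trans ?_ (pow_le_pow_of_le_one h0 h1 hQ)
          refine le_trans (frac_mono fun g hg a _ => hg a) (frac_forall_le
            (p := fun a x => x ∈ avoiders R (F i a) Q) _ fun a ha => by simpa using ha)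
        · simp only [hQ, false_and, frac_false]
          positivity
    _ = _ := by simp

lemma two_pow_mul_pow_le (h0 : 0 ≤ δ) (h1 : 2 ^ 13 * δ ≤ 1) {e d n : ℕ} (he : e ≤ 13 * d)
    (hd : n ≤ d) : 2 ^ e * δ ^ d ≤ (2 ^ 13 * δ) ^ n := by
  calc 2 ^ e * δ ^ d ≤ 2 ^ (13 * d) * δ ^ d := by gcongr; norm_num
    _ = (2 ^ 13 * δ) ^ d := by rw [mul_pow, pow_mul]
    _ ≤ _ := pow_le_pow_of_le_one (by positivity) h1 hd

/-- Random functions on three families of pairs are unlikely to avoid `R` on all triples. -/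
lemma frac_forall_not_le (hR : Expanding R δ) (h0 : 0 ≤ δ) (h1 : 2 ^ 13 * δ ≤ 1) {w : ℕ}
    (hw : 1 ≤ w) (hΩ : Nat.card Ω = 8 * w) :
    frac (fun x : (Fin (8 * w) → Fin (64 * w ^ 2) → Fin (8 * w) → Ω) ×
        (Fin (64 * w ^ 2) → Fin (64 * w ^ 2) → Ω) ×
        (Fin (64 * w ^ 2) × Fin (8 * w) × Fin (8 * w) → Ω) =>
      ∀ i a j c, ¬ R (x.1 i a j) (x.2.1 c a) (x.2.2 (c, i, j))) ≤
      3 * (2 ^ 13 * δ) ^ (32 * w ^ 4) := by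
  classical
  have hδ : δ ≤ 1 := by linarith
  have w3 : w ≤ w ^ 3 := Nat.le_self_pow (by norm_num) w
  have w34 : w ^ 3 ≤ w ^ 4 := Nat.pow_le_pow_right hw (by norm_num)
  have w24 : w ^ 2 ≤ w ^ 4 := Nat.pow_le_pow_right hw (by norm_num)
  set ε := (2 ^ 13 * δ) ^ (32 * w ^ 4) with hε
  have hε0 : 0 ≤ ε := by positivity
  let E₁ (F : Fin (8 * w) → Fin (64 * w ^ 2) → Fin (8 * w) → Ω) : Prop :=
    w ≤ {i | Atypical R δ w (32 * w ^ 2) (F i)}.ncard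
  let S (F : Fin (8 * w) → Fin (64 * w ^ 2) → Fin (8 * w) → Ω)
      (G : Fin (64 * w ^ 2) → Fin (64 * w ^ 2) → Ω) :
      Set (Fin (64 * w ^ 2) × Fin (8 * w) × Fin (8 * w)) :=
    {q | δ < frac (· ∈ allowed R F (G q.1) q.2)}
  let E₂ (F : Fin (8 * w) → Fin (64 * w ^ 2) → Fin (8 * w) → Ω)
      (G : Fin (64 * w ^ 2) → Fin (64 * w ^ 2) → Ω) : Prop :=
    16 * w ^ 2 ≤ {c | 16 * w ^ 2 ≤ {p | (c, p) ∈ S F G}.ncard}.ncard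
  have b₁ : frac E₁ ≤ ε := by
    refine (frac_many_le (p := fun _ f => Atypical R δ w (32 * w ^ 2) f) (by positivity) w
      fun _ => frac_atypical_le hR h0 hδ w (32 * w ^ 2)).trans ?_
    simp only [Nat.card_eq_fintype_card, Fintype.card_fin]
    rw [hΩ]
    calc _ = 2 ^ (8 * w + 128 * w ^ 3 + 256 * w ^ 4) * δ ^ (32 * w ^ 4) := by ring
      _ ≤ ε := two_pow_mul_pow_le h0 h1 (by omega) le_rfl
  have b₂ : ∀ F, ¬ E₁ F → frac (E₂ F) ≤ ε := by
    intro F hF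
    refine (frac_many_le (p := fun _ g => 16 * w ^ 2 ≤
      {p | δ < frac (· ∈ allowed R F g p)}.ncard) (by positivity) (16 * w ^ 2)
      fun _ => frac_many_allowed_le (h' := 32 * w ^ 2) h0 hδ F (not_le.1 hF)
        (by simp; omega) (by simp; nlinarith) (by simp; omega)).trans ?_
    simp only [Nat.card_eq_fintype_card, Fintype.card_fin]
    rw [hΩ]
    have h8 : ((8 * w : ℕ) : ℝ) ≤ 2 ^ (8 * w) := by exact_mod_cast Nat.lt_two_pow_self.le
    calc _ ≤ (2 : ℝ) ^ (64 * w ^ 2) * (2 ^ (8 * w) * ((2 ^ (8 * w)) ^ (8 * w) *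
          δ ^ (32 * w ^ 2))) ^ (16 * w ^ 2) := by gcongr
      _ = 2 ^ (64 * w ^ 2 + 128 * w ^ 3 + 1024 * w ^ 4) * δ ^ (512 * w ^ 4) := by ring
      _ ≤ ε := two_pow_mul_pow_le h0 h1 (by omega) (by omega)
  have b₃ : ∀ F G, ¬ E₂ F G → frac (fun L : Fin (64 * w ^ 2) × Fin (8 * w) × Fin (8 * w) → Ω =>
      ∀ q, L q ∈ allowed R F (G q.1) q.2) ≤ ε := by
    intro F G hG
    have hS : (S F G).ncard < 2048 * w ^ 4 := by
      by_contra! hge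
      refine hG (le_ncard_large_fibers _ (le_trans ?_ hge) (by simp; omega))
      simp
      apply le_of_eq
      ring
    have hc := Set.ncard_add_ncard_compl (S F G)
    have hcard : Nat.card (Fin (64 * w ^ 2) × Fin (8 * w) × Fin (8 * w)) = 4096 * w ^ 4 := by
      simp
      ring
    rw [hcard] at hc
    refine (frac_mono fun L hL q _ => hL q).trans ((frac_forall_le
      (p := fun q x => x ∈ allowed R F (G q.1) q.2) (S F G)ᶜ.toFinset (ε := δ)
      fun q hq => by simpa [S] using hq).trans ?_)
    rw [← Set.ncard_eq_toFinset_card']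
    calc δ ^ (S F G)ᶜ.ncard = 2 ^ 0 * δ ^ (S F G)ᶜ.ncard := by simp
      _ ≤ ε := two_pow_mul_pow_le h0 h1 (by omega) (by omega)
  calc _ ≤ frac (fun x : (Fin (8 * w) → Fin (64 * w ^ 2) → Fin (8 * w) → Ω) ×
        (Fin (64 * w ^ 2) → Fin (64 * w ^ 2) → Ω) ×
        (Fin (64 * w ^ 2) × Fin (8 * w) × Fin (8 * w) → Ω) =>
        E₁ x.1 ∨ (¬ E₁ x.1 ∧ E₂ x.1 x.2.1) ∨
          (¬ E₂ x.1 x.2.1 ∧ ∀ q, x.2.2 q ∈ allowed R x.1 (x.2.1 q.1) q.2)) := by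
        refine frac_mono fun x hx => ?_
        have : ∀ q, x.2.2 q ∈ allowed R x.1 (x.2.1 q.1) q.2 := fun q a => hx _ _ _ _
        tauto
    _ ≤ ε + (ε + ε) := by
        refine (frac_or_le _ _).trans (add_le_add ?_ ((frac_or_le _ _).trans (add_le_add ?_ ?_)))
        · exact frac_prod_le' hε0 fun _ => b₁
        · refine frac_prod_le hε0 fun F => frac_prod_le' hε0 fun L => ?_
          by_cases hF : E₁ F
          · simpa [hF, frac_false] using hε0
          · simpa [hF] using b₂ F hF
        · refine frac_prod_le hε0 fun F => frac_prod_le hε0 fun G => ?_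
          by_cases hG : E₂ F G
          · simpa [hG, frac_false] using hε0
          · simpa [hG] using b₃ F G hG
    _ = _ := by ring

end Counting
section Construction

/-- The links of all three vertices of a triple see its opposite pair as adjacent, where the
arguments hold the colors of the pairs 12, 13, 23 at their smaller and larger vertex. -/
def LinksAdj {V : Type*} (adj : V → V → Prop) (f g l : V × V) : Prop :=
  adj f.1 g.1 ∧ adj f.2 l.1 ∧ adj g.2 l.2

lemma frac_dense_fibers {V : Type*} [Finite V] {δ : ℝ} (h0 : 0 ≤ δ) {X : Set (V × V)}
    (hX : 2 * δ < frac (· ∈ X)) : δ < frac (· ∈ {x | δ < frac (fun z => (x, z) ∈ X)}) := by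
  by_contra! hlt
  refine absurd hX (not_lt.2 ?_)
  calc frac (· ∈ X)
      ≤ frac (fun q : V × V => δ < frac (fun z => (q.1, z) ∈ X) ∨
          (¬ δ < frac (fun z => (q.1, z) ∈ X) ∧ q ∈ X)) := frac_mono fun q hq => by tauto
    _ ≤ δ + δ := by
        refine (frac_or_le _ _).trans (add_le_add ?_ ?_)
        · exact frac_prod_le' h0 fun _ => hlt
        · refine frac_prod_le h0 fun x => ?_
          by_cases hx : δ < frac (fun z => (x, z) ∈ X)
          · simpa [hx, frac_false] using h0
          · simpa only [hx, not_false_eq_true, true_and] using not_lt.1 hx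
    _ = 2 * δ := by ring

lemma expanding_linksAdj {V : Type*} [Finite V] {adj : V → V → Prop} {δ : ℝ} (h0 : 0 ≤ δ)
    (h : ∀ A B : Set V, δ < frac (· ∈ A) → δ < frac (· ∈ B) → ∃ a ∈ A, ∃ b ∈ B, adj a b) :
    Expanding (LinksAdj adj) (2 * δ) := by
  intro X Y Z hX hY hZ
  obtain ⟨p, hp, x, hx, hpx⟩ := h _ _ (frac_dense_fibers h0 hX) (frac_dense_fibers h0 hY)
  have nbr : ∀ A : Set V, δ < frac (· ∈ A) → frac (fun b => ∀ a ∈ A, ¬ adj a b) ≤ δ := by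
    intro A hA
    by_contra! hlt
    obtain ⟨a, ha, b, hb, hab⟩ := h A {b | ∀ a ∈ A, ¬ adj a b} hA hlt
    exact hb a ha hab
  by_contra! hno
  refine absurd hZ (not_lt.2 ?_)
  calc frac (· ∈ Z)
      ≤ frac (fun q : V × V => (∀ a ∈ {a | (p, a) ∈ X}, ¬ adj a q.1) ∨
          (∀ a ∈ {a | (x, a) ∈ Y}, ¬ adj a q.2)) := by
        refine frac_mono fun q hq => ?_
        by_contra! hcon
        obtain ⟨⟨a, ha, haq⟩, b, hb, hbq⟩ := hcon
        exact hno (p, a) ha (x, b) hb q hq ⟨hpx, haq, hbq⟩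
    _ ≤ δ + δ := by
        refine (frac_or_le _ _).trans (add_le_add ?_ ?_)
        · exact frac_prod_le' h0 fun _ => nbr _ hp
        · exact frac_prod_le h0 fun _ => nbr _ hx
    _ = 2 * δ := by ring

/-- The restriction of a function on pairs to the pairs between three families of vertices. -/
def crossPairs {X Ω I A J C : Type*} (α : A → X) (β : I × J → X) (γ : C → X) (Ψ : X × X → Ω) :
    (I → A → J → Ω) × (C → A → Ω) × (C × I × J → Ω) :=
  (fun i a j => Ψ (α a, β (i, j)), fun c a => Ψ (α a, γ c), fun q => Ψ (β q.2, γ q.1))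

lemma frac_crossPairs_le {X Ω I A J C : Type*} [Finite X] [Finite Ω] [Finite I] [Finite A]
    [Finite J] [Finite C] {α : A → X} {β : I × J → X} {γ : C → X} (hα : α.Injective)
    (hβ : β.Injective) (hγ : γ.Injective) (hαβ : ∀ a p, α a ≠ β p) (hβγ : ∀ p c, β p ≠ γ c)
    (P : (I → A → J → Ω) × (C → A → Ω) × (C × I × J → Ω) → Prop) :
    frac (fun Ψ => P (crossPairs α β γ Ψ)) ≤ frac P := by
  let e : (I × A × J) ⊕ (C × A) ⊕ (C × I × J) → X × X :=
    Sum.elim (fun q => (α q.2.1, β (q.1, q.2.2)))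
      (Sum.elim (fun q => (α q.2, γ q.1)) (fun q => (β q.2, γ q.1)))
  have he : e.Injective := by
    rintro (⟨i, a, j⟩ | ⟨c, a⟩ | ⟨c, p⟩) (⟨i', a', j'⟩ | ⟨c', a'⟩ | ⟨c', p'⟩) h <;>
      simp [e, hα.eq_iff, hβ.eq_iff, hγ.eq_iff, hαβ, hβγ, fun a p => (hαβ a p).symm] at h ⊢ <;>
      tauto
  let E : ((I × A × J) ⊕ (C × A) ⊕ (C × I × J) → Ω) ≃
      (I → A → J → Ω) × (C → A → Ω) × (C × I × J → Ω) :=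
    { toFun := fun f => (fun i a j => f (.inl (i, a, j)), fun c a => f (.inr (.inl (c, a))),
        fun q => f (.inr (.inr q)))
      invFun := fun f => Sum.elim (fun q => f.1 q.1 q.2.1 q.2.2)
        (Sum.elim (fun q => f.2.1 q.1 q.2) f.2.2)
      left_inv := fun f => by ext (_ | _ | _) <;> rfl
      right_inv := fun f => rfl }
  calc frac (fun Ψ => P (crossPairs α β γ Ψ)) = frac (fun Ψ : X × X → Ω => P (E (Ψ ∘ e))) := rfl
    _ ≤ frac (fun f => P (E f)) := frac_comp_le he (fun f => P (E f))
    _ = frac P := frac_equiv E P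

/-- There is a coloring of pairs for which every large ordered set contains a triple in `R`. -/
lemma exists_pair_coloring {Ω : Type*} [Finite Ω] {R : Ω → Ω → Ω → Prop} {δ : ℝ}
    (hR : Expanding R δ) (h0 : 0 ≤ δ) (h1 : 2 ^ 13 * δ ≤ 1) {w N : ℕ} (hw : 1 ≤ w)
    (hΩ : Nat.card Ω = 8 * w)
    (hN : (N : ℝ) ^ (192 * w ^ 2) * (3 * (2 ^ 13 * δ) ^ (32 * w ^ 4)) < 1) :
    ∃ Ψ : Fin N × Fin N → Ω, ∀ e : Fin (192 * w ^ 2) → Fin N, StrictMono e →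
      ∃ x y z, x < y ∧ y < z ∧ R (Ψ (e x, e y)) (Ψ (e x, e z)) (Ψ (e y, e z)) := by
  classical
  have := Fintype.ofFinite Ω
  have : Nonempty Ω := (Nat.card_pos_iff.1 (by omega)).1
  by_contra! hno
  let α : Fin (64 * w ^ 2) → Fin (192 * w ^ 2) := fun a => ⟨a, by omega⟩
  have hlt : ∀ p : Fin (8 * w) × Fin (8 * w), (finProdFinEquiv p : ℕ) < 64 * w ^ 2 :=
    fun p => (finProdFinEquiv p).2.trans_eq (by ring)
  let β : Fin (8 * w) × Fin (8 * w) → Fin (192 * w ^ 2) :=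
    fun p => ⟨64 * w ^ 2 + finProdFinEquiv p, by have := hlt p; omega⟩
  let γ : Fin (64 * w ^ 2) → Fin (192 * w ^ 2) := fun c => ⟨128 * w ^ 2 + c, by omega⟩
  have hα : α.Injective := fun a b h => by simpa [α, Fin.ext_iff] using h
  have hβ : β.Injective := fun a b h => by
    simpa only [β, Fin.mk.injEq, Nat.add_left_cancel_iff, Fin.val_inj,
      EmbeddingLike.apply_eq_iff_eq] using h
  have hγ : γ.Injective := fun a b h => by simpa [γ, Fin.ext_iff] using h
  have hαβ : ∀ a p, α a < β p := fun a p => by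
    simp only [α, β, Fin.lt_def]
    omega
  have hβγ : ∀ p c, β p < γ c := fun p c => by
    have := hlt p
    simp only [β, γ, Fin.lt_def]
    omega
  refine absurd hN (not_lt.2 ?_)
  calc (1 : ℝ) = frac (fun _ : Fin N × Fin N → Ω => True) := by simp [frac]
    _ ≤ frac (fun Ψ : Fin N × Fin N → Ω => ∃ e : Fin (192 * w ^ 2) → Fin N, StrictMono e ∧
        ∀ i a j c, ¬ R ((crossPairs (e ∘ α) (e ∘ β) (e ∘ γ) Ψ).1 i a j)
          ((crossPairs (e ∘ α) (e ∘ β) (e ∘ γ) Ψ).2.1 c a)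
          ((crossPairs (e ∘ α) (e ∘ β) (e ∘ γ) Ψ).2.2 (c, i, j))) := by
        refine frac_mono fun Ψ _ => ?_
        obtain ⟨e, he, h⟩ := hno Ψ
        exact ⟨e, he, fun i a j c => h _ _ _ (hαβ a (i, j)) (hβγ (i, j) c)⟩
    _ ≤ Fintype.card (Fin (192 * w ^ 2) → Fin N) * (3 * (2 ^ 13 * δ) ^ (32 * w ^ 4)) := by
        refine frac_exists_le fun e => ?_
        by_cases he : StrictMono e
        · simp only [he, true_and]
          refine le_trans ?_ (frac_forall_not_le hR h0 h1 hw hΩ)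
          exact frac_crossPairs_le (he.injective.comp hα) (he.injective.comp hβ)
            (he.injective.comp hγ) (fun a p => (he (hαβ a p)).ne) (fun p c => (he (hβγ p c)).ne)
            (fun x => ∀ i a j c, ¬ R (x.1 i a j) (x.2.1 c a) (x.2.2 (c, i, j)))
        · simp only [he, false_and, frac_false]
          positivity
    _ = _ := by simp

/-- The color of `v` in the link of `u`. -/
def linkColor {V : Type*} {N : ℕ} (Ψ : Fin N × Fin N → V × V) (u v : Fin N) : V :=
  if u < v then (Ψ (u, v)).1 else (Ψ (v, u)).2

open Classical in
/-- The 3-graph in which the link of each vertex `u` is pulled back from `adj` by the coloring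
`linkColor Ψ u`. -/
noncomputable def linkGraph {V : Type*} (adj : V → V → Prop) {N : ℕ}
    (Ψ : Fin N × Fin N → V × V) : ThreeGraph where
  n := N
  edges := Finset.univ.filter fun e => e.card = 3 ∧ ∀ u ∈ e, ∀ v ∈ e, ∀ w ∈ e,
    u ≠ v → u ≠ w → v ≠ w → adj (linkColor Ψ u v) (linkColor Ψ u w)
  card_eq := fun _ he => (Finset.mem_filter.1 he).2.1

open Classical in
lemma mem_linkGraph_edges {V : Type*} {adj : V → V → Prop} {N : ℕ} {Ψ : Fin N × Fin N → V × V}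
    {e : Finset (Fin N)} : e ∈ (linkGraph adj Ψ).edges ↔ e.card = 3 ∧ ∀ u ∈ e, ∀ v ∈ e, ∀ w ∈ e,
      u ≠ v → u ≠ w → v ≠ w → adj (linkColor Ψ u v) (linkColor Ψ u w) := by
  unfold linkGraph
  rw [Finset.mem_filter]
  simp only [Finset.mem_univ, true_and]

lemma card_edges_linkGraph_le {V : Type*} (adj : V → V → Prop) {N : ℕ}
    (Ψ : Fin N × Fin N → V × V) : (linkGraph adj Ψ).edges.card ≤ N ^ 3 := by
  classical
  calc (linkGraph adj Ψ).edges.card ≤ (Finset.powersetCard 3 (Finset.univ : Finset (Fin N))).card :=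
        Finset.card_le_card fun e he =>
          Finset.mem_powersetCard.2 ⟨Finset.subset_univ e, (linkGraph adj Ψ).card_eq e he⟩
    _ ≤ N ^ 3 := by simpa using Nat.choose_le_pow N 3

lemma linkGraph_free {V : Type*} {adj : V → V → Prop}
    (htri : ∀ x y z, adj x y → adj x z → ¬ adj y z) {N : ℕ} (Ψ : Fin N × Fin N → V × V) :
    (linkGraph adj Ψ).Free K4minus := by
  rintro ⟨f, hf⟩
  let g : Fin 4 ↪ Fin N := f
  have hg : ∀ e ∈ ({{0, 1, 2}, {0, 1, 3}, {0, 2, 3}} : Finset (Finset (Fin 4))),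
      e.image g ∈ (linkGraph adj Ψ).edges := hf
  have key : ∀ i j : Fin 4, i ≠ j → i ≠ 0 → j ≠ 0 →
      {0, i, j} ∈ ({{0, 1, 2}, {0, 1, 3}, {0, 2, 3}} : Finset (Finset (Fin 4))) →
      adj (linkColor Ψ (g 0) (g i)) (linkColor Ψ (g 0) (g j)) := by
    intro i j hij hi hj hmem
    exact (mem_linkGraph_edges.1 (hg _ hmem)).2
      (g 0) (Finset.mem_image_of_mem g (by simp)) (g i) (Finset.mem_image_of_mem g (by simp))
      (g j) (Finset.mem_image_of_mem g (by simp))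
      (by simpa using hi.symm) (by simpa using hj.symm) (by simpa using hij)
  exact htri _ _ _ (key 1 2 (by decide) (by decide) (by decide) (by decide))
    (key 1 3 (by decide) (by decide) (by decide) (by decide))
    (key 2 3 (by decide) (by decide) (by decide) (by decide))

lemma mem_edges_linkGraph {V : Type*} {adj : V → V → Prop} (hsymm : ∀ x y, adj x y → adj y x)
    {N : ℕ} {Ψ : Fin N × Fin N → V × V} {x y z : Fin N} (hxy : x < y) (hyz : y < z)
    (h : LinksAdj adj (Ψ (x, y)) (Ψ (x, z)) (Ψ (y, z))) :
    ({x, y, z} : Finset (Fin N)) ∈ (linkGraph adj Ψ).edges := by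
  have hxz := hxy.trans hyz
  refine mem_linkGraph_edges.2 ⟨?_, ?_⟩
  · exact Finset.card_eq_three.2 ⟨x, y, z, hxy.ne, hxz.ne, hyz.ne, rfl⟩
  obtain ⟨h1, h2, h3⟩ := h
  have e1 : linkColor Ψ x y = (Ψ (x, y)).1 := if_pos hxy
  have e2 : linkColor Ψ x z = (Ψ (x, z)).1 := if_pos hxz
  have e3 : linkColor Ψ y z = (Ψ (y, z)).1 := if_pos hyz
  have e4 : linkColor Ψ y x = (Ψ (x, y)).2 := if_neg hxy.not_gt
  have e5 : linkColor Ψ z x = (Ψ (x, z)).2 := if_neg hxz.not_gt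
  have e6 : linkColor Ψ z y = (Ψ (y, z)).2 := if_neg hyz.not_gt
  intro u hu v hv t ht huv hut hvt
  simp only [Finset.mem_insert, Finset.mem_singleton] at hu hv ht
  rcases hu with rfl | rfl | rfl <;> rcases hv with rfl | rfl | rfl <;>
    rcases ht with rfl | rfl | rfl <;> first
      | exact absurd rfl ‹_›
      | (simp only [e1, e2, e3, e4, e5, e6]; first | assumption | (apply hsymm; assumption))

lemma not_colorable_linkGraph {V : Type*} {adj : V → V → Prop}
    (hsymm : ∀ x y, adj x y → adj y x) {N m r : ℕ} {Ψ : Fin N × Fin N → V × V} (hr : 0 < r)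
    (hN : r * m ≤ N)
    (h : ∀ e : Fin m → Fin N, StrictMono e → ∃ x y z, x < y ∧ y < z ∧
      LinksAdj adj (Ψ (e x, e y)) (Ψ (e x, e z)) (Ψ (e y, e z))) :
    ¬ (linkGraph adj Ψ).Colorable r := by
  classical
  rintro ⟨c, hc⟩
  change Fin N → Fin r at c
  have : Nonempty (Fin r) := ⟨⟨0, hr⟩⟩
  obtain ⟨i, hi⟩ := Fintype.exists_le_card_fiber_of_mul_le_card (f := c) (n := m) (by simpa)
  obtain ⟨S, hS, hcard⟩ := Finset.exists_subset_card_eq hi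
  obtain ⟨x, y, z, hxy, hyz, hR⟩ := h _ (S.orderEmbOfFin hcard).strictMono
  have mono := (S.orderEmbOfFin hcard).strictMono
  have col : ∀ k, c (S.orderEmbOfFin hcard k) = i := fun k => by
    simpa using hS (S.orderEmbOfFin_mem hcard k)
  obtain ⟨u, hu, v, hv, huv⟩ := hc _ (mem_edges_linkGraph hsymm (mono hxy) (mono hyz) hR)
  have col' : ∀ u : Fin N, u ∈ ({S.orderEmbOfFin hcard x, S.orderEmbOfFin hcard y,
      S.orderEmbOfFin hcard z} : Finset (Fin N)) → c u = i := by
    intro u hu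
    simp only [Finset.mem_insert, Finset.mem_singleton] at hu
    rcases hu with rfl | rfl | rfl <;> exact col _
  exact huv ((col' u hu).trans (col' v hv).symm)

end Construction
section Asymptotics

lemma pow_mul_three_mul_pow_lt_one {x p q : ℝ} (hx : 0 ≤ x) (hp : 0 ≤ p) (hpq : p ≤ q) {w : ℕ}
    (hw : 1 ≤ w) (h : x ^ 6 * q ^ w ^ 2 ≤ 1 / 4) :
    x ^ (192 * w ^ 2) * (3 * p ^ (32 * w ^ 4)) < 1 := by
  have hq := hp.trans hpq
  have hexp : x ^ (192 * w ^ 2) * q ^ (32 * w ^ 4) = (x ^ 6 * q ^ w ^ 2) ^ (32 * w ^ 2) := by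
    rw [mul_pow, ← pow_mul, ← pow_mul]
    congr 2 <;> ring
  calc x ^ (192 * w ^ 2) * (3 * p ^ (32 * w ^ 4))
      ≤ x ^ (192 * w ^ 2) * (3 * q ^ (32 * w ^ 4)) := by gcongr
    _ = 3 * (x ^ 6 * q ^ w ^ 2) ^ (32 * w ^ 2) := by rw [mul_left_comm, hexp]
    _ ≤ 3 * (1 / 4) ^ (32 * w ^ 2) := by gcongr
    _ ≤ 3 * (1 / 4) ^ 1 := by
      gcongr 3 * ?_
      exact pow_le_pow_of_le_one (by norm_num) (by norm_num) (by nlinarith)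
    _ < 1 := by norm_num

lemma four_mul_pow_six_le {j r u : ℕ} (hu : 100 ≤ u) (hj : 14 ≤ j) (hr : r ≤ 2 ^ (j * u)) :
    4 * (r * (3 * 2 ^ (120 * j))) ^ 6 ≤ 2 ^ (j * (16 * u)) := calc
  4 * (r * (3 * 2 ^ (120 * j))) ^ 6 ≤ 4 * (2 ^ (j * u) * (4 * 2 ^ (120 * j))) ^ 6 := by
    gcongr
    norm_num
  _ = 2 ^ (14 + 720 * j + 6 * (j * u)) := by
    rw [pow_add, pow_add, pow_mul' 2 6, mul_pow, mul_pow, ← pow_mul 2 (120 * j),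
      show 120 * j * 6 = 720 * j by ring]
    ring
  _ ≤ 2 ^ (j * (16 * u)) := Nat.pow_le_pow_right (by norm_num) (by nlinarith)

lemma exists_free_not_colorable {j r : ℕ} (hj : 14 ≤ j) (hr : 0 < r)
    (hrj : r ≤ 2 ^ (j * 2 ^ (120 * j - 10))) :
    ∃ G : ThreeGraph, G.Free K4minus ∧ ¬ G.Colorable r ∧
      G.edges.card ≤ (r * (3 * 2 ^ (120 * j))) ^ 3 := by
  obtain ⟨u, hu⟩ : ∃ u, u = 2 ^ (120 * j - 10) := ⟨_, rfl⟩
  obtain ⟨w, hw⟩ : ∃ w, w = 2 ^ (60 * j - 3) := ⟨_, rfl⟩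
  have hw1 : 1 ≤ w := hw ▸ Nat.one_le_two_pow
  have hw2 : w ^ 2 = 16 * u := by
    rw [hw, hu, ← pow_mul, show (60 * j - 3) * 2 = 4 + (120 * j - 10) by omega, pow_add]
    norm_num
  have hm : 192 * w ^ 2 = 3 * 2 ^ (120 * j) := by
    rw [hw2, hu, show 120 * j = 10 + (120 * j - 10) by omega, pow_add]
    simp
    ring
  have hu100 : 100 ≤ u := by
    rw [hu]
    exact (by norm_num : 100 ≤ 2 ^ 7).trans (Nat.pow_le_pow_right (by norm_num) (by omega))
  rw [← hu] at hrj
  rw [← hm]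
  set δ : ℝ := (27 / 32) ^ (10 * j) with hδ
  have hδ0 : 0 ≤ δ := by positivity
  have hη : 2 ^ 13 * (2 * δ) ≤ (1 / 2) ^ j := by
    have h1 : δ ≤ (1 / 4) ^ j := by
      rw [hδ, pow_mul]
      gcongr
      norm_num
    have h2 : (2 : ℝ) ^ 14 ≤ 2 ^ j := pow_le_pow_right₀ (by norm_num) hj
    calc 2 ^ 13 * (2 * δ) = 2 ^ 14 * δ := by ring
      _ ≤ 2 ^ j * (1 / 4) ^ j := by gcongr
      _ = (1 / 2) ^ j := by rw [← mul_pow]; norm_num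
  have hη1 : 2 ^ 13 * (2 * δ) ≤ 1 := hη.trans (pow_le_one₀ (by norm_num) (by norm_num))
  have hΩ : Nat.card ((Fin (3 * (10 * j)) → Bool) × (Fin (3 * (10 * j)) → Bool)) = 8 * w := by
    rw [hw, show 8 = 2 ^ 3 by norm_num, ← pow_add]
    simp only [Nat.card_eq_fintype_card, Fintype.card_prod, Fintype.card_fun, Fintype.card_fin,
      Fintype.card_bool, ← pow_add]
    congr 1
    omega
  obtain ⟨N, hN⟩ : ∃ N, N = r * (192 * w ^ 2) := ⟨_, rfl⟩
  have hN6 : 4 * N ^ 6 ≤ 2 ^ (j * w ^ 2) := by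
    rw [hN, hm, hw2]
    exact four_mul_pow_six_le hu100 hj hrj
  have hlt : (N : ℝ) ^ (192 * w ^ 2) * (3 * (2 ^ 13 * (2 * δ)) ^ (32 * w ^ 4)) < 1 := by
    refine pow_mul_three_mul_pow_lt_one (Nat.cast_nonneg N) (by positivity) hη hw1 ?_
    have h2 : (4 : ℝ) * N ^ 6 ≤ 2 ^ (j * w ^ 2) := by exact_mod_cast hN6
    rw [← pow_mul, one_div, inv_pow, ← div_eq_mul_inv, div_le_iff₀ (by positivity)]
    linarith
  rw [← hN]
  obtain ⟨Ψ, hΨ⟩ := exists_pair_coloring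
    (expanding_linksAdj hδ0 (hδ ▸ exists_farApart (k := 10 * j))) (by positivity) hη1 hw1 hΩ hlt
  have hfree := linkGraph_free (adj := FarApart) (fun _ _ _ => not_farApart_triangle) Ψ
  have hcol := not_colorable_linkGraph (fun _ _ => FarApart.symm) hr hN.ge hΨ
  exact ⟨linkGraph FarApart Ψ, hfree, hcol, card_edges_linkGraph_le FarApart Ψ⟩

lemma one_lt_log_of_three_le {r : ℕ} (hr : 3 ≤ r) : 1 < Real.log r := by
  rw [Real.lt_log_iff_exp_lt (by positivity)]
  have : (3 : ℝ) ≤ r := by exact_mod_cast hr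
  linarith [Real.exp_one_lt_d9]

lemma two_pow_le_log_div_log_log {j r : ℕ} (hj : 2 ≤ j) (hr : 3 ≤ r)
    (hlow : 2 ^ ((j - 1) * 2 ^ (120 * (j - 1) - 10)) < r)
    (hup : r ≤ 2 ^ (j * 2 ^ (120 * j - 10))) :
    (2 : ℝ) ^ (120 * j) ≤ 2 ^ 140 * (Real.log r / Real.log (Real.log r)) := by
  have hL := one_lt_log_of_three_le hr
  have hLL : 0 < Real.log (Real.log r) := Real.log_pos hL
  have hj1 : ((j - 1 : ℕ) : ℝ) = j - 1 := by push_cast [show 1 ≤ j by omega]; ring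
  have hj2 : (2 : ℝ) ≤ j := by exact_mod_cast hj
  have hl2 := Real.log_two_gt_d9
  have hl2' := Real.log_two_lt_d9
  have h1 : ((j : ℝ) - 1) * 2 ^ (120 * (j - 1) - 10) * Real.log 2 ≤ Real.log r := by
    rw [← hj1]
    have : ((2 : ℝ) ^ ((j - 1) * 2 ^ (120 * (j - 1) - 10))) ≤ r := by exact_mod_cast hlow.le
    simpa [Real.log_pow] using Real.log_le_log (by positivity) this
  have h2 : Real.log r ≤ 2 ^ (121 * j) := by
    have h3 : (r : ℝ) ≤ 2 ^ (j * 2 ^ (120 * j - 10)) := by exact_mod_cast hup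
    have h4 : Real.log r ≤ j * 2 ^ (120 * j - 10) * Real.log 2 := by
      simpa [Real.log_pow] using Real.log_le_log (by positivity) h3
    have h5 : (j : ℝ) ≤ 2 ^ j := by exact_mod_cast Nat.lt_two_pow_self.le
    calc Real.log r ≤ j * 2 ^ (120 * j - 10) * Real.log 2 := h4
      _ ≤ 2 ^ j * 2 ^ (120 * j) * 1 := by
        gcongr
        · norm_num
        · omega
        · linarith
      _ = 2 ^ (121 * j) := by ring
  have h3 : Real.log (Real.log r) ≤ 121 * j := by
    have := Real.log_le_log (by positivity) h2
    rw [Real.log_pow] at this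
    push_cast at this
    nlinarith
  have h4 : (2 : ℝ) ^ (120 * j) = 2 ^ 130 * 2 ^ (120 * (j - 1) - 10) := by
    rw [← pow_add]
    congr 1
    omega
  rw [← mul_div_assoc, le_div_iff₀ hLL, h4]
  have hX : (0 : ℝ) < 2 ^ (120 * (j - 1) - 10) := by positivity
  generalize (2 : ℝ) ^ (120 * (j - 1) - 10) = X at *
  have h5 : (121 : ℝ) * j ≤ 2 ^ 10 * (((j : ℝ) - 1) * Real.log 2) := by nlinarith
  calc 2 ^ 130 * X * Real.log (Real.log r) ≤ 2 ^ 130 * X * (121 * j) := by gcongr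
    _ ≤ 2 ^ 130 * X * (2 ^ 10 * (((j : ℝ) - 1) * Real.log 2)) := by gcongr
    _ = 2 ^ 140 * (((j : ℝ) - 1) * X * Real.log 2) := by ring
    _ ≤ _ := by gcongr

end Asymptotics

/-- There is a constant `C > 0` such that
`m_{K_4^-}(r) ≤ C·r^3·(ln r / ln ln r)^3` for all `r ≥ 3`. -/
theorem mH_K4minus_upper :
    ∃ C : ℝ, 0 < C ∧ ∀ r : ℕ, 3 ≤ r →
      ∃ G : ThreeGraph, G.Free K4minus ∧ ¬ G.Colorable r ∧
        (G.edges.card : ℝ) ≤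
          C * (r : ℝ) ^ 3 * (Real.log r / Real.log (Real.log r)) ^ 3 := by
  refine ⟨(3 * 2 ^ (120 * 14)) ^ 3, by positivity, fun r hr => ?_⟩
  have hex : ∃ j, 14 ≤ j ∧ r ≤ 2 ^ (j * 2 ^ (120 * j - 10)) := by
    refine ⟨r + 14, by omega, Nat.lt_two_pow_self.le.trans
      (Nat.pow_le_pow_right (by norm_num) ?_)⟩
    exact (Nat.le_add_right r 14).trans (Nat.le_mul_of_pos_right _ (by positivity))
  obtain ⟨hj, hup⟩ := Nat.find_spec hex
  have hmin := fun i => Nat.find_min (m := i) hex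
  generalize Nat.find hex = j at hj hup hmin
  have hL := one_lt_log_of_three_le hr
  have hLL : 0 < Real.log (Real.log r) := Real.log_pos hL
  have key : (2 : ℝ) ^ (120 * j) ≤ 2 ^ (120 * 14) * (Real.log r / Real.log (Real.log r)) := by
    rcases hj.eq_or_lt with rfl | hlt
    · refine le_mul_of_one_le_right (by positivity) ((one_le_div hLL).2 ?_)
      linarith [Real.log_le_sub_one_of_pos (zero_lt_one.trans hL)]
    · have hlow := hmin (j - 1) (by omega)
      refine (two_pow_le_log_div_log_log (by omega) hr (by grind) hup).trans ?_
      gcongr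
      · norm_num
      · norm_num
  obtain ⟨G, hfree, hcol, hcard⟩ := exists_free_not_colorable hj (by omega) hup
  refine ⟨G, hfree, hcol, ?_⟩
  calc (G.edges.card : ℝ) ≤ (r * (3 * 2 ^ (120 * j))) ^ 3 := by exact_mod_cast hcard
    _ ≤ (r * (3 * (2 ^ (120 * 14) * (Real.log r / Real.log (Real.log r))))) ^ 3 := by gcongr
    _ = _ := by
      generalize (2 : ℝ) ^ (120 * 14) = K
      ring
end

section
/- For every ε > 0 there exists a constant c > 0 such that for all integers r ≥ 2 one has m_{K_4}(r) ≥ c·r^3·(ln r)^{1/2−ε}. -/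
/-- `K_4`: the complete 3-graph on 4 vertices. -/
def K4 : ThreeGraph where
  n := 4
  edges := {({0, 1, 2} : Finset (Fin 4)), {0, 1, 3}, {0, 2, 3}, {1, 2, 3}}
  card_eq := by decide

namespace ThreeGraph

variable {G : ThreeGraph}

/-- The triple `a, b, c` is an edge of `G`. -/
def IsEdge (G : ThreeGraph) (a b c : Fin G.n) : Prop :=
  ({a, b, c} : Finset (Fin G.n)) ∈ G.edges

theorem IsEdge.ne {a b c : Fin G.n} (h : G.IsEdge a b c) : a ≠ b ∧ a ≠ c ∧ b ≠ c := by
  have h3 := G.card_eq _ h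
  have h2 : ({b, c} : Finset (Fin G.n)).card ≤ 2 := Finset.card_le_two
  refine ⟨fun hab => ?_, fun hac => ?_, fun hbc => ?_⟩
  · rw [hab, Finset.insert_eq_of_mem (by simp)] at h3
    omega
  · rw [hac, Finset.insert_eq_of_mem (by simp)] at h3
    omega
  · rw [hbc, Finset.pair_eq_singleton] at h3
    have := Finset.card_le_two (a := a) (b := c)
    omega

theorem IsEdge.swap_left {a b c : Fin G.n} (h : G.IsEdge a b c) : G.IsEdge b a c := by
  unfold IsEdge at *
  rwa [Finset.insert_comm]

theorem IsEdge.swap_right {a b c : Fin G.n} (h : G.IsEdge a b c) : G.IsEdge a c b := by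
  unfold IsEdge at *
  rwa [Finset.pair_comm]

theorem exists_isEdge {e : Finset (Fin G.n)} (he : e ∈ G.edges) :
    ∃ a b c, e = {a, b, c} ∧ G.IsEdge a b c := by
  obtain ⟨a, b, c, -, -, -, rfl⟩ := Finset.card_eq_three.mp (G.card_eq e he)
  exact ⟨a, b, c, rfl, he⟩

theorem indepSet_of_not_isEdge {S : Finset (Fin G.n)}
    (h : ∀ a ∈ S, ∀ b ∈ S, ∀ c ∈ S, ¬ G.IsEdge a b c) : G.IndepSet S := by
  intro e he hS
  obtain ⟨a, b, c, rfl, h'⟩ := exists_isEdge he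
  exact h a (hS (by simp)) b (hS (by simp)) c (hS (by simp)) h'

theorem Free.not_isEdge (hG : G.Free K4) {a b c d : Fin G.n} (habc : G.IsEdge a b c)
    (habd : G.IsEdge a b d) (hacd : G.IsEdge a c d) : ¬ G.IsEdge b c d := by
  intro hbcd
  obtain ⟨h1, h2, h3⟩ := habc.ne
  obtain ⟨-, h4, h5⟩ := habd.ne
  obtain ⟨-, -, h6⟩ := hacd.ne
  have hinj : Function.Injective (![a, b, c, d] : Fin 4 → Fin G.n) := by
    intro i j hij
    fin_cases i <;> fin_cases j <;> simp_all [eq_comm]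
  have himage : ∀ e ∈ ({({0, 1, 2} : Finset (Fin 4)), {0, 1, 3}, {0, 2, 3}, {1, 2, 3}} :
      Finset (Finset (Fin 4))), e.image ![a, b, c, d] ∈ G.edges := by
    intro e he
    simp only [Finset.mem_insert, Finset.mem_singleton] at he
    rcases he with rfl | rfl | rfl | rfl
    · simpa [Finset.image_insert, IsEdge] using habc
    · simpa [Finset.image_insert, IsEdge] using habd
    · simpa [Finset.image_insert, IsEdge] using hacd
    · simpa [Finset.image_insert, IsEdge] using hbcd
  exact hG ⟨⟨![a, b, c, d], hinj⟩, himage⟩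

/-- A spine `A`, branches `W v` for `v ∈ A` and a reservoir `S` inside `U`: no edge meets the
spine in two vertices and has its third vertex in the spine or the reservoir, while each `v ∈ A` forms an edge
with any two vertices of `W v`, and with any vertex of `W v` and any vertex of `S`. -/
structure SpineState (G : ThreeGraph) (U A : Finset (Fin G.n))
    (W : Fin G.n → Finset (Fin G.n)) (S : Finset (Fin G.n)) : Prop where
  spine_subset : A ⊆ U
  branch_subset : ∀ v ∈ A, W v ⊆ U
  res_subset : S ⊆ U
  disj : ∀ a ∈ A, a ∉ S
  spine : ∀ a ∈ A, ∀ b ∈ A, ∀ c ∈ A, ¬ G.IsEdge a b c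
  spine_res : ∀ a ∈ A, ∀ b ∈ A, ∀ y ∈ S, ¬ G.IsEdge a b y
  branch : ∀ v ∈ A, ∀ x ∈ W v, ∀ x' ∈ W v, x ≠ x' → G.IsEdge v x x'
  branch_res : ∀ v ∈ A, ∀ x ∈ W v, ∀ y ∈ S, G.IsEdge v x y

theorem SpineState.indepSet {U A W S} (h : SpineState G U A W S) : G.IndepSet A :=
  indepSet_of_not_isEdge h.spine

theorem SpineState.indepSet_branch (hG : G.Free K4) {U A W S} (h : SpineState G U A W S)
    {v : Fin G.n} (hv : v ∈ A) : G.IndepSet (W v) := by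
  refine indepSet_of_not_isEdge fun a ha b hb c hc he => ?_
  obtain ⟨h1, h2, h3⟩ := he.ne
  exact hG.not_isEdge (h.branch v hv a ha b hb h1) (h.branch v hv a ha c hc h2)
    (h.branch v hv b hb c hc h3) he

theorem SpineState.add_branch {U A W S} (h : SpineState G U A W S) {v x : Fin G.n} (hv : v ∈ A)
    (hx : x ∈ S) {S' : Finset (Fin G.n)} (hS' : S' ⊆ S) (hE : ∀ y ∈ S', G.IsEdge v x y) :
    SpineState G U A (Function.update W v (insert x (W v))) S' where
  spine_subset := h.spine_subset
  branch_subset u hu := by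
    by_cases huv : u = v
    · subst huv
      rw [Function.update_self]
      exact Finset.insert_subset (h.res_subset hx) (h.branch_subset u hu)
    · rw [Function.update_of_ne huv]
      exact h.branch_subset u hu
  res_subset := hS'.trans h.res_subset
  disj a ha hS := h.disj a ha (hS' hS)
  spine := h.spine
  spine_res a ha b hb y hy := h.spine_res a ha b hb y (hS' hy)
  branch u hu a ha b hb hab := by
    by_cases huv : u = v
    · subst huv
      simp only [Function.update_self, Finset.mem_insert] at ha hb
      rcases ha with rfl | ha <;> rcases hb with rfl | hb
      · exact absurd rfl hab
      · exact (h.branch_res u hu b hb a hx).swap_right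
      · exact h.branch_res u hu a ha b hx
      · exact h.branch u hu a ha b hb hab
    · rw [Function.update_of_ne huv] at ha hb
      exact h.branch u hu a ha b hb hab
  branch_res u hu a ha y hy := by
    by_cases huv : u = v
    · subst huv
      simp only [Function.update_self, Finset.mem_insert] at ha
      rcases ha with rfl | ha
      · exact hE y hy
      · exact h.branch_res u hu a ha y (hS' hy)
    · rw [Function.update_of_ne huv] at ha
      exact h.branch_res u hu a ha y (hS' hy)

theorem SpineState.add_spine {U A W S} (h : SpineState G U A W S) {x : Fin G.n}
    (hx : x ∈ S) {S' : Finset (Fin G.n)} (hS' : S' ⊆ S.erase x)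
    (hE : ∀ y ∈ S', ∀ v ∈ A, ¬ G.IsEdge v x y) :
    SpineState G U (insert x A) (Function.update W x ∅) S' where
  spine_subset := Finset.insert_subset (h.res_subset hx) h.spine_subset
  branch_subset u hu := by
    by_cases hux : u = x
    · subst hux
      simp
    · rw [Function.update_of_ne hux]
      exact h.branch_subset u (Finset.mem_of_mem_insert_of_ne hu hux)
  res_subset := (hS'.trans (Finset.erase_subset _ _)).trans h.res_subset
  disj a ha hS := by
    have := Finset.mem_erase.mp (hS' hS)
    rcases Finset.mem_insert.mp ha with rfl | ha
    · exact this.1 rfl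
    · exact h.disj a ha this.2
  spine a ha b hb c hc he := by
    obtain ⟨h1, h2, h3⟩ := he.ne
    rw [Finset.mem_insert] at ha hb hc
    rcases ha with rfl | ha <;> rcases hb with rfl | hb <;> rcases hc with rfl | hc <;>
      try contradiction
    · exact h.spine_res b hb c hc a hx he.swap_left.swap_right
    · exact h.spine_res a ha c hc b hx he.swap_right
    · exact h.spine_res a ha b hb c hx he
    · exact h.spine a ha b hb c hc he
  spine_res a ha b hb y hy he := by
    obtain ⟨h1, h2, h3⟩ := he.ne
    rw [Finset.mem_insert] at ha hb
    rcases ha with rfl | ha <;> rcases hb with rfl | hb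
    · contradiction
    · exact hE y hy b hb he.swap_left
    · exact hE y hy a ha he
    · exact h.spine_res a ha b hb y (Finset.mem_of_mem_erase (hS' hy)) he
  branch u hu a ha b hb hab := by
    by_cases hux : u = x
    · subst hux
      simp at ha
    · rw [Function.update_of_ne hux] at ha hb
      exact h.branch u (Finset.mem_of_mem_insert_of_ne hu hux) a ha b hb hab
  branch_res u hu a ha y hy := by
    by_cases hux : u = x
    · subst hux
      simp at ha
    · rw [Function.update_of_ne hux] at ha
      exact h.branch_res u (Finset.mem_of_mem_insert_of_ne hu hux) a ha y
        (Finset.mem_of_mem_erase (hS' hy))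

open Classical in
theorem SpineState.exists_succ {t : ℕ} {U A W S} (h : SpineState G U A W S)
    (hA : A.card < t) (hS : 2 ≤ S.card) :
    ∃ A' W' S', SpineState G U A' W' S' ∧
      A'.card + ∑ v ∈ A', (W' v).card = A.card + ∑ v ∈ A, (W v).card + 1 ∧
      S.card ≤ 4 * t * S'.card := by
  obtain ⟨x, hx⟩ : S.Nonempty := Finset.card_pos.mp (by omega)
  have hS0 : S.card = (S.erase x).card + 1 := (Finset.card_erase_add_one hx).symm
  by_cases hc : ∃ v ∈ A, (S.erase x).card ≤ 2 * t * ((S.erase x).filter (G.IsEdge v x)).card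
  · obtain ⟨v, hv, hcard⟩ := hc
    refine ⟨A, _, (S.erase x).filter (G.IsEdge v x),
      h.add_branch hv hx ((Finset.filter_subset _ _).trans (Finset.erase_subset _ _))
      (fun y hy => (Finset.mem_filter.mp hy).2), ?_, ?_⟩
    · have hxW : x ∉ W v := fun hxW => (h.branch_res v hv x hxW x hx).ne.2.2 rfl
      rw [← Finset.add_sum_erase A _ hv, ← Finset.add_sum_erase A (fun v => (W v).card) hv]
      simp only [Function.update_self, Finset.card_insert_of_notMem hxW]
      have : ∑ u ∈ A.erase v, (Function.update W v (insert x (W v)) u).card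
          = ∑ u ∈ A.erase v, (W u).card :=
        Finset.sum_congr rfl fun u hu => by
          rw [Function.update_of_ne (Finset.ne_of_mem_erase hu)]
      rw [this]
      ring
    · linarith
  · push Not at hc
    have hxA : x ∉ A := fun hxA => h.disj x hxA hx
    refine ⟨insert x A, _, _, h.add_spine hx
      (Finset.filter_subset (fun y => ∀ v ∈ A, ¬ G.IsEdge v x y) (S.erase x))
      (fun y hy => (Finset.mem_filter.mp hy).2), ?_, ?_⟩
    · rw [Finset.sum_insert hxA, Finset.card_insert_of_notMem hxA]
      have : ∑ u ∈ A, (Function.update W x ∅ u).card = ∑ u ∈ A, (W u).card :=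
        Finset.sum_congr rfl fun u hu => by
          rw [Function.update_of_ne (ne_of_mem_of_not_mem hu hxA)]
      rw [this]
      simp
      ring
    · set S' := (S.erase x).filter (fun y => ∀ v ∈ A, ¬ G.IsEdge v x y)
      have hcover : S.erase x ⊆ S' ∪ A.biUnion fun v => (S.erase x).filter (G.IsEdge v x) := by
        intro y hy
        by_cases hy' : ∀ v ∈ A, ¬ G.IsEdge v x y
        · exact Finset.mem_union_left _ (Finset.mem_filter.mpr ⟨hy, hy'⟩)
        · push Not at hy'
          obtain ⟨v, hv, he⟩ := hy'
          exact Finset.mem_union_right _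
            (Finset.mem_biUnion.mpr ⟨v, hv, Finset.mem_filter.mpr ⟨hy, he⟩⟩)
      have h1 : (S.erase x).card ≤
          S'.card + ∑ v ∈ A, ((S.erase x).filter (G.IsEdge v x)).card :=
        (Finset.card_le_card hcover).trans
          ((Finset.card_union_le _ _).trans (Nat.add_le_add_left Finset.card_biUnion_le _))
      have h2 : 2 * t * ∑ v ∈ A, ((S.erase x).filter (G.IsEdge v x)).card
          ≤ t * (S.erase x).card := by
        rw [Finset.mul_sum]
        calc _ ≤ ∑ v ∈ A, (S.erase x).card := Finset.sum_le_sum fun v hv => (hc v hv).le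
          _ = A.card * (S.erase x).card := by simp
          _ ≤ _ := Nat.mul_le_mul_right _ hA.le
      have h3 : t * (S.erase x).card ≤ t * (2 * S'.card) := by nlinarith
      have h4 := Nat.le_of_mul_le_mul_left h3 (by omega)
      have h5 : S.card ≤ 4 * S'.card := by omega
      calc S.card ≤ 1 * (4 * S'.card) := by omega
        _ ≤ t * (4 * S'.card) := Nat.mul_le_mul_right _ (by omega)
        _ = _ := by ring

/-- In a `K_4`-free 3-graph every set of at least `2 (4t)^(t²)` vertices contains an independent
set of size at least `t`. -/
theorem Free.exists_indepSet (hG : G.Free K4) {t : ℕ} (U : Finset (Fin G.n))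
    (hU : 2 * (4 * t) ^ (t * t) ≤ U.card) :
    ∃ A : Finset (Fin G.n), A ⊆ U ∧ G.IndepSet A ∧ t ≤ A.card := by
  by_contra! hno
  have ht : 0 < t := by
    by_contra ht
    have := hno ∅ (by simp) (indepSet_of_not_isEdge (by simp))
    omega
  have key : ∀ n, 2 * (4 * t) ^ n ≤ U.card → ∃ A W S, SpineState G U A W S ∧
      A.card + ∑ v ∈ A, (W v).card = n ∧ U.card ≤ (4 * t) ^ n * S.card := by
    intro n
    induction n with
    | zero =>
      intro _
      exact ⟨∅, fun _ => ∅, U, by constructor <;> simp, by simp, by simp⟩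
    | succ n ih =>
      intro hn
      have hpos : 0 < (4 * t) ^ n := by positivity
      have hle : 2 * (4 * t) ^ n ≤ U.card := by
        refine le_trans ?_ hn
        rw [pow_succ]
        nlinarith
      obtain ⟨A, W, S, h, hcard, hUS⟩ := ih hle
      have hS : 2 ≤ S.card := by
        by_contra! hS
        have : (4 * t) ^ n * S.card ≤ (4 * t) ^ n * 1 := Nat.mul_le_mul_left _ (by omega)
        omega
      obtain ⟨A', W', S', h', hcard', hS'⟩ :=
        h.exists_succ (hno A h.spine_subset h.indepSet) hS
      refine ⟨A', W', S', h', by omega, hUS.trans ?_⟩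
      calc (4 * t) ^ n * S.card ≤ (4 * t) ^ n * (4 * t * S'.card) := Nat.mul_le_mul_left _ hS'
        _ = _ := by ring
  obtain ⟨A, W, S, h, hcard, -⟩ := key (t * t) hU
  have hA := hno A h.spine_subset h.indepSet
  have hW : ∑ v ∈ A, (W v).card ≤ A.card * (t - 1) := by
    rw [← smul_eq_mul]
    refine Finset.sum_le_card_nsmul _ _ _ fun v hv => ?_
    have := hno (W v) (h.branch_subset v hv) (h.indepSet_branch hG hv)
    omega
  obtain ⟨s, rfl⟩ : ∃ s, t = s + 1 := ⟨t - 1, by omega⟩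
  simp only [Nat.add_sub_cancel] at hW
  nlinarith

/-- The colourings with `q` colours having no monochromatic edge inside `S`. -/
def colorings (G : ThreeGraph) (q : ℕ) (S : Finset (Fin G.n)) : Finset (Fin G.n → Fin q) :=
  {c | ∀ e ∈ G.edges, e ⊆ S → ∃ u ∈ e, ∃ v ∈ e, c u ≠ c v}

theorem mem_colorings {q : ℕ} {S : Finset (Fin G.n)} {c : Fin G.n → Fin q} :
    c ∈ G.colorings q S ↔ ∀ e ∈ G.edges, e ⊆ S → ∃ u ∈ e, ∃ v ∈ e, c u ≠ c v := by
  simp [colorings]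

theorem card_colorings_filter_le {q : ℕ} {S : Finset (Fin G.n)} {u v w : Fin G.n}
    (hv : v ∉ S) (huv : u ≠ v) (hwv : w ≠ v) (hwu : w ≠ u) :
    q ^ 2 * ((G.colorings q S).filter fun c => c u = c v ∧ c w = c v).card
      ≤ (G.colorings q (S.erase u)).card := by
  set B := (G.colorings q S).filter fun c => c u = c v ∧ c w = c v
  have h : (B ×ˢ (Finset.univ : Finset (Fin q × Fin q))).card
      ≤ (G.colorings q (S.erase u)).card := by
    refine Finset.card_le_card_of_injOn
      (fun p => Function.update (Function.update p.1 u p.2.1) v p.2.2) ?_ ?_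
    · rintro ⟨c, a, b⟩ hp
      simp only [Finset.coe_product, Set.mem_prod, Finset.mem_coe] at hp ⊢
      have hc := mem_colorings.mp (Finset.mem_filter.mp hp.1).1
      refine mem_colorings.mpr fun e he heS => ?_
      obtain ⟨x, hx, y, hy, hxy⟩ := hc e he (heS.trans (Finset.erase_subset _ _))
      have aux : ∀ z ∈ e, Function.update (Function.update c u a) v b z = c z := by
        intro z hz
        have hz' := Finset.mem_erase.mp (heS hz)
        rw [Function.update_of_ne (ne_of_mem_of_not_mem hz'.2 hv), Function.update_of_ne hz'.1]
      exact ⟨x, hx, y, hy, by rwa [aux x hx, aux y hy]⟩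
    · rintro ⟨c, a, b⟩ hp ⟨c', a', b'⟩ hp' heq
      simp only [Finset.coe_product, Set.mem_prod, Finset.mem_coe] at hp hp' heq
      obtain ⟨h1, h2⟩ := (Finset.mem_filter.mp hp.1).2
      obtain ⟨h1', h2'⟩ := (Finset.mem_filter.mp hp'.1).2
      have hb : b = b' := by simpa using congrFun heq v
      have ha : a = a' := by simpa [huv] using congrFun heq u
      have hw : c w = c' w := by simpa [hwv, hwu] using congrFun heq w
      have hc : c = c' := by
        funext x
        by_cases hxv : x = v
        · subst hxv
          rw [← h2, ← h2', hw]
        by_cases hxu : x = u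
        · subst hxu
          rw [h1, h1', ← h2, ← h2', hw]
        simpa [hxv, hxu] using congrFun heq x
      rw [hc, ha, hb]
  rw [Finset.card_product, Finset.card_univ, Fintype.card_prod, Fintype.card_fin] at h
  linarith

theorem card_colorings_le_insert {q : ℕ} (hq : 0 < q) {S : Finset (Fin G.n)} {v : Fin G.n}
    (hv : v ∉ S) (hdeg : 4 * G.degree v ≤ q ^ 2)
    (hS : ∀ u ∈ S, (G.colorings q (S.erase u)).card ≤ 2 * (G.colorings q S).card) :
    (G.colorings q S).card ≤ 2 * (G.colorings q (insert v S)).card := by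
  set E := G.edges.filter fun e => v ∈ e
  set bad : Finset (Fin G.n) → Finset (Fin G.n → Fin q) := fun e =>
    (G.colorings q S).filter fun c => e ⊆ insert v S ∧ ∀ a ∈ e, c a = c v
  have hcover : G.colorings q S ⊆ G.colorings q (insert v S) ∪ E.biUnion bad := by
    intro c hc
    by_cases hc' : c ∈ G.colorings q (insert v S)
    · exact Finset.mem_union_left _ hc'
    refine Finset.mem_union_right _ ?_
    rw [mem_colorings] at hc'
    push Not at hc'
    obtain ⟨e, he, heS, hmono⟩ := hc'
    have hve : v ∈ e := by
      by_contra hve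
      obtain ⟨x, hx, y, hy, hxy⟩ :=
        mem_colorings.mp hc e he ((Finset.subset_insert_iff_of_notMem hve).mp heS)
      exact hxy (hmono x hx y hy)
    exact Finset.mem_biUnion.mpr ⟨e, Finset.mem_filter.mpr ⟨he, hve⟩,
      Finset.mem_filter.mpr ⟨hc, heS, fun a ha => hmono a ha v hve⟩⟩
  have hbad : ∀ e ∈ E, q ^ 2 * (bad e).card ≤ 2 * (G.colorings q S).card := by
    intro e he
    obtain ⟨he, hve⟩ := Finset.mem_filter.mp he
    by_cases heS : e ⊆ insert v S
    swap
    · simp [bad, heS]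
    have h2 : (e.erase v).card = 2 := by
      rw [Finset.card_erase_of_mem hve, G.card_eq e he]
    obtain ⟨u, w, huw, heq⟩ := Finset.card_eq_two.mp h2
    have hu : u ∈ e.erase v := by simp [heq]
    have hw : w ∈ e.erase v := by simp [heq]
    obtain ⟨huv, hu⟩ := Finset.mem_erase.mp hu
    obtain ⟨hwv, hw⟩ := Finset.mem_erase.mp hw
    have hsub : bad e ⊆ (G.colorings q S).filter fun c => c u = c v ∧ c w = c v := by
      intro c hc
      obtain ⟨hc, -, h⟩ := Finset.mem_filter.mp hc
      exact Finset.mem_filter.mpr ⟨hc, h u hu, h w hw⟩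
    calc q ^ 2 * (bad e).card ≤ q ^ 2 * _ := Nat.mul_le_mul_left _ (Finset.card_le_card hsub)
      _ ≤ _ := card_colorings_filter_le hv huv hwv huw.symm
      _ ≤ _ := hS u (Finset.mem_of_mem_insert_of_ne (heS hu) huv)
  have h1 : (G.colorings q S).card ≤
      (G.colorings q (insert v S)).card + ∑ e ∈ E, (bad e).card :=
    (Finset.card_le_card hcover).trans
      ((Finset.card_union_le _ _).trans (Nat.add_le_add_left Finset.card_biUnion_le _))
  have h2 : q ^ 2 * ∑ e ∈ E, (bad e).card ≤ G.degree v * (2 * (G.colorings q S).card) := by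
    rw [Finset.mul_sum, ← smul_eq_mul (G.degree v)]
    exact Finset.sum_le_card_nsmul _ _ _ hbad
  have hq2 : 0 < q ^ 2 := by positivity
  refine Nat.le_of_mul_le_mul_left (c := q ^ 2) ?_ hq2
  have h3 := Nat.mul_le_mul_left (q ^ 2) h1
  have h4 := Nat.mul_le_mul_right (G.colorings q S).card hdeg
  nlinarith

theorem colorings_nonempty {q : ℕ} (hq : 0 < q) {L : Finset (Fin G.n)}
    (hL : ∀ v ∈ L, 4 * G.degree v ≤ q ^ 2) : (G.colorings q L).Nonempty := by
  have key : ∀ k, ∀ S ⊆ L, S.card = k → ∀ v ∈ L, v ∉ S →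
      (G.colorings q S).card ≤ 2 * (G.colorings q (insert v S)).card := by
    intro k
    induction k with
    | zero =>
      intro S hS hk v hv hvS
      obtain rfl := Finset.card_eq_zero.mp hk
      exact card_colorings_le_insert hq hvS (hL v hv) (by simp)
    | succ k ih =>
      intro S hS hk v hv hvS
      refine card_colorings_le_insert hq hvS (hL v hv) fun u hu => ?_
      have := ih (S.erase u) ((Finset.erase_subset _ _).trans hS)
        (by rw [Finset.card_erase_of_mem hu]; omega) u (hS hu) (Finset.notMem_erase _ _)
      rwa [Finset.insert_erase hu] at this
  suffices h : ∀ S ⊆ L, 0 < (G.colorings q S).card from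
    Finset.card_pos.mp (h L subset_rfl)
  intro S
  induction S using Finset.induction_on with
  | empty =>
    intro _
    refine Finset.card_pos.mpr ⟨fun _ => ⟨0, hq⟩, mem_colorings.mpr fun e he h => ?_⟩
    have := G.card_eq e he
    simp [Finset.subset_empty.mp h] at this
  | insert v S hv ih =>
    intro hvS
    have hS := (Finset.subset_insert v S).trans hvS
    have := key S.card S hS rfl v (hvS (Finset.mem_insert_self _ _)) hv
    have := ih hS
    omega

/-- The subgraph of `G` induced by `S` has a proper colouring with `q` colours. -/
def ColorableOn (G : ThreeGraph) (S : Finset (Fin G.n)) (q : ℕ) : Prop :=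
  ∃ c : Fin G.n → ℕ, (∀ v ∈ S, c v < q) ∧
    ∀ e ∈ G.edges, e ⊆ S → ∃ u ∈ e, ∃ v ∈ e, c u ≠ c v

theorem ColorableOn.mono {S : Finset (Fin G.n)} {q q' : ℕ} (h : G.ColorableOn S q)
    (hq : q ≤ q') : G.ColorableOn S q' :=
  let ⟨c, hc, hE⟩ := h
  ⟨c, fun v hv => (hc v hv).trans_le hq, hE⟩

theorem ColorableOn.union {S T : Finset (Fin G.n)} {q p : ℕ} (hS : G.ColorableOn S q)
    (hT : G.ColorableOn T p) : G.ColorableOn (S ∪ T) (q + p) := by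
  obtain ⟨c, hc, hcE⟩ := hS
  obtain ⟨d, hd, hdE⟩ := hT
  refine ⟨fun v => if v ∈ S then c v else q + d v, fun v hv => ?_, fun e he heST => ?_⟩
  · by_cases hvS : v ∈ S
    · simpa [hvS] using (hc v hvS).trans_le (Nat.le_add_right q p)
    · simpa [hvS] using hd v ((Finset.mem_union.mp hv).resolve_left hvS)
  · by_cases heS : e ⊆ S
    · obtain ⟨u, hu, v, hv, huv⟩ := hcE e he heS
      exact ⟨u, hu, v, hv, by simpa [heS hu, heS hv] using huv⟩
    obtain ⟨x, hx, hxS⟩ := Finset.not_subset.mp heS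
    by_cases hy : ∃ y ∈ e, y ∈ S
    · obtain ⟨y, hy, hyS⟩ := hy
      have := hc y hyS
      exact ⟨x, hx, y, hy, by simp only [hxS, hyS, if_true, if_false]; omega⟩
    · push Not at hy
      obtain ⟨u, hu, v, hv, huv⟩ := hdE e he fun z hz =>
        (Finset.mem_union.mp (heST hz)).resolve_left (hy z hz)
      exact ⟨u, hu, v, hv, by simpa [hy u hu, hy v hv] using huv⟩

theorem IndepSet.colorableOn {S : Finset (Fin G.n)} (h : G.IndepSet S) : G.ColorableOn S 1 :=
  ⟨fun _ => 0, by simp, fun e he heS => absurd heS (h e he)⟩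

theorem colorableOn_empty : G.ColorableOn ∅ 0 := by
  refine ⟨fun _ => 0, by simp, fun e he heS => ?_⟩
  have := G.card_eq e he
  simp [Finset.subset_empty.mp heS] at this

theorem colorableOn_card (S : Finset (Fin G.n)) : G.ColorableOn S S.card := by
  induction S using Finset.induction_on with
  | empty => exact colorableOn_empty
  | insert v S hv ih =>
    have h1 : G.IndepSet {v} := fun e he hev => by
      have := Finset.card_le_card hev
      rw [G.card_eq e he, Finset.card_singleton] at this
      omega
    rw [Finset.card_insert_of_notMem hv, add_comm, Finset.insert_eq]
    exact h1.colorableOn.union ih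

theorem colorableOn_of_exists_indepSet {t M : ℕ}
    (h : ∀ U : Finset (Fin G.n), M < U.card → ∃ A ⊆ U, G.IndepSet A ∧ t ≤ A.card)
    (k : ℕ) (U : Finset (Fin G.n)) (hU : U.card ≤ k * t) : G.ColorableOn U (k + M) := by
  induction k generalizing U with
  | zero =>
    obtain rfl : U = ∅ := Finset.card_eq_zero.mp (by omega)
    exact colorableOn_empty.mono (Nat.zero_le _)
  | succ k ih =>
    by_cases hM : U.card ≤ M
    · exact (colorableOn_card U).mono (by omega)
    obtain ⟨A, hAU, hA, ht⟩ := h U (by omega)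
    have hcard := Finset.card_sdiff_add_card_eq_card hAU
    rw [add_mul, one_mul] at hU
    have := (ih (U \ A) (by omega)).union hA.colorableOn
    rw [Finset.sdiff_union_of_subset hAU] at this
    exact this.mono (by omega)

theorem ColorableOn.colorable {r : ℕ} (h : G.ColorableOn Finset.univ r) : G.Colorable r := by
  obtain ⟨c, hc, hE⟩ := h
  refine ⟨fun v => ⟨c v, hc v (Finset.mem_univ v)⟩, fun e he => ?_⟩
  obtain ⟨u, hu, v, hv, huv⟩ := hE e he (Finset.subset_univ e)
  exact ⟨u, hu, v, hv, by simpa using huv⟩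

theorem sum_degree (G : ThreeGraph) : ∑ v, G.degree v = 3 * G.edges.card := by
  simp only [degree, Finset.card_filter]
  rw [Finset.sum_comm, mul_comm, ← smul_eq_mul, ← Finset.sum_const]
  refine Finset.sum_congr rfl fun e he => ?_
  simp [G.card_eq e he]

theorem Free.mul_pow_le_card_edges (hG : G.Free K4) {r t : ℕ} (hr : 4 ≤ r)
    (ht : 2 * (4 * t) ^ (t * t) ≤ r / 4) (hcol : ¬ G.Colorable r) :
    t * r ^ 3 ≤ 864 * G.edges.card := by
  set q := r / 2
  set L : Finset (Fin G.n) := {v | 4 * G.degree v ≤ q ^ 2}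
  have hL : G.ColorableOn L q := by
    obtain ⟨c, hc⟩ := G.colorings_nonempty (q := q) (L := L) (by omega) (by simp [L])
    refine ⟨fun v => c v, fun v _ => (c v).2, fun e he heL => ?_⟩
    obtain ⟨u, hu, v, hv, huv⟩ := mem_colorings.mp hc e he heL
    exact ⟨u, hu, v, hv, fun h => huv (Fin.ext h)⟩
  have hH : r / 4 * t < Lᶜ.card := by
    by_contra! hH
    have h := colorableOn_of_exists_indepSet (t := t) (M := r / 4)
      (fun U hU => hG.exists_indepSet U (ht.trans hU.le)) (r / 4) Lᶜ hH
    have := hL.union h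
    rw [Finset.union_compl] at this
    exact hcol (this.mono (by omega)).colorable
  have h1 : Lᶜ.card * q ^ 2 ≤ 12 * G.edges.card := by
    calc Lᶜ.card * q ^ 2 ≤ ∑ v ∈ Lᶜ, 4 * G.degree v := by
          rw [← smul_eq_mul]
          refine Finset.card_nsmul_le_sum _ _ _ fun v hv => ?_
          simp only [L, Finset.compl_filter, Finset.mem_filter, not_le] at hv
          exact hv.2.le
      _ ≤ ∑ v, 4 * G.degree v :=
          Finset.sum_le_sum_of_subset (Finset.subset_univ _)
      _ = _ := by rw [← Finset.mul_sum, sum_degree]; ring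
  have h2 : r ≤ 8 * (r / 4) := by omega
  have h3 : r ≤ 3 * q := by omega
  calc t * r ^ 3 = r * t * r ^ 2 := by ring
    _ ≤ (8 * (r / 4)) * t * (3 * q) ^ 2 := by gcongr
    _ = 72 * ((r / 4 * t) * q ^ 2) := by ring
    _ ≤ 72 * (Lᶜ.card * q ^ 2) := by gcongr
    _ ≤ 72 * (12 * G.edges.card) := by gcongr
    _ = _ := by ring

end ThreeGraph

open Filter in
theorem eventually_exists_two_mul_pow_le_div {δ : ℝ} (hδ : 0 < δ) (hδ' : δ ≤ 1 / 4) :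
    ∀ᶠ r : ℕ in atTop, ∃ t : ℕ,
      Real.log r ^ ((1 : ℝ) / 2 - δ) ≤ t ∧ 2 * (4 * t) ^ (t * t) ≤ r / 4 := by
  have hlog : Tendsto (fun r : ℕ => Real.log r) atTop atTop :=
    Real.tendsto_log_atTop.comp tendsto_natCast_atTop_atTop
  have hlittle : ∀ᶠ x : ℝ in atTop, 4 * x ^ (1 - 2 * δ) * Real.log (8 * x) ≤ x / 2 := by
    have hlog8 : (fun x : ℝ => Real.log (8 * x)) =o[atTop] fun x => (8 * x) ^ (2 * δ) :=
      (isLittleO_log_rpow_atTop (by positivity)).comp_tendsto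
        (tendsto_id.const_mul_atTop (by norm_num))
    have hc : (0 : ℝ) < 1 / (8 * 8 ^ (2 * δ)) := by positivity
    filter_upwards [hlog8.def hc, eventually_ge_atTop 1] with x hx hx1
    have hx0 : 0 < x := by linarith
    rw [Real.norm_of_nonneg (Real.log_nonneg (by linarith)),
      Real.norm_of_nonneg (by positivity), Real.mul_rpow (by norm_num) hx0.le] at hx
    calc 4 * x ^ (1 - 2 * δ) * Real.log (8 * x)
        ≤ 4 * x ^ (1 - 2 * δ) * (1 / (8 * 8 ^ (2 * δ)) * (8 ^ (2 * δ) * x ^ (2 * δ))) := by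
          gcongr
      _ = x ^ (1 - 2 * δ) * x ^ (2 * δ) / 2 := by
          field_simp
          norm_num
      _ = x / 2 := by
          rw [← Real.rpow_add hx0]
          simp
  filter_upwards [hlog.eventually hlittle, hlog.eventually (eventually_ge_atTop 10),
    eventually_ge_atTop 4] with r h1 h2 hr
  set x := Real.log r
  have hy : 1 ≤ x ^ ((1 : ℝ) / 2 - δ) := Real.one_le_rpow (by linarith) (by linarith)
  refine ⟨⌈x ^ ((1 : ℝ) / 2 - δ)⌉₊, Nat.le_ceil _, ?_⟩
  set t := ⌈x ^ ((1 : ℝ) / 2 - δ)⌉₊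
  have ht : (t : ℝ) ≤ 2 * x ^ ((1 : ℝ) / 2 - δ) := by
    have := Nat.ceil_lt_add_one (zero_le_one.trans hy)
    linarith
  have ht0 : (1 : ℝ) ≤ t := hy.trans (Nat.le_ceil _)
  have ht2 : (t : ℝ) * t ≤ 4 * x ^ (1 - 2 * δ) := by
    calc (t : ℝ) * t ≤ (2 * x ^ ((1 : ℝ) / 2 - δ)) * (2 * x ^ ((1 : ℝ) / 2 - δ)) := by gcongr
      _ = 4 * (x ^ ((1 : ℝ) / 2 - δ) * x ^ ((1 : ℝ) / 2 - δ)) := by ring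
      _ = 4 * x ^ (1 - 2 * δ) := by
        rw [← Real.rpow_add (by linarith)]
        ring_nf
  have htx : (4 : ℝ) * t ≤ 8 * x := by
    have : x ^ ((1 : ℝ) / 2 - δ) ≤ x := by
      conv_rhs => rw [← Real.rpow_one x]
      exact Real.rpow_le_rpow_of_exponent_le (by linarith) (by linarith)
    linarith
  have hmain : Real.log ((4 * t : ℝ) ^ (t * t)) ≤ x / 2 := by
    rw [Real.log_pow]
    push_cast
    refine le_trans ?_ h1
    gcongr
    exact Real.log_nonneg (by linarith)
  rw [Nat.le_div_iff_mul_le (by norm_num)]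
  have hr0 : (0 : ℝ) < r := by positivity
  have h8 : Real.log 8 ≤ x / 2 := by
    have h : Real.log 8 = 3 * Real.log 2 := by
      rw [show (8 : ℝ) = 2 ^ 3 by norm_num, Real.log_pow]
      norm_num
    have := Real.log_two_lt_d9
    linarith
  have hfin : 8 * (4 * t : ℝ) ^ (t * t) ≤ r := by
    rw [← Real.log_le_log_iff (by positivity) hr0, Real.log_mul (by norm_num) (by positivity)]
    linarith
  have : 8 * (4 * t) ^ (t * t) ≤ r := by exact_mod_cast hfin
  linarith

open Filter in
/-- For every `ε > 0` there is a constant `c > 0` such that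
`m_{K_4}(r) ≥ c·r^3·(ln r)^(1/2−ε)` for all `r ≥ 2`. -/
theorem mH_K4_lower :
    ∀ ε : ℝ, 0 < ε → ∃ c : ℝ, 0 < c ∧
      ∀ r : ℕ, 2 ≤ r → ∀ G : ThreeGraph, G.Free K4 → ¬ G.Colorable r →
        c * (r : ℝ) ^ 3 * Real.log r ^ ((1 : ℝ) / 2 - ε) ≤ (G.edges.card : ℝ) := by
  intro ε hε
  obtain ⟨r₀, hr₀⟩ := eventually_atTop.mp
    (eventually_exists_two_mul_pow_le_div (δ := min ε (1 / 4)) (by positivity) (min_le_right _ _))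
  set f : ℕ → ℝ := fun r => (r : ℝ) ^ 3 * Real.log r ^ ((1 : ℝ) / 2 - ε)
  have hf : ∀ r, 0 ≤ f r := fun r =>
    mul_nonneg (by positivity) (Real.rpow_nonneg (Real.log_natCast_nonneg r) _)
  have hK : 0 ≤ ∑ r ∈ Finset.range (r₀ + 4), f r := Finset.sum_nonneg fun r _ => hf r
  refine ⟨1 / (864 + ∑ r ∈ Finset.range (r₀ + 4), f r), by positivity, ?_⟩
  intro r hr G hG hcol
  rw [mul_assoc, one_div_mul_eq_div, div_le_iff₀ (by positivity)]
  change f r ≤ _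
  by_cases hlt : r < r₀ + 4
  · have hedge : 1 ≤ G.edges.card := by
      rw [Nat.one_le_iff_ne_zero, Ne, Finset.card_eq_zero]
      intro h
      exact hcol ⟨fun _ => ⟨0, by omega⟩, by simp [h]⟩
    have h1 : (1 : ℝ) ≤ G.edges.card := by exact_mod_cast hedge
    have h2 := Finset.single_le_sum (fun r _ => hf r) (Finset.mem_range.mpr hlt)
    nlinarith
  · obtain ⟨t, ht, hpow⟩ := hr₀ r (by omega)
    have h1 : (t : ℝ) * (r : ℝ) ^ 3 ≤ 864 * G.edges.card := by
      exact_mod_cast hG.mul_pow_le_card_edges (by omega) hpow hcol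
    have hlog : 1 ≤ Real.log r := by
      rw [Real.le_log_iff_exp_le (by positivity)]
      have := Real.exp_one_lt_d9
      have : (4 : ℝ) ≤ r := by exact_mod_cast (by omega : 4 ≤ r)
      linarith
    have h2 : Real.log r ^ ((1 : ℝ) / 2 - ε) ≤ t :=
      (Real.rpow_le_rpow_of_exponent_le hlog (by linarith [min_le_left ε (1 / 4)])).trans ht
    have h3 : f r ≤ (r : ℝ) ^ 3 * t := mul_le_mul_of_nonneg_left h2 (by positivity)
    have h4 : 0 ≤ (G.edges.card : ℝ) * ∑ r ∈ Finset.range (r₀ + 4), f r := by positivity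
    linarith
end

section
/- There exists a constant C > 0 such that for all integers r ≥ 3 one has m_{K_4}(r) ≤ C·r^3·(ln r / ln ln r)^3. -/
open Finset in
theorem card_filter_comp_mem_mul_le {ι κ D : Type*} [Fintype ι] [Fintype κ] [Fintype D]
    [DecidableEq ι] [DecidableEq κ] [DecidableEq D]
    (g : κ → ι) (hg : Function.Injective g) (T : Finset (κ → D)) :
    #{χ : ι → D | χ ∘ g ∈ T} * Fintype.card D ^ Fintype.card κ
      ≤ #T * Fintype.card D ^ Fintype.card ι := by
  classical
  rw [← Fintype.card_fun, ← Fintype.card_fun, ← Finset.card_univ, ← Finset.card_univ,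
    ← card_product, ← card_product]
  let swap : (ι → D) × (κ → D) → (κ → D) × (ι → D) := fun x =>
    (x.1 ∘ g, fun i => if h : ∃ k, g k = i then x.2 h.choose else x.1 i)
  have hval : ∀ (x : (ι → D) × (κ → D)) (k : κ), (swap x).2 (g k) = x.2 k := by
    intro x k
    have h : ∃ k', g k' = g k := ⟨k, rfl⟩
    simp only [swap, dif_pos h]
    rw [hg h.choose_spec]
  refine card_le_card_of_injOn swap ?_ ?_
  · intro x hx
    simp only [coe_product, Set.mem_prod, mem_coe, mem_filter, mem_univ, true_and, and_true] at hx ⊢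
    exact hx
  · intro x _ y _ hxy
    refine Prod.ext ?_ ?_
    · funext i
      by_cases h : ∃ k, g k = i
      · obtain ⟨k, rfl⟩ := h
        exact congrFun (congrArg Prod.fst hxy) k
      · have := congrFun (congrArg Prod.snd hxy) i
        simpa only [swap, dif_neg h] using this
    · funext k
      rw [← hval x k, ← hval y k, hxy]

section Flags

variable {p : ℕ} [Fact p.Prime]

/-- A triple `(x, y, a)` is the point `(x, y)` of the affine plane together with the line of
slope `a` through it. A flag is related to another one when its point lies on the line of the
other, while both the points and the lines of the two flags differ. -/
def FlagRel (c d : ZMod p × ZMod p × ZMod p) : Prop :=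
  c.2.1 - d.2.1 = d.2.2 * (c.1 - d.1) ∧ c.1 ≠ d.1 ∧ c.2.2 ≠ d.2.2

instance : DecidableRel (FlagRel (p := p)) := fun c d =>
  inferInstanceAs (Decidable (c.2.1 - d.2.1 = d.2.2 * (c.1 - d.1) ∧ c.1 ≠ d.1 ∧ c.2.2 ≠ d.2.2))

theorem FlagRel.not_trans {b c d : ZMod p × ZMod p × ZMod p} (hbc : FlagRel b c)
    (hbd : FlagRel b d) : ¬ FlagRel c d := by
  rintro ⟨h, -, hne⟩
  have : (c.2.2 - d.2.2) * (b.1 - c.1) = 0 := by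
    linear_combination hbd.1 - hbc.1 - h
  rcases mul_eq_zero.1 this with h0 | h0
  · exact hne (sub_eq_zero.1 h0)
  · exact hbc.2.1 (sub_eq_zero.1 h0)

open Finset

theorem FlagRel.sq_le_card_out (c : ZMod p × ZMod p × ZMod p) :
    (p - 1) ^ 2 ≤ #{d | FlagRel c d} := by
  have h : #((univ.erase c.1) ×ˢ (univ.erase c.2.2)) = (p - 1) ^ 2 := by
    rw [card_product, card_erase_of_mem (mem_univ _), card_erase_of_mem (mem_univ _), card_univ,
      ZMod.card, sq]
  rw [← h]
  refine card_le_card_of_injOn (fun s => (s.1, c.2.1 - s.2 * (c.1 - s.1), s.2)) ?_ ?_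
  · rintro ⟨x, a⟩ hs
    simp only [coe_product, Set.mem_prod, mem_coe, mem_erase, mem_univ, and_true] at hs
    simp only [mem_coe, mem_filter, mem_univ, true_and]
    exact ⟨by ring, hs.1.symm, hs.2.symm⟩
  · rintro ⟨x, a⟩ - ⟨x', a'⟩ - h
    simp only [Prod.mk.injEq] at h
    exact Prod.ext h.1 h.2.2

theorem FlagRel.card_out_le (c : ZMod p × ZMod p × ZMod p) :
    #{d | FlagRel c d} ≤ p ^ 2 := by
  have h : #(univ : Finset (ZMod p × ZMod p)) = p ^ 2 := by
    rw [card_univ, Fintype.card_prod, ZMod.card, sq]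
  rw [← h]
  refine card_le_card_of_injOn (fun d => (d.1, d.2.2)) (fun _ _ => mem_coe.2 (mem_univ _)) ?_
  rintro ⟨x, y, a⟩ hd ⟨x', y', a'⟩ hd' he
  simp only [mem_coe, mem_filter, mem_univ, true_and, Prod.mk.injEq] at hd hd' he
  obtain ⟨rfl, rfl⟩ := he
  have : y = y' := by linear_combination hd'.1 - hd.1
  rw [this]

theorem FlagRel.card_common_out_le {b c : ZMod p × ZMod p × ZMod p}
    (hbc : (b.1, b.2.1) ≠ (c.1, c.2.1)) : #{d | FlagRel b d ∧ FlagRel c d} ≤ p := by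
  have h : #(univ : Finset (ZMod p)) = p := by rw [card_univ, ZMod.card]
  conv_rhs => rw [← h]
  refine card_le_card_of_injOn (fun d => d.1) (fun _ _ => mem_coe.2 (mem_univ _)) ?_
  rintro ⟨x, y, a⟩ hd ⟨x', y', a'⟩ hd' he
  simp only [mem_coe, mem_filter, mem_univ, true_and] at hd hd' he
  subst he
  obtain ⟨⟨h1, -, -⟩, h2, -, -⟩ := hd
  obtain ⟨⟨h3, -, -⟩, h4, -, -⟩ := hd'
  have hx : b.1 - c.1 ≠ 0 := by
    intro h0
    apply hbc
    have h5 : b.2.1 = c.2.1 := by linear_combination h1 - h2 + a * h0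
    rw [sub_eq_zero.1 h0, h5]
  have ha : a = a' := by
    refine mul_right_cancel₀ hx ?_
    linear_combination h3 - h1 - h4 + h2
  subst ha
  have : y = y' := by linear_combination h3 - h1
  rw [this]

theorem FlagRel.card_missed_le (T : Finset (ZMod p × ZMod p × ZMod p))
    (hT : Set.InjOn (fun c => (c.1, c.2.1)) (T : Set (ZMod p × ZMod p × ZMod p))) {k : ℕ}
    (hk : 0 < k) (hkp : k ≤ p) (hTk : p * k ≤ #T) :
    #{d | ∀ c ∈ T, ¬ FlagRel c d} * k ≤ 5 * p ^ 3 := by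
  have hp : 0 < p := (Fact.out : p.Prime).pos
  have hp' : (0 : ℝ) < p := by exact_mod_cast hp
  set t : ℝ := (#T : ℝ) with ht
  set X : ZMod p × ZMod p × ZMod p → ℝ := fun d => ∑ c ∈ T, if FlagRel c d then (1 : ℝ) else 0
    with hX
  have htk : (p : ℝ) * k ≤ t := by rw [ht]; exact_mod_cast hTk
  have hk' : (0 : ℝ) < k := by exact_mod_cast hk
  have hkp' : (k : ℝ) ≤ p := by exact_mod_cast hkp
  have ht0 : 0 < t := lt_of_lt_of_le (by positivity) htk
  have hsum : t * ((p : ℝ) - 1) ^ 2 ≤ ∑ d, X d := by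
    simp only [hX]
    rw [sum_comm, ht, ← nsmul_eq_mul]
    refine card_nsmul_le_sum _ _ _ fun c _ => ?_
    rw [sum_boole]
    have := FlagRel.sq_le_card_out c
    rw [← Nat.cast_one, ← Nat.cast_sub hp]
    exact_mod_cast this
  have hsq : ∑ d, X d ^ 2 ≤ t * p ^ 2 + t ^ 2 * p := by
    have h1 : ∀ b ∈ T, ∑ c ∈ T, (#{d | FlagRel b d ∧ FlagRel c d} : ℝ) ≤ (p : ℝ) ^ 2 + t * p := by
      intro b hb
      rw [← add_sum_erase _ _ hb]
      refine add_le_add ?_ ?_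
      · simp only [and_self]
        exact_mod_cast FlagRel.card_out_le b
      · calc ∑ c ∈ T.erase b, (#{d | FlagRel b d ∧ FlagRel c d} : ℝ)
            ≤ #(T.erase b) • (p : ℝ) := by
              refine sum_le_card_nsmul _ _ _ fun c hc => ?_
              rw [mem_erase] at hc
              exact_mod_cast FlagRel.card_common_out_le
                fun h => hc.1 (hT (mem_coe.2 hc.2) (mem_coe.2 hb) h.symm)
          _ ≤ t * p := by
              rw [nsmul_eq_mul, ht]
              gcongr
              exact erase_subset _ _
    calc ∑ d, X d ^ 2 = ∑ b ∈ T, ∑ c ∈ T, (#{d | FlagRel b d ∧ FlagRel c d} : ℝ) := by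
          simp only [hX, sq, sum_mul_sum]
          rw [sum_comm]
          refine sum_congr rfl fun b _ => ?_
          rw [sum_comm]
          refine sum_congr rfl fun c _ => ?_
          rw [← sum_boole]
          refine sum_congr rfl fun d _ => ?_
          by_cases h1 : FlagRel b d <;> by_cases h2 : FlagRel c d <;> simp [h1, h2]
      _ ≤ #T • ((p : ℝ) ^ 2 + t * p) := sum_le_card_nsmul _ _ _ h1
      _ = t * p ^ 2 + t ^ 2 * p := by rw [nsmul_eq_mul]; ring
  have hvar : (#{d | ∀ c ∈ T, ¬ FlagRel c d} : ℝ) * (t / p) ^ 2 ≤ ∑ d, (X d - t / p) ^ 2 := by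
    rw [← nsmul_eq_mul]
    refine (card_nsmul_le_sum _ (fun d => (X d - t / p) ^ 2) _ fun d hd => ?_).trans
      (sum_le_sum_of_subset_of_nonneg (filter_subset _ _) fun _ _ _ => sq_nonneg _)
    have : X d = 0 := by
      refine sum_eq_zero fun c hc => ?_
      rw [if_neg ((mem_filter.1 hd).2 c hc)]
    rw [this]; exact le_of_eq (by ring)
  have hexp : ∑ d, (X d - t / p) ^ 2 = ∑ d, X d ^ 2 - 2 * (t / p) * ∑ d, X d + t ^ 2 * p := by
    have hcard : (Fintype.card (ZMod p × ZMod p × ZMod p) : ℝ) = p ^ 3 := by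
      simp only [Fintype.card_prod, ZMod.card]; push_cast; ring
    simp only [sub_sq, sum_add_distrib, sum_sub_distrib, sum_const, card_univ, nsmul_eq_mul, hcard]
    rw [← sum_mul, ← mul_sum]
    field_simp
  set m : ℝ := (#{d | ∀ c ∈ T, ¬ FlagRel c d} : ℝ) with hm
  have h2 : m * (t / p) ^ 2 ≤ t * p ^ 2 + 4 * t ^ 2 := by
    have h3 : 2 * (t / p) * (t * ((p : ℝ) - 1) ^ 2) ≤ 2 * (t / p) * ∑ d, X d := by gcongr
    have h4 : 2 * (t / p) * (t * ((p : ℝ) - 1) ^ 2) = 2 * t ^ 2 * p - 4 * t ^ 2 + 2 * t ^ 2 / p := by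
      field_simp; ring
    have h5 : 0 ≤ 2 * t ^ 2 / p := by positivity
    linarith
  have h6 : m * t ≤ p ^ 4 + 4 * t * p ^ 2 := by
    have h7 : m * (t / p) ^ 2 * (p ^ 2 / t) ≤ (t * p ^ 2 + 4 * t ^ 2) * (p ^ 2 / t) := by gcongr
    have h8 : m * (t / p) ^ 2 * (p ^ 2 / t) = m * t := by field_simp
    have h9 : (t * p ^ 2 + 4 * t ^ 2) * (p ^ 2 / t) = p ^ 4 + 4 * t * p ^ 2 := by field_simp
    linarith
  have h10 : m * k * t ≤ 5 * p ^ 3 * t := by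
    calc m * k * t = m * t * k := by ring
      _ ≤ (p ^ 4 + 4 * t * p ^ 2) * k := by gcongr
      _ = p ^ 3 * (p * k) + 4 * t * p ^ 2 * k := by ring
      _ ≤ p ^ 3 * t + 4 * t * p ^ 2 * p := by gcongr
      _ = 5 * p ^ 3 * t := by ring
  have := le_of_mul_le_mul_right h10 ht0
  rw [hm] at this
  exact_mod_cast this

theorem FlagRel.card_unrelated_le {h k : ℕ} (hk : 0 < k) (hkp : k ≤ p) :
    #{w : (Fin h → ZMod p × ZMod p × ZMod p) × (Fin h → ZMod p × ZMod p × ZMod p) |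
        ∀ i j, ¬ FlagRel (w.1 i) (w.2 j)} * k ^ h
      ≤ (p ^ (2 * (p * k)) * (p ^ 2 * k * k) ^ h + (5 * p ^ 3) ^ h) * (p ^ 3) ^ h := by
  classical
  set P : (Fin h → ZMod p × ZMod p × ZMod p) → Finset (ZMod p × ZMod p) :=
    fun u => univ.image fun i => ((u i).1, (u i).2.1) with hP
  have hcard : Fintype.card (ZMod p × ZMod p × ZMod p) = p ^ 3 := by
    simp only [Fintype.card_prod, ZMod.card]; ring
  have hfew : #{u | #(P u) ≤ p * k} ≤ p ^ (2 * (p * k)) * (p ^ 2 * k) ^ h := by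
    have hsub : ({u | #(P u) ≤ p * k} : Finset (Fin h → ZMod p × ZMod p × ZMod p)) ⊆
        (powersetCard (p * k) (univ : Finset (ZMod p × ZMod p))).biUnion fun Q =>
          Fintype.piFinset fun _ => ({c | (c.1, c.2.1) ∈ Q} : Finset _) := by
      intro u hu
      rw [mem_filter] at hu
      obtain ⟨Q, hPQ, -, hQ⟩ := exists_subsuperset_card_eq (subset_univ (P u)) hu.2 (by
        rw [card_univ, Fintype.card_prod, ZMod.card]; gcongr)
      rw [mem_biUnion]
      refine ⟨Q, mem_powersetCard_univ.2 hQ, ?_⟩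
      simp only [Fintype.mem_piFinset, mem_filter, mem_univ, true_and]
      exact fun i => hPQ (mem_image.2 ⟨i, mem_univ _, rfl⟩)
    refine (card_le_card hsub).trans ((card_biUnion_le_card_mul _ _ ((p ^ 2 * k) ^ h) ?_).trans ?_)
    · intro Q hQ
      rw [mem_powersetCard_univ] at hQ
      rw [Fintype.card_piFinset_const]
      gcongr
      have h1 : #(Q ×ˢ (univ : Finset (ZMod p))) = p ^ 2 * k := by
        rw [card_product, card_univ, ZMod.card, hQ]; ring
      rw [← h1]
      refine card_le_card_of_injOn (fun c => ((c.1, c.2.1), c.2.2)) ?_ ?_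
      · intro c hc
        simpa using hc
      · rintro ⟨x, y, a⟩ - ⟨x', y', a'⟩ - he
        simp only [Prod.mk.injEq] at he ⊢
        exact ⟨he.1.1, he.1.2, he.2⟩
    · gcongr
      rw [card_powersetCard, card_univ, Fintype.card_prod, ZMod.card, pow_mul, sq]
      exact Nat.choose_le_pow _ _
  have hmany : ∀ u, p * k < #(P u) →
      #{v : Fin h → ZMod p × ZMod p × ZMod p | ∀ i j, ¬ FlagRel (u i) (v j)} * k ^ h
        ≤ (5 * p ^ 3) ^ h := by
    intro u hu
    obtain ⟨T, hTsub, hTinj, hTim⟩ := exists_subset_injOn_image_eq_of_surjOn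
      (f := fun c : ZMod p × ZMod p × ZMod p => (c.1, c.2.1)) (Set.range u) (P u) (by
        intro q hq
        obtain ⟨i, -, hi⟩ := mem_image.1 (mem_coe.1 hq)
        exact ⟨u i, ⟨i, rfl⟩, hi⟩)
    have hTcard : #T = #(P u) := by rw [← hTim, card_image_of_injOn hTinj]
    have hle := FlagRel.card_missed_le T hTinj hk hkp (by omega)
    have : #{v : Fin h → ZMod p × ZMod p × ZMod p | ∀ i j, ¬ FlagRel (u i) (v j)} ≤
        #{d | ∀ c ∈ T, ¬ FlagRel c d} ^ h := by
      have h2 := Fintype.card_piFinset_const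
        ({d | ∀ c ∈ T, ¬ FlagRel c d} : Finset (ZMod p × ZMod p × ZMod p)) h
      rw [← h2]
      refine card_le_card fun v hv => ?_
      simp only [mem_filter, mem_univ, true_and] at hv
      simp only [Fintype.mem_piFinset, mem_filter, mem_univ, true_and]
      intro j c hc
      obtain ⟨i, rfl⟩ := hTsub (mem_coe.2 hc)
      exact hv i j
    calc _ ≤ #{d | ∀ c ∈ T, ¬ FlagRel c d} ^ h * k ^ h := by gcongr
      _ = (#{d | ∀ c ∈ T, ¬ FlagRel c d} * k) ^ h := (mul_pow _ _ _).symm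
      _ ≤ _ := by gcongr
  have hsplit : #{w : (Fin h → ZMod p × ZMod p × ZMod p) × (Fin h → ZMod p × ZMod p × ZMod p) |
        ∀ i j, ¬ FlagRel (w.1 i) (w.2 j)} =
      ∑ u : Fin h → ZMod p × ZMod p × ZMod p,
        #{v : Fin h → ZMod p × ZMod p × ZMod p | ∀ i j, ¬ FlagRel (u i) (v j)} := by
    simp only [card_filter]
    rw [Fintype.sum_prod_type]
  rw [hsplit, sum_mul, ← sum_filter_add_sum_filter_not univ (fun u => #(P u) ≤ p * k), add_mul]
  refine add_le_add ?_ ?_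
  · calc _ ≤ #{u | #(P u) ≤ p * k} • ((p ^ 3) ^ h * k ^ h) := by
          refine sum_le_card_nsmul _ _ _ fun u _ => ?_
          gcongr
          refine (card_le_univ _).trans ?_
          rw [Fintype.card_fun, hcard, Fintype.card_fin]
      _ ≤ (p ^ (2 * (p * k)) * (p ^ 2 * k) ^ h) * ((p ^ 3) ^ h * k ^ h) := by
          rw [smul_eq_mul]; gcongr
      _ = _ := by rw [mul_pow _ k]; ring
  · calc _ ≤ #{u | ¬ #(P u) ≤ p * k} • (5 * p ^ 3) ^ h := by
          refine sum_le_card_nsmul _ _ _ fun u hu => hmany u ?_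
          exact not_le.1 (mem_filter.1 hu).2
      _ ≤ (p ^ 3) ^ h * (5 * p ^ 3) ^ h := by
          rw [smul_eq_mul]; gcongr
          refine (card_le_univ _).trans ?_
          rw [Fintype.card_fun, hcard, Fintype.card_fin]
      _ = _ := mul_comm _ _

end Flags

section Coloring

open Finset

variable {C : Type*}

open Classical in
/-- The 3-graph on `Fin N` whose edges are the triples `i < j < k` for which the colors of the
pairs `ij` and `ik` are related by `F`. -/
noncomputable def ThreeGraph.ofPairColoring (F : C → C → Prop) {N : ℕ} (χ : Fin N → Fin N → C) :
    ThreeGraph where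
  n := N
  edges := {e : Finset (Fin N) | ∃ i j k, i < j ∧ j < k ∧ e = {i, j, k} ∧ F (χ i j) (χ i k)}
  card_eq := by
    intro e he
    obtain ⟨i, j, k, hij, hjk, rfl, -⟩ := (mem_filter.1 he).2
    exact card_eq_three.2 ⟨i, j, k, hij.ne, (hij.trans hjk).ne, hjk.ne, rfl⟩

theorem ThreeGraph.mem_edges_ofPairColoring {F : C → C → Prop} {N : ℕ} {χ : Fin N → Fin N → C}
    {e : Finset (Fin N)} : e ∈ (ThreeGraph.ofPairColoring F χ).edges ↔
      ∃ i j k, i < j ∧ j < k ∧ e = {i, j, k} ∧ F (χ i j) (χ i k) := by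
  classical
  unfold ThreeGraph.ofPairColoring
  simp only [mem_filter, mem_univ, true_and]

theorem ThreeGraph.insert_mem_edges_ofPairColoring {F : C → C → Prop} {N : ℕ}
    {χ : Fin N → Fin N → C} {i j k : Fin N} (hij : i < j) (hjk : j < k) :
    ({i, j, k} : Finset (Fin N)) ∈ (ThreeGraph.ofPairColoring F χ).edges ↔
      F (χ i j) (χ i k) := by
  rw [ThreeGraph.mem_edges_ofPairColoring]
  refine ⟨?_, fun h => ⟨i, j, k, hij, hjk, rfl, h⟩⟩
  rintro ⟨i', j', k', hij', hjk', he, h⟩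
  have h1 := fun x => Finset.ext_iff.1 he x
  simp only [mem_insert, mem_singleton] at h1
  have a1 := h1 i
  have a2 := h1 j
  have a3 := h1 k
  have b1 := h1 i'
  have b2 := h1 j'
  have b3 := h1 k'
  have hi : i = i' := by grind
  have hj : j = j' := by grind
  have hk : k = k' := by grind
  subst hi hj hk
  exact h

theorem ThreeGraph.free_K4_ofPairColoring {F : C → C → Prop}
    (hF : ∀ b c d, F b c → F b d → ¬ F c d) {N : ℕ} (χ : Fin N → Fin N → C) :
    (ThreeGraph.ofPairColoring F χ).Free K4 := by
  rintro ⟨f, hf⟩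
  change Fin 4 ↪ Fin N at f
  have hK : ∀ a b c : Fin 4, a ≠ b → a ≠ c → b ≠ c → ({a, b, c} : Finset (Fin 4)) ∈ K4.edges := by
    unfold K4
    decide
  have hcard : #(univ.image f) = 4 := by
    rw [card_image_of_injective _ f.injective, card_univ, Fintype.card_fin]
  set g := (univ.image f).orderEmbOfFin hcard with hg
  have hedge : ∀ a b c : Fin 4, a < b → b < c → F (χ (g a) (g b)) (χ (g a) (g c)) := by
    intro a b c hab hbc
    have hmem : ∀ a, ∃ a', f a' = g a := fun a => by
      have := (univ.image f).orderEmbOfFin_mem hcard a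
      rw [mem_image] at this
      obtain ⟨a', -, ha⟩ := this
      exact ⟨a', ha⟩
    obtain ⟨a', ha⟩ := hmem a
    obtain ⟨b', hb⟩ := hmem b
    obtain ⟨c', hc⟩ := hmem c
    have hne : ∀ {x y : Fin 4} {x' y' : Fin 4}, x < y → f x' = g x → f y' = g y → x' ≠ y' := by
      rintro x y x' y' hxy hx hy rfl
      exact hxy.ne (g.injective (hx.symm.trans hy))
    have h := hf _ (hK a' b' c' (hne hab ha hb) (hne (hab.trans hbc) ha hc) (hne hbc hb hc))
    have him : ({a', b', c'} : Finset (Fin 4)).image f = {g a, g b, g c} := by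
      simp only [image_insert, image_singleton, ha, hb, hc]
    exact (ThreeGraph.insert_mem_edges_ofPairColoring (g.strictMono hab) (g.strictMono hbc)).1
      (him ▸ h)
  exact hF _ _ _ (hedge 0 1 2 (by decide) (by decide)) (hedge 0 1 3 (by decide) (by decide))
    (hedge 0 2 3 (by decide) (by decide))

theorem ThreeGraph.exists_ofPairColoring_forall_indepSet_card_lt [Fintype C]
    (F : C → C → Prop) [DecidableRel F] {N h : ℕ} (hh : 0 < h)
    (hN : N ^ 3 * #{w : (Fin h → C) × (Fin h → C) | ∀ i j, ¬ F (w.1 i) (w.2 j)}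
      < Fintype.card C ^ (2 * h)) :
    ∃ χ : Fin N → Fin N → C, ∀ S : Finset (Fin N),
      (ThreeGraph.ofPairColoring F χ).IndepSet S → #S < 3 * h := by
  classical
  set W : Finset ((Fin h → C) × (Fin h → C)) := {w | ∀ i j, ¬ F (w.1 i) (w.2 j)} with hW
  let T : Finset (Fin h ⊕ Fin h → C) := {t | ∀ i j, ¬ F (t (Sum.inl i)) (t (Sum.inr j))}
  have hT : #T ≤ #W := by
    refine card_le_card_of_injOn (fun t => (t ∘ Sum.inl, t ∘ Sum.inr)) ?_ ?_
    · intro t ht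
      simpa [T, W] using ht
    · intro s _ t _ hst
      funext x
      rcases x with i | i
      · exact congrFun (congrArg Prod.fst hst) i
      · exact congrFun (congrArg Prod.snd hst) i
  let first : Fin h → Fin (3 * h) := fun i => ⟨i, by omega⟩
  let rest : Fin h ⊕ Fin h → Fin (3 * h) :=
    Sum.elim (fun i => ⟨h + i, by omega⟩) (fun i => ⟨2 * h + i, by omega⟩)
  have hfirst : Function.Injective first := by
    intro i j hij
    simpa [first, Fin.ext_iff] using hij
  have hrest : Function.Injective rest := by
    rintro (i | i) (j | j) hij <;> simp [rest, Fin.ext_iff] at hij ⊢ <;> omega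
  let R : (Fin (3 * h) → Fin N) → Finset (Fin N → C) := fun f => {ρ | ρ ∘ (f ∘ rest) ∈ T}
  let B : (Fin (3 * h) → Fin N) → Finset (Fin N → Fin N → C) := fun f =>
    {χ | χ ∘ (f ∘ first) ∈ Fintype.piFinset fun _ : Fin h => R f}
  set c := Fintype.card C with hc
  have hc0 : 0 < c := by
    rcases Nat.eq_zero_or_pos c with h0 | h0
    · rw [h0, zero_pow (by omega)] at hN
      omega
    · exact h0
  have hR : ∀ f, Function.Injective f → #(R f) * N ^ 3 < c ^ N := by
    intro f hf
    have h1 := card_filter_comp_mem_mul_le (f ∘ rest) (hf.comp hrest) T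
    rw [Fintype.card_sum, Fintype.card_fin, Fintype.card_fin, ← two_mul] at h1
    refine lt_of_mul_lt_mul_right (a := c ^ (2 * h)) ?_ (Nat.zero_le _)
    calc #(R f) * N ^ 3 * c ^ (2 * h) = N ^ 3 * (#(R f) * c ^ (2 * h)) := by ring
      _ ≤ N ^ 3 * (#T * c ^ N) := by gcongr
      _ ≤ N ^ 3 * (#W * c ^ N) := by gcongr
      _ = (N ^ 3 * #W) * c ^ N := by ring
      _ < c ^ (2 * h) * c ^ N := by gcongr
      _ = _ := mul_comm _ _
  have hB : ∀ f, Function.Injective f → #(B f) * (N ^ 3) ^ h < (c ^ N) ^ N := by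
    intro f hf
    have h1 := card_filter_comp_mem_mul_le (f ∘ first) (hf.comp hfirst)
      (Fintype.piFinset fun _ : Fin h => R f)
    rw [Fintype.card_piFinset_const, Fintype.card_fun, Fintype.card_fin, Fintype.card_fin,
      ← hc] at h1
    refine lt_of_mul_lt_mul_right (a := (c ^ N) ^ h) ?_ (Nat.zero_le _)
    calc #(B f) * (N ^ 3) ^ h * (c ^ N) ^ h = (#(B f) * (c ^ N) ^ h) * (N ^ 3) ^ h := by ring
      _ ≤ (#(R f) ^ h * (c ^ N) ^ N) * (N ^ 3) ^ h := by gcongr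
      _ = (#(R f) * N ^ 3) ^ h * (c ^ N) ^ N := by rw [mul_pow]; ring
      _ < (c ^ N) ^ h * (c ^ N) ^ N := by
        have := Nat.pow_lt_pow_left (hR f hf) hh.ne'
        gcongr
      _ = _ := mul_comm _ _
  have hunion : #(({f | Function.Injective f} : Finset (Fin (3 * h) → Fin N)).biUnion B)
      < Fintype.card (Fin N → Fin N → C) := by
    rw [Fintype.card_fun, Fintype.card_fun, Fintype.card_fin, ← hc]
    rcases ({f | Function.Injective f} : Finset (Fin (3 * h) → Fin N)).eq_empty_or_nonempty
      with he | he
    · rw [he, biUnion_empty, card_empty]; positivity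
    refine (card_biUnion_le).trans_lt ?_
    have hN0 : 0 < (N ^ 3) ^ h := by
      obtain ⟨f, -⟩ := he
      have : 0 < N := (f ⟨0, by omega⟩).pos
      positivity
    refine lt_of_mul_lt_mul_right (a := (N ^ 3) ^ h) ?_ (Nat.zero_le _)
    rw [sum_mul]
    calc _ < ∑ f ∈ ({f | Function.Injective f} : Finset (Fin (3 * h) → Fin N)), (c ^ N) ^ N :=
          sum_lt_sum_of_nonempty he fun f hf => hB f (mem_filter.1 hf).2
      _ = #({f | Function.Injective f} : Finset (Fin (3 * h) → Fin N)) * (c ^ N) ^ N := by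
          rw [sum_const, smul_eq_mul]
      _ ≤ (N ^ 3) ^ h * (c ^ N) ^ N := by
          gcongr
          refine (card_le_univ _).trans ?_
          rw [Fintype.card_fun, Fintype.card_fin, Fintype.card_fin, pow_mul]
      _ = _ := mul_comm _ _
  obtain ⟨χ, hχ⟩ : ∃ χ, χ ∉ ({f | Function.Injective f} :
      Finset (Fin (3 * h) → Fin N)).biUnion B := by
    by_contra! hall
    rw [eq_univ_iff_forall.2 hall, card_univ] at hunion
    exact lt_irrefl _ hunion
  refine ⟨χ, fun S hS => ?_⟩
  by_contra! hSh
  obtain ⟨S', hS', hcard⟩ := exists_subset_card_eq hSh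
  set f := S'.orderEmbOfFin hcard with hf
  refine hχ (mem_biUnion.2 ⟨f, mem_filter.2 ⟨mem_univ _, f.injective⟩, ?_⟩)
  refine mem_filter.2 ⟨mem_univ _, Fintype.mem_piFinset.2 fun a => mem_filter.2 ⟨mem_univ _,
    mem_filter.2 ⟨mem_univ _, fun i j hij => ?_⟩⟩⟩
  have h1 : first a < rest (Sum.inl i) := by
    simp only [first, rest, Sum.elim_inl, Fin.mk_lt_mk]; omega
  have h2 : rest (Sum.inl i) < rest (Sum.inr j) := by
    simp only [rest, Sum.elim_inl, Sum.elim_inr, Fin.mk_lt_mk]; omega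
  refine hS _ ((ThreeGraph.insert_mem_edges_ofPairColoring (f.strictMono h1)
    (f.strictMono h2)).2 hij) ?_
  intro x hx
  have hmem : ∀ b, f b ∈ S := fun b => hS' (S'.orderEmbOfFin_mem hcard b)
  rcases mem_insert.1 hx with rfl | hx
  · exact hmem _
  rcases mem_insert.1 hx with rfl | hx
  · exact hmem _
  · rw [mem_singleton.1 hx]; exact hmem _

end Coloring

theorem ThreeGraph.card_edges_le (G : ThreeGraph) : G.edges.card ≤ G.n ^ 3 := by
  have h : G.edges ⊆ Finset.powersetCard 3 Finset.univ := fun e he =>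
    Finset.mem_powersetCard_univ.2 (G.card_eq e he)
  refine (Finset.card_le_card h).trans ?_
  rw [Finset.card_powersetCard, Finset.card_univ, Fintype.card_fin]
  exact Nat.choose_le_pow _ _

theorem ThreeGraph.not_colorable_of_forall_indepSet_card_lt {G : ThreeGraph} {r t : ℕ}
    (hG : ∀ S, G.IndepSet S → S.card < t) (hn : r * t ≤ G.n) (hr : 0 < r) : ¬ G.Colorable r := by
  rintro ⟨c, hc⟩
  have : Nonempty (Fin r) := ⟨⟨0, hr⟩⟩
  obtain ⟨y, hy⟩ := Fintype.exists_le_card_fiber_of_mul_le_card c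
    (n := t) (by rwa [Fintype.card_fin, Fintype.card_fin])
  refine (hG {x | c x = y} fun e he hsub => ?_).not_ge hy
  obtain ⟨u, hu, v, hv, huv⟩ := hc e he
  exact huv ((Finset.mem_filter.1 (hsub hu)).2.trans (Finset.mem_filter.1 (hsub hv)).2.symm)

theorem cube_mul_lt_of_mul_pow_le {k p N W h : ℕ} (hk : 25 ≤ k) (hkp : k ^ 2 < p)
    (hpk : p ≤ 2 * k ^ 2) (hN : N ≤ k ^ (3 * k ^ 3)) (hh : h = 24 * k ^ 3)
    (hW : W * k ^ h
      ≤ (p ^ (2 * (p * k)) * (p ^ 2 * k * k) ^ h + (5 * p ^ 3) ^ h) * (p ^ 3) ^ h) :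
    N ^ 3 * W < (p ^ 3) ^ (2 * h) := by
  have hk0 : 0 < k := by omega
  have hp0 : 0 < p := by omega
  have hk3 : 0 < k ^ 3 := by positivity
  have h1 : p ^ (2 * (p * k)) ≤ k ^ (12 * k ^ 3) := by
    calc p ^ (2 * (p * k)) ≤ p ^ (2 * (2 * k ^ 2 * k)) := by gcongr
      _ ≤ (k ^ 3) ^ (2 * (2 * k ^ 2 * k)) := by
        gcongr
        calc p ≤ 2 * k ^ 2 := hpk
          _ ≤ k * k ^ 2 := by gcongr; omega
          _ = k ^ 3 := by ring
      _ = k ^ (12 * k ^ 3) := by rw [← pow_mul]; congr 1; ring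
  have h2 : 5 ^ h ≤ k ^ (12 * k ^ 3) := by
    calc 5 ^ h = (5 ^ 2) ^ (12 * k ^ 3) := by rw [← pow_mul, hh]; congr 1; ring
      _ ≤ _ := Nat.pow_le_pow_left (by omega) _
  have h3 : p ^ 2 * k * k ≤ p ^ 3 := by
    calc p ^ 2 * k * k = p ^ 2 * k ^ 2 := by ring
      _ ≤ p ^ 2 * p := by gcongr
      _ = p ^ 3 := by ring
  have h4 : (k ^ (3 * k ^ 3)) ^ 3 * (k ^ (12 * k ^ 3) + k ^ (12 * k ^ 3)) < k ^ h := by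
    calc (k ^ (3 * k ^ 3)) ^ 3 * (k ^ (12 * k ^ 3) + k ^ (12 * k ^ 3))
        = 2 * k ^ (21 * k ^ 3) := by
          rw [← pow_mul, ← two_mul, mul_left_comm, ← pow_add]; congr 2; ring
      _ < k * k ^ (21 * k ^ 3) := by gcongr; omega
      _ = k ^ (21 * k ^ 3 + 1) := (pow_succ' _ _).symm
      _ ≤ k ^ h := Nat.pow_le_pow_right hk0 (by omega)
  refine lt_of_mul_lt_mul_right (a := k ^ h) ?_ (Nat.zero_le _)
  rw [mul_assoc]
  calc _ ≤ (k ^ (3 * k ^ 3)) ^ 3 *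
          ((p ^ (2 * (p * k)) * (p ^ 2 * k * k) ^ h + (5 * p ^ 3) ^ h) * (p ^ 3) ^ h) := by
        gcongr
    _ ≤ (k ^ (3 * k ^ 3)) ^ 3 *
          ((k ^ (12 * k ^ 3) * (p ^ 3) ^ h + k ^ (12 * k ^ 3) * (p ^ 3) ^ h)
            * (p ^ 3) ^ h) := by
        rw [mul_pow 5]
        gcongr
    _ = ((k ^ (3 * k ^ 3)) ^ 3 * (k ^ (12 * k ^ 3) + k ^ (12 * k ^ 3))) *
          (p ^ 3) ^ (2 * h) := by ring
    _ < k ^ h * (p ^ 3) ^ (2 * h) := by gcongr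
    _ = _ := mul_comm _ _

/-- Superexponential lower bound for the Ramsey number of `K₄` against an independent set. -/
theorem exists_free_K4_forall_indepSet_card_lt {k N : ℕ} (hk : 25 ≤ k)
    (hN : N ≤ k ^ (3 * k ^ 3)) :
    ∃ G : ThreeGraph, G.n = N ∧ G.Free K4 ∧ ∀ S, G.IndepSet S → S.card < 72 * k ^ 3 := by
  obtain ⟨p, hp, hkp, hpk⟩ := Nat.exists_prime_lt_and_le_two_mul (k ^ 2) (by positivity)
  have : Fact p.Prime := ⟨hp⟩
  have hk0 : 0 < k := by omega
  have hkp' : k ≤ p := (Nat.le_self_pow two_ne_zero k).trans hkp.le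
  have hk3 : 0 < k ^ 3 := by positivity
  obtain ⟨h, hh⟩ : ∃ h, h = 24 * k ^ 3 := ⟨_, rfl⟩
  have hcard : Fintype.card (ZMod p × ZMod p × ZMod p) = p ^ 3 := by
    simp only [Fintype.card_prod, ZMod.card]; ring
  have hlt := cube_mul_lt_of_mul_pow_le hk hkp hpk hN hh
    (FlagRel.card_unrelated_le (p := p) (h := h) hk0 hkp')
  rw [← hcard] at hlt
  obtain ⟨χ, hχ⟩ := ThreeGraph.exists_ofPairColoring_forall_indepSet_card_lt
    (FlagRel (p := p)) (by omega) hlt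
  refine ⟨ThreeGraph.ofPairColoring FlagRel χ, rfl,
    ThreeGraph.free_K4_ofPairColoring (F := FlagRel (p := p))
      (fun _ _ _ hbc hbd => hbc.not_trans hbd) χ, fun S hS =>
      (hχ S hS).trans_eq (by rw [hh]; ring)⟩

theorem mul_log_le_of_cube_mul_log_le {x L : ℝ} (hx : 1 ≤ x) (hL : 1 ≤ L)
    (h : x ^ 3 * Real.log x ≤ L) : x ^ 3 * Real.log L ≤ 6 * L := by
  rcases le_or_gt (Real.log L) (6 * Real.log x) with h1 | h1
  · calc x ^ 3 * Real.log L ≤ x ^ 3 * (6 * Real.log x) := by gcongr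
      _ = 6 * (x ^ 3 * Real.log x) := by ring
      _ ≤ 6 * L := by gcongr
  · have h2 : x ^ 6 < L := by
      rw [← Real.log_lt_log_iff (by positivity) (by positivity), Real.log_pow]
      exact_mod_cast h1
    have h3 : x ^ 3 ≤ √L := Real.le_sqrt_of_sq_le (by linarith [show (x ^ 3) ^ 2 = x ^ 6 by ring])
    have h4 : Real.log L ≤ 2 * √L := by
      have h5 := Real.log_le_self (Real.sqrt_nonneg L)
      rw [Real.log_sqrt (by positivity)] at h5
      linarith
    calc x ^ 3 * Real.log L ≤ √L * (2 * √L) :=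
          mul_le_mul h3 h4 (Real.log_nonneg hL) (Real.sqrt_nonneg _)
      _ = 2 * L := by rw [mul_left_comm, Real.mul_self_sqrt (by positivity)]
      _ ≤ 6 * L := by linarith

theorem exists_le_pow_cube_and_cube_le {r : ℕ} (hr : 3 ≤ r) :
    ∃ k : ℕ, 25 ≤ k ∧ r ≤ k ^ k ^ 3 ∧
      (k : ℝ) ^ 3 ≤ 25 ^ 3 * (Real.log r / Real.log (Real.log r)) := by
  have hex : ∃ k : ℕ, 25 ≤ k ∧ r ≤ k ^ k ^ 3 :=
    ⟨r + 25, by omega, (Nat.le_add_right _ _).trans (Nat.le_self_pow (by positivity) _)⟩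
  have hr' : (3 : ℝ) ≤ r := by exact_mod_cast hr
  have hL : 1 < Real.log r := by
    rw [Real.lt_log_iff_exp_lt (by linarith)]
    linarith [Real.exp_one_lt_d9]
  have hLL : 0 < Real.log (Real.log r) := Real.log_pos hL
  have hone : 1 ≤ Real.log r / Real.log (Real.log r) :=
    (one_le_div hLL).2 (Real.log_le_self (by linarith))
  classical
  obtain ⟨k, ⟨hk, hrk⟩, hmin⟩ : ∃ k, (25 ≤ k ∧ r ≤ k ^ k ^ 3) ∧
      ∀ j < k, ¬ (25 ≤ j ∧ r ≤ j ^ j ^ 3) :=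
    ⟨Nat.find hex, Nat.find_spec hex, fun j hj => Nat.find_min hex hj⟩
  refine ⟨k, hk, hrk, ?_⟩
  rcases hk.eq_or_lt with rfl | hk'
  · push_cast
    linarith
  obtain ⟨j, rfl⟩ : ∃ j, k = j + 1 := ⟨k - 1, by omega⟩
  have hj : j ^ j ^ 3 < r := by
    by_contra! h
    exact hmin j (by omega) ⟨by omega, h⟩
  have hj1 : (1 : ℝ) ≤ j := by exact_mod_cast (by omega : 1 ≤ j)
  have hjL : (j : ℝ) ^ 3 * Real.log j ≤ Real.log r := by
    have h1 : Real.log ((j : ℝ) ^ j ^ 3) ≤ Real.log r :=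
      Real.log_le_log (by positivity) (by exact_mod_cast hj.le)
    rw [Real.log_pow] at h1
    exact_mod_cast h1
  have h2 : (j : ℝ) ^ 3 ≤ 6 * (Real.log r / Real.log (Real.log r)) := by
    rw [← mul_div_assoc, le_div_iff₀ hLL]
    exact mul_log_le_of_cube_mul_log_le hj1 hL.le hjL
  calc ((j + 1 : ℕ) : ℝ) ^ 3 ≤ (2 * j) ^ 3 := by
        push_cast
        gcongr
        linarith
    _ = 8 * (j : ℝ) ^ 3 := by ring
    _ ≤ 25 ^ 3 * (Real.log r / Real.log (Real.log r)) := by linarith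

/-- There is a constant `C > 0` such that
`m_{K_4}(r) ≤ C·r^3·(ln r / ln ln r)^3` for all `r ≥ 3`. -/
theorem mH_K4_upper :
    ∃ C : ℝ, 0 < C ∧ ∀ r : ℕ, 3 ≤ r →
      ∃ G : ThreeGraph, G.Free K4 ∧ ¬ G.Colorable r ∧
        (G.edges.card : ℝ) ≤
          C * (r : ℝ) ^ 3 * (Real.log r / Real.log (Real.log r)) ^ 3 := by
  refine ⟨(72 * 25 ^ 3) ^ 3, by positivity, fun r hr => ?_⟩
  obtain ⟨k, hk, hrk, hkL⟩ := exists_le_pow_cube_and_cube_le hr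
  have hN : r * (72 * k ^ 3) ≤ k ^ (3 * k ^ 3) := by
    have hk3 : 0 < k ^ 3 := by positivity
    calc r * (72 * k ^ 3) ≤ k ^ k ^ 3 * (k ^ 2 * k ^ 3) := by
          gcongr
          nlinarith
      _ = k ^ (k ^ 3 + 5) := by ring
      _ ≤ k ^ (3 * k ^ 3) := by
          have : 25 ^ 3 ≤ k ^ 3 := Nat.pow_le_pow_left hk 3
          gcongr <;> omega
  obtain ⟨G, hGn, hfree, hindep⟩ := exists_free_K4_forall_indepSet_card_lt hk hN
  refine ⟨G, hfree, ThreeGraph.not_colorable_of_forall_indepSet_card_lt hindep hGn.ge (by omega),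
    ?_⟩
  calc (G.edges.card : ℝ) ≤ ((r * (72 * k ^ 3) : ℕ) : ℝ) ^ 3 := by
        rw [← hGn]
        exact_mod_cast G.card_edges_le
    _ = (72 * r * (k : ℝ) ^ 3) ^ 3 := by push_cast; ring
    _ ≤ (72 * r * (25 ^ 3 * (Real.log r / Real.log (Real.log r)))) ^ 3 := by gcongr
    _ = _ := by ring
end

section
/- Let H be the 3-graph on the vertex set {1,2,3,4,5,6,7} with edges {1,2,3}, {1,4,5}, {1,6,7}, {2,4,6}. Then for all integers r ≥ 1 one has m_H(r) > (e/288)·r^4, where e is Euler's number. -/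
/-- The 3-graph on 7 vertices with edges `{1,2,3}, {1,4,5}, {1,6,7}, {2,4,6}`
(here written 0-indexed). -/
def H7 : ThreeGraph where
  n := 7
  edges := {({0, 1, 2} : Finset (Fin 7)), {0, 3, 4}, {0, 5, 6}, {1, 3, 5}}
  card_eq := by set_option maxRecDepth 10000 in decide

section ListColoring

variable {V : Type*} [Fintype V] [DecidableEq V]

/-- Colorings of `S` from the lists `L` (with the value `0` outside `S`) such that no member of `E`
inside `S` is monochromatic. -/
def partialColorings (E : Finset (Finset V)) (L : V → Finset ℕ) (S : Finset V) :
    Finset (V → ℕ) :=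
  (Fintype.piFinset fun v => if v ∈ S then L v else {0}).filter
    (fun c => ∀ e ∈ E, e ⊆ S → ∃ u ∈ e, ∃ w ∈ e, c u ≠ c w)

theorem mem_partialColorings {E : Finset (Finset V)} {L : V → Finset ℕ} {S : Finset V}
    {c : V → ℕ} : c ∈ partialColorings E L S ↔
      ((∀ v ∈ S, c v ∈ L v) ∧ ∀ v ∉ S, c v = 0) ∧
        ∀ e ∈ E, e ⊆ S → ∃ u ∈ e, ∃ w ∈ e, c u ≠ c w := by
  simp only [partialColorings, Finset.mem_filter, Fintype.mem_piFinset]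
  refine and_congr_left fun _ => ⟨fun h => ⟨fun v hv => ?_, fun v hv => ?_⟩, fun h v => ?_⟩
  · simpa [hv] using h v
  · simpa [hv] using h v
  · by_cases hv : v ∈ S
    · simpa [hv] using h.1 v hv
    · simpa [hv] using h.2 v hv

/-- Extensions of colorings of `S` to `v` that make `e` monochromatic are determined by their
restriction to `S` minus one further vertex of `e`. -/
theorem card_monochromatic_extensions_le (E : Finset (Finset V)) (L : V → Finset ℕ)
    {S e : Finset V} {v x y : V} (hx : x ∈ e.erase v) (hy : y ∈ e.erase v) (hxy : x ≠ y) :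
    ((partialColorings E L S ×ˢ L v).filter (fun p => ∀ u ∈ e.erase v, p.1 u = p.2)).card ≤
      (partialColorings E L (S.erase x)).card := by
  refine Finset.card_le_card_of_injOn (fun p => Function.update p.1 x 0) ?_ ?_
  · rintro ⟨c, j⟩ hp
    simp only [Finset.coe_filter, Finset.mem_product, Set.mem_ofPred_eq] at hp
    obtain ⟨⟨hc, -⟩, -⟩ := hp
    rw [mem_partialColorings] at hc
    obtain ⟨⟨h1, h2⟩, h3⟩ := hc
    simp only [Finset.mem_coe, mem_partialColorings]
    refine ⟨⟨fun w hw => ?_, fun w hw => ?_⟩, fun f hf hfS => ?_⟩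
    · rw [Finset.mem_erase] at hw
      rw [Function.update_of_ne hw.1]
      exact h1 w hw.2
    · by_cases hwx : w = x
      · simp [hwx]
      · rw [Function.update_of_ne hwx]
        exact h2 w fun h => hw (Finset.mem_erase.2 ⟨hwx, h⟩)
    · obtain ⟨u, hu, w, hw, huw⟩ := h3 f hf (hfS.trans (Finset.erase_subset _ _))
      refine ⟨u, hu, w, hw, ?_⟩
      rwa [Function.update_of_ne (Finset.mem_erase.1 (hfS hu)).1,
        Function.update_of_ne (Finset.mem_erase.1 (hfS hw)).1]
  · rintro ⟨c, j⟩ hp ⟨c', j'⟩ hp' h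
    simp only [Finset.coe_filter, Set.mem_ofPred_eq] at hp hp'
    have hc : ∀ w, w ≠ x → c w = c' w := fun w hw => by
      simpa [Function.update_of_ne hw] using congrFun h w
    have hj : j = j' := by
      rw [← hp.2 y hy, ← hp'.2 y hy]
      exact hc y hxy.symm
    refine Prod.ext (funext fun w => ?_) hj
    by_cases hw : w = x
    · subst hw
      exact (hp.2 w hx).trans (hj.trans (hp'.2 w hx).symm)
    · exact hc w hw

theorem card_mul_card_le_card_partialColorings_insert (E : Finset (Finset V))
    (L : V → Finset ℕ) {S : Finset V} {v : V} (hv : v ∉ S) :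
    (partialColorings E L S).card * (L v).card ≤ (partialColorings E L (insert v S)).card +
      ∑ e ∈ E.filter (fun e => v ∈ e ∧ e ⊆ insert v S),
        ((partialColorings E L S ×ˢ L v).filter (fun p => ∀ u ∈ e.erase v, p.1 u = p.2)).card := by
  rw [← Finset.card_product]
  set F := E.filter (fun e => v ∈ e ∧ e ⊆ insert v S) with hF
  set P := partialColorings E L S ×ˢ L v with hP
  have hsub : P ⊆ P.filter (fun p => ∀ e ∈ F, ¬ ∀ u ∈ e.erase v, p.1 u = p.2) ∪
      F.biUnion fun e => P.filter (fun p => ∀ u ∈ e.erase v, p.1 u = p.2) := by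
    intro p hp
    by_cases h : ∀ e ∈ F, ¬ ∀ u ∈ e.erase v, p.1 u = p.2
    · exact Finset.mem_union_left _ (Finset.mem_filter.2 ⟨hp, h⟩)
    · push Not at h
      obtain ⟨e, he, h⟩ := h
      exact Finset.mem_union_right _
        (Finset.mem_biUnion.2 ⟨e, he, Finset.mem_filter.2 ⟨hp, h⟩⟩)
  refine (Finset.card_le_card hsub).trans ((Finset.card_union_le _ _).trans
    (add_le_add ?_ Finset.card_biUnion_le))
  refine Finset.card_le_card_of_injOn (fun p => Function.update p.1 v p.2) ?_ ?_
  · rintro ⟨c, j⟩ hp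
    simp only [Finset.coe_filter, hP, Finset.mem_product, Set.mem_ofPred_eq] at hp
    obtain ⟨⟨hc, hj⟩, hgood⟩ := hp
    rw [mem_partialColorings] at hc
    obtain ⟨⟨h1, h2⟩, h3⟩ := hc
    simp only [Finset.mem_coe, mem_partialColorings]
    refine ⟨⟨fun w hw => ?_, fun w hw => ?_⟩, fun f hf hfS => ?_⟩
    · by_cases hwv : w = v
      · subst hwv
        simpa using hj
      · rw [Function.update_of_ne hwv]
        exact h1 w (Finset.mem_of_mem_insert_of_ne hw hwv)
    · rw [Finset.mem_insert, not_or] at hw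
      rw [Function.update_of_ne hw.1]
      exact h2 w hw.2
    · by_cases hvf : v ∈ f
      · have := hgood f (Finset.mem_filter.2 ⟨hf, hvf, hfS⟩)
        push Not at this
        obtain ⟨u, hu, hne⟩ := this
        rw [Finset.mem_erase] at hu
        refine ⟨u, hu.2, v, hvf, ?_⟩
        rwa [Function.update_of_ne hu.1, Function.update_self]
      · obtain ⟨u, hu, w, hw, huw⟩ := h3 f hf ((Finset.subset_insert_iff_of_notMem hvf).1 hfS)
        refine ⟨u, hu, w, hw, ?_⟩
        rwa [Function.update_of_ne (ne_of_mem_of_not_mem hu hvf),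
          Function.update_of_ne (ne_of_mem_of_not_mem hw hvf)]
  · rintro ⟨c, j⟩ hp ⟨c', j'⟩ hp' h
    simp only [Finset.coe_filter, hP, Finset.mem_product, Set.mem_ofPred_eq,
      mem_partialColorings] at hp hp'
    refine Prod.ext (funext fun w => ?_) (by simpa using congrFun h v)
    by_cases hw : w = v
    · subst hw
      exact (hp.1.1.1.2 w hv).trans (hp'.1.1.1.2 w hv).symm
    · simpa [Function.update_of_ne hw] using congrFun h w

theorem mul_card_partialColorings_le_insert {E : Finset (Finset V)}
    (hE : ∀ e ∈ E, e.card = 3) {L : V → Finset ℕ} {β : ℝ} (hβ : 0 < β)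
    (hL : ∀ v, β + ((E.filter (fun e => v ∈ e)).card : ℝ) / β ≤ (L v).card)
    (S : Finset V) (v : V) (hv : v ∉ S) :
    β * (partialColorings E L S).card ≤ (partialColorings E L (insert v S)).card := by
  induction S using Finset.strongInduction generalizing v with
  | H S ih =>
    have hbad : ∀ e ∈ E.filter (fun e => v ∈ e ∧ e ⊆ insert v S),
        (((partialColorings E L S ×ˢ L v).filter
          (fun p => ∀ u ∈ e.erase v, p.1 u = p.2)).card : ℝ) ≤
            (partialColorings E L S).card / β := by
      intro e he
      obtain ⟨heE, hve, heS⟩ := Finset.mem_filter.1 he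
      have hcard : (e.erase v).card = 2 := by rw [Finset.card_erase_of_mem hve, hE e heE]
      obtain ⟨x, y, hxy, hexy⟩ := Finset.card_eq_two.1 hcard
      have hx : x ∈ e.erase v := by simp [hexy]
      have hy : y ∈ e.erase v := by simp [hexy]
      have hxS : x ∈ S := Finset.mem_of_mem_insert_of_ne (heS (Finset.mem_of_mem_erase hx))
        (Finset.ne_of_mem_erase hx)
      have h1 := ih (S.erase x) (Finset.erase_ssubset hxS) x (Finset.notMem_erase x S)
      rw [Finset.insert_erase hxS] at h1
      rw [le_div_iff₀ hβ, mul_comm]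
      refine le_trans ?_ h1
      gcongr
      exact card_monochromatic_extensions_le E L hx hy hxy
    have hmain := card_mul_card_le_card_partialColorings_insert E L hv
    have hsum := Finset.sum_le_sum hbad
    rw [Finset.sum_const, nsmul_eq_mul] at hsum
    have hdeg : ((E.filter (fun e => v ∈ e ∧ e ⊆ insert v S)).card : ℝ) ≤
        ((E.filter (fun e => v ∈ e)).card : ℝ) := by
      refine Nat.cast_le.2 (Finset.card_le_card fun e he => ?_)
      rw [Finset.mem_filter] at he ⊢
      exact ⟨he.1, he.2.1⟩
    have hmain' : ((partialColorings E L S).card : ℝ) * (L v).card ≤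
        (partialColorings E L (insert v S)).card +
        ∑ e ∈ E.filter (fun e => v ∈ e ∧ e ⊆ insert v S),
          (((partialColorings E L S ×ˢ L v).filter
            (fun p => ∀ u ∈ e.erase v, p.1 u = p.2)).card : ℝ) := by exact_mod_cast hmain
    have h2 := mul_le_mul_of_nonneg_left (hL v)
      (Nat.cast_nonneg (α := ℝ) (partialColorings E L S).card)
    have h3 := mul_le_mul_of_nonneg_right hdeg
      (div_nonneg (Nat.cast_nonneg (α := ℝ) (partialColorings E L S).card) hβ.le)
    have h4 : ((E.filter (fun e => v ∈ e)).card : ℝ) * ((partialColorings E L S).card / β) =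
        (partialColorings E L S).card * (((E.filter (fun e => v ∈ e)).card : ℝ) / β) := by ring
    linarith

/-- A 3-uniform family is colorable from lists of size at least `β + deg v / β`. -/
theorem exists_list_coloring {E : Finset (Finset V)} (hE : ∀ e ∈ E, e.card = 3)
    {L : V → Finset ℕ} {β : ℝ} (hβ : 0 < β)
    (hL : ∀ v, β + ((E.filter (fun e => v ∈ e)).card : ℝ) / β ≤ (L v).card) :
    ∃ c : V → ℕ, (∀ v, c v ∈ L v) ∧ ∀ e ∈ E, ∃ u ∈ e, ∃ w ∈ e, c u ≠ c w := by
  have hpos : ∀ S : Finset V, 0 < (partialColorings E L S).card := by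
    intro S
    induction S using Finset.induction_on with
    | empty =>
      refine Finset.card_pos.2 ⟨fun _ => 0, mem_partialColorings.2 ⟨by simp, fun e he h => ?_⟩⟩
      have := hE e he
      simp [Finset.subset_empty.1 h] at this
    | insert v S hv ih =>
      have h := mul_card_partialColorings_le_insert hE hβ hL S v hv
      have : (0 : ℝ) < β * (partialColorings E L S).card := by positivity
      exact_mod_cast this.trans_le h
  obtain ⟨c, hc⟩ := Finset.card_pos.1 (hpos Finset.univ)
  rw [mem_partialColorings] at hc
  exact ⟨c, fun v => hc.1.1 v (Finset.mem_univ v), fun e he => hc.2 e he (Finset.subset_univ e)⟩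

end ListColoring

section Peeling

variable {V : Type*} [Fintype V] [DecidableEq V]

/-- Peeling off vertices of large degree: all subsets of `U` meet many members of `E`, while the
part of `E` that avoids `U` has small degrees. -/
theorem exists_peeling (E : Finset (Finset V)) (θ : ℝ) :
    ∃ U : Finset V, (∀ S ⊆ U, θ * S.card ≤ (E.filter (fun e => ¬ Disjoint e S)).card) ∧
      ∀ v ∉ U, ((E.filter (fun e => v ∈ e ∧ Disjoint e U)).card : ℝ) ≤ θ := by
  obtain ⟨U, hU⟩ := (Set.toFinite {U : Finset V | ∀ S ⊆ U,
    θ * S.card ≤ (E.filter (fun e => ¬ Disjoint e S)).card}).exists_maximal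
      ⟨∅, fun S hS => by simp [Finset.subset_empty.1 hS]⟩
  refine ⟨U, hU.prop, fun v hv => ?_⟩
  by_contra! hdeg
  refine hv (hU.le_of_ge (y := insert v U) (fun S hS => ?_) (Finset.subset_insert v U)
    (Finset.mem_insert_self v U))
  by_cases hvS : v ∈ S
  · have hSU : S.erase v ⊆ U := Finset.subset_insert_iff.1 hS
    have h1 := hU.prop (S.erase v) hSU
    have hdisj : Disjoint (E.filter (fun e => ¬ Disjoint e (S.erase v)))
        (E.filter (fun e => v ∈ e ∧ Disjoint e U)) :=
      Finset.disjoint_filter.2 fun e _ h h' => h (h'.2.mono_right hSU)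
    have hsub : E.filter (fun e => ¬ Disjoint e (S.erase v)) ∪
        E.filter (fun e => v ∈ e ∧ Disjoint e U) ⊆ E.filter (fun e => ¬ Disjoint e S) := by
      intro e he
      simp only [Finset.mem_union, Finset.mem_filter] at he ⊢
      rcases he with ⟨he, h⟩ | ⟨he, h, -⟩
      · exact ⟨he, fun h' => h (h'.mono_right (Finset.erase_subset v S))⟩
      · exact ⟨he, Finset.not_disjoint_iff.2 ⟨v, h, hvS⟩⟩
    have hcard := Finset.card_le_card hsub
    rw [Finset.card_union_of_disjoint hdisj] at hcard
    have hcard' : ((E.filter (fun e => ¬ Disjoint e (S.erase v))).card : ℝ) +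
        (E.filter (fun e => v ∈ e ∧ Disjoint e U)).card ≤
          (E.filter (fun e => ¬ Disjoint e S)).card := by exact_mod_cast hcard
    have hS1 : (S.card : ℝ) = (S.erase v).card + 1 := by
      exact_mod_cast (Finset.card_erase_add_one hvS).symm
    rw [hS1]
    linarith
  · exact hU.prop S ((Finset.subset_insert_iff_of_notMem hvS).1 hS)

end Peeling

/-- A set containing no member of a 3-uniform family meets at least half as many members as the
sum of its degrees. -/
theorem sum_degree_le_two_mul_card {V : Type*} [DecidableEq V] {E : Finset (Finset V)}
    (hE : ∀ e ∈ E, e.card = 3)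
    {T : Finset V} (hT : ∀ e ∈ E, ¬ e ⊆ T) :
    ∑ v ∈ T, (E.filter (fun e => v ∈ e)).card ≤
      2 * (E.filter (fun e => ¬ Disjoint e T)).card := by
  have h1 : ∑ v ∈ T, (E.filter (fun e => v ∈ e)).card = ∑ e ∈ E, (T.filter (· ∈ e)).card :=
    Finset.sum_card_bipartiteAbove_eq_sum_card_bipartiteBelow (fun v e => v ∈ e)
  rw [h1, mul_comm, ← smul_eq_mul, ← Finset.sum_const, Finset.sum_filter]
  refine Finset.sum_le_sum fun e he => ?_
  split_ifs with h
  · rw [Finset.filter_eq_empty_iff.2 fun x hx hxe => Finset.disjoint_left.1 h hxe hx]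
    simp
  · have hss : T.filter (· ∈ e) ⊂ e := by
      refine Finset.ssubset_iff_subset_ne.2 ⟨fun x hx => (Finset.mem_filter.1 hx).2, fun h' => ?_⟩
      exact hT e he (h' ▸ Finset.filter_subset _ _)
    have := Finset.card_lt_card hss
    rw [hE e he] at this
    omega

namespace ThreeGraph

/-- The edges `{v, x i, y i}` through `v` of three different colors form, together with an edge
`{x i, x j, x k}`, a copy of `H7`. -/
theorem indepSet_image_of_free {G : ThreeGraph} (hG : G.Free H7) {r : ℕ} {v : Fin G.n}
    {x y : Fin r → Fin G.n} {c : Fin G.n → ℕ}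
    (hx : ∀ j, c (x j) = j) (hy : ∀ j, c (y j) = j)
    (hedge : ∀ j, ({v, x j, y j} : Finset (Fin G.n)) ∈ G.edges) :
    G.IndepSet (Finset.univ.image x) := by
  intro e he hsub
  have hne : ∀ j, v ≠ x j ∧ v ≠ y j ∧ x j ≠ y j := fun j => by
    have := G.card_eq _ (hedge j)
    refine ⟨fun h => ?_, fun h => ?_, fun h => ?_⟩
    · have h' := Finset.card_le_two (a := x j) (b := y j)
      simp [h] at this
      omega
    · have h' := Finset.card_le_two (a := x j) (b := y j)
      rw [h, Finset.insert_eq_of_mem (by simp)] at this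
      omega
    · have h' := Finset.card_le_two (a := v) (b := y j)
      simp [h] at this
      omega
  obtain ⟨p, q, s, hpq, hps, hqs, rfl⟩ := Finset.card_eq_three.1 (G.card_eq e he)
  have hmem : ∀ w ∈ ({p, q, s} : Finset (Fin G.n)), ∃ j, x j = w := fun w hw => by
    simpa using hsub hw
  obtain ⟨i, rfl⟩ := hmem p (by simp)
  obtain ⟨j, rfl⟩ := hmem q (by simp)
  obtain ⟨k, rfl⟩ := hmem s (by simp)
  have cne : ∀ {a b : Fin r}, a ≠ b → x a ≠ x b ∧ x a ≠ y b ∧ y a ≠ x b ∧ y a ≠ y b := by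
    intro a b hab
    refine ⟨fun h => hab ?_, fun h => hab ?_, fun h => hab ?_, fun h => hab ?_⟩ <;>
    · have := congrArg c h
      simp only [hx, hy] at this
      exact Fin.ext this
  have hij : i ≠ j := fun h => hpq (h ▸ rfl)
  have hik : i ≠ k := fun h => hps (h ▸ rfl)
  have hjk : j ≠ k := fun h => hqs (h ▸ rfl)
  obtain ⟨a1, a2, a3, a4⟩ := cne hij
  obtain ⟨b1, b2, b3, b4⟩ := cne hik
  obtain ⟨d1, d2, d3, d4⟩ := cne hjk
  obtain ⟨i1, i2, i3⟩ := hne i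
  obtain ⟨j1, j2, j3⟩ := hne j
  obtain ⟨k1, k2, k3⟩ := hne k
  let f : Fin 7 → Fin G.n := ![v, x i, y i, x j, y j, x k, y k]
  have hf : Function.Injective f := by
    have hnodup : [v, x i, y i, x j, y j, x k, y k].Nodup := by
      simp [*]
    exact List.nodup_ofFn.1 (by simpa [f] using hnodup)
  have him (a b d : Fin 7) : ({a, b, d} : Finset (Fin 7)).image f = {f a, f b, f d} := by
    simp only [Finset.image_insert, Finset.image_singleton]
  have hcopy : ∀ e' ∈ ({({0, 1, 2} : Finset (Fin 7)), {0, 3, 4}, {0, 5, 6}, {1, 3, 5}} :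
      Finset (Finset (Fin 7))), e'.image f ∈ G.edges := by
    simp only [Finset.mem_insert, Finset.mem_singleton]
    rintro e' (rfl | rfl | rfl | rfl)
    · exact (him 0 1 2).symm ▸ hedge i
    · exact (him 0 3 4).symm ▸ hedge j
    · exact (him 0 5 6).symm ▸ hedge k
    · exact (him 1 3 5).symm ▸ he
  exact hG ⟨⟨f, hf⟩, hcopy⟩

/-- Delete all edges that meet `T`. -/
def deleteMeeting (G : ThreeGraph) (T : Finset (Fin G.n)) : ThreeGraph where
  n := G.n
  edges := G.edges.filter (fun e => Disjoint e T)
  card_eq := fun e he => G.card_eq e (Finset.mem_of_mem_filter e he)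

theorem Free.deleteMeeting {G H : ThreeGraph} (hG : G.Free H) (T : Finset (Fin G.n)) :
    (G.deleteMeeting T).Free H := fun ⟨f, hf⟩ =>
  hG ⟨f, fun e he => Finset.mem_of_mem_filter _ (hf e he)⟩

theorem IndepSet.colorable_succ {G : ThreeGraph} {T : Finset (Fin G.n)} (hT : G.IndepSet T)
    {r : ℕ} (h : (G.deleteMeeting T).Colorable r) : G.Colorable (r + 1) := by
  obtain ⟨c, hc⟩ : ∃ c : Fin G.n → Fin r, ∀ e ∈ G.edges.filter (fun e => Disjoint e T),
    ∃ u ∈ e, ∃ v ∈ e, c u ≠ c v := h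
  refine ⟨fun v => if v ∈ T then Fin.last r else (c v).castSucc, fun e he => ?_⟩
  by_cases hd : Disjoint e T
  · obtain ⟨u, hu, w, hw, huw⟩ := hc e (Finset.mem_filter.2 ⟨he, hd⟩)
    refine ⟨u, hu, w, hw, ?_⟩
    beta_reduce
    rw [if_neg (Finset.disjoint_left.1 hd hu), if_neg (Finset.disjoint_left.1 hd hw)]
    exact fun h => huw (Fin.castSucc_injective r h)
  · obtain ⟨u, hu, huT⟩ := Finset.not_disjoint_iff.1 hd
    obtain ⟨w, hw, hwT⟩ := Finset.not_subset.1 (hT e he)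
    refine ⟨u, hu, w, hw, ?_⟩
    beta_reduce
    rw [if_pos huT, if_neg hwT]
    exact (Fin.castSucc_lt_last _).ne'

/-- If `G` is not `r`-colorable, a partial coloring can be extended greedily until some vertex `v`
lies, for each color, in an edge whose other two vertices have that color. -/
theorem exists_stuck_vertex {G : ThreeGraph} {r : ℕ} (hcol : ¬ G.Colorable r)
    {S₀ : Finset (Fin G.n)} {c₀ : Fin G.n → ℕ} (hlt : ∀ v ∈ S₀, c₀ v < r)
    (hproper : ∀ e ∈ G.edges, e ⊆ S₀ → ∃ u ∈ e, ∃ w ∈ e, c₀ u ≠ c₀ w) :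
    ∃ (c : Fin G.n → ℕ) (v : Fin G.n) (x y : Fin r → Fin G.n), (∀ u ∈ S₀, c u = c₀ u) ∧
      (∀ j, c (x j) = j) ∧ (∀ j, c (y j) = j) ∧
      ∀ j, ({v, x j, y j} : Finset (Fin G.n)) ∈ G.edges := by
  obtain ⟨S, hS⟩ := (Set.toFinite {S : Finset (Fin G.n) | S₀ ⊆ S ∧ ∃ c : Fin G.n → ℕ,
    (∀ u ∈ S₀, c u = c₀ u) ∧ (∀ u ∈ S, c u < r) ∧
      ∀ e ∈ G.edges, e ⊆ S → ∃ u ∈ e, ∃ w ∈ e, c u ≠ c w}).exists_maximal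
        ⟨S₀, subset_rfl, c₀, fun _ _ => rfl, hlt, hproper⟩
  obtain ⟨hS₀, c, hcc, hcr, hce⟩ := hS.prop
  obtain ⟨v, hv⟩ : ∃ v, v ∉ S := by
    by_contra! hall
    refine hcol ⟨fun v => ⟨c v, hcr v (hall v)⟩, fun e he => ?_⟩
    obtain ⟨u, hu, w, hw, huw⟩ := hce e he fun x _ => hall x
    exact ⟨u, hu, w, hw, fun h => huw (Fin.mk.inj h)⟩
  have key : ∀ j : Fin r, ∃ x y : Fin G.n, c x = j ∧ c y = j ∧
      ({v, x, y} : Finset (Fin G.n)) ∈ G.edges := by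
    intro j
    by_contra! hno
    refine hv (hS.le_of_ge (y := insert v S) ⟨hS₀.trans (Finset.subset_insert v S),
      Function.update c v j, fun u hu => ?_, fun u hu => ?_, fun e he heS => ?_⟩
      (Finset.subset_insert v S) (Finset.mem_insert_self v S))
    · rw [Function.update_of_ne (ne_of_mem_of_not_mem (hS₀ hu) hv), hcc u hu]
    · by_cases huv : u = v
      · subst huv
        simp
      · rw [Function.update_of_ne huv]
        exact hcr u (Finset.mem_of_mem_insert_of_ne hu huv)
    · by_cases hve : v ∈ e
      · have hcard : (e.erase v).card = 2 := by rw [Finset.card_erase_of_mem hve, G.card_eq e he]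
        obtain ⟨x, y, hxy, hexy⟩ := Finset.card_eq_two.1 hcard
        have hx : x ∈ e.erase v := by simp [hexy]
        have hy : y ∈ e.erase v := by simp [hexy]
        rw [Finset.mem_erase] at hx hy
        have hedge : ({v, x, y} : Finset (Fin G.n)) ∈ G.edges := by
          rwa [← hexy, Finset.insert_erase hve]
        by_cases hxj : c x = j
        · refine ⟨y, hy.2, v, hve, ?_⟩
          rw [Function.update_of_ne hy.1, Function.update_self]
          exact fun h => hno x y hxj h hedge
        · refine ⟨x, hx.2, v, hve, ?_⟩
          rwa [Function.update_of_ne hx.1, Function.update_self]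
      · obtain ⟨u, hu, w, hw, huw⟩ := hce e he ((Finset.subset_insert_iff_of_notMem hve).1 heS)
        refine ⟨u, hu, w, hw, ?_⟩
        rwa [Function.update_of_ne (ne_of_mem_of_not_mem hu hve),
          Function.update_of_ne (ne_of_mem_of_not_mem hw hve)]
  choose x y hx hy hedge using key
  exact ⟨c, v, x, y, hcc, hx, hy, hedge⟩

/-- An `H7`-free 3-graph that is not `r`-colorable has an independent set meeting many edges. -/
theorem exists_indepSet_meeting_many {G : ThreeGraph} (hG : G.Free H7) {r a : ℕ}
    (hcol : ¬ G.Colorable r) (har : a ≤ r) {β : ℝ} (hβ : 0 < β) (hβa : β ≤ a) :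
    ∃ T : Finset (Fin G.n), G.IndepSet T ∧
      ∑ j ∈ Finset.range a, β * (j - β) / 2 + (r - a) * (β * (a - β)) ≤
        (G.edges.filter (fun e => ¬ Disjoint e T)).card := by
  obtain ⟨U, hU, hdeg⟩ := exists_peeling G.edges (β * (a - β))
  set E := G.edges.filter (fun e => Disjoint e U) with hEdef
  set d : Fin G.n → ℕ := fun v => (E.filter (fun e => v ∈ e)).card with hd
  have hE : ∀ e ∈ E, e.card = 3 := fun e he => G.card_eq e (Finset.mem_of_mem_filter e he)
  have hdle : ∀ v, (d v : ℝ) ≤ β * (a - β) := by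
    intro v
    by_cases hv : v ∈ U
    · have : d v = 0 := by
        simp only [hd, hEdef, Finset.filter_filter, Finset.card_eq_zero,
          Finset.filter_eq_empty_iff]
        exact fun e _ h => Finset.disjoint_left.1 h.1 h.2 hv
      rw [this, Nat.cast_zero]
      exact mul_nonneg hβ.le (sub_nonneg.2 hβa)
    · refine le_trans (le_of_eq ?_) (hdeg v hv)
      simp only [hd, hEdef, Finset.filter_filter, and_comm]
  have hL : ∀ v, β + ((E.filter (fun e => v ∈ e)).card : ℝ) / β ≤
      ((Finset.range ⌈β + d v / β⌉₊).card : ℝ) := fun v => by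
    rw [Finset.card_range]
    exact Nat.le_ceil _
  obtain ⟨c₀, hc₀, hproper⟩ := exists_list_coloring hE hβ hL
  have hlist : ∀ v, (c₀ v : ℝ) < β + d v / β := fun v =>
    Nat.lt_ceil.1 (Finset.mem_range.1 (hc₀ v))
  have hc₀a : ∀ v, c₀ v < a := by
    intro v
    have h1 : (d v : ℝ) / β ≤ a - β := by
      rw [div_le_iff₀ hβ, mul_comm]
      exact hdle v
    have h2 := hlist v
    exact_mod_cast (show (c₀ v : ℝ) < a by linarith)
  obtain ⟨c, v, x, y, hcc, hx, hy, hedge⟩ := exists_stuck_vertex (S₀ := Uᶜ) hcol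
    (fun v _ => (hc₀a v).trans_le har) (fun e he heU => hproper e
      (Finset.mem_filter.2 ⟨he, Finset.disjoint_left.2 fun w hw => Finset.mem_compl.1 (heU hw)⟩))
  have hT := indepSet_image_of_free hG hx hy hedge
  set T := Finset.univ.image x with hTdef
  refine ⟨T, hT, ?_⟩
  have hxinj : Function.Injective x := fun i j hij => by
    have := congrArg c hij
    rw [hx, hx] at this
    exact Fin.ext this
  let g : Fin G.n → ℝ := fun w => if w ∈ U then β * (a - β) else d w / 2
  have hlow : ∀ j : Fin r,
      (if (j : ℕ) < a then β * ((j : ℕ) - β) / 2 else β * (a - β)) ≤ g (x j) := by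
    intro j
    have hθ : 0 ≤ β * (a - β) := mul_nonneg hβ.le (sub_nonneg.2 hβa)
    by_cases hxU : x j ∈ U
    · simp only [g, if_pos hxU]
      split_ifs with hja
      · have hja' : ((j : ℕ) : ℝ) ≤ a := by exact_mod_cast hja.le
        have := mul_le_mul_of_nonneg_left (sub_le_sub_right hja' β) hβ.le
        linarith
      · exact le_rfl
    · have hcj : c₀ (x j) = j := by rw [← hcc _ (Finset.mem_compl.2 hxU), hx]
      have h1 := hlist (x j)
      have h2 := hc₀a (x j)
      rw [hcj] at h1 h2
      simp only [g, if_neg hxU, if_pos h2]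
      have h3 : ((j : ℕ) : ℝ) - β < d (x j) / β := by linarith
      rw [lt_div_iff₀ hβ, mul_comm] at h3
      linarith
  have hsum : ∑ j ∈ Finset.range a, β * (j - β) / 2 + (r - a) * (β * (a - β)) ≤
      ∑ w ∈ T, g w := by
    rw [hTdef, Finset.sum_image fun _ _ _ _ h => hxinj h]
    refine le_trans (le_of_eq ?_) (Finset.sum_le_sum fun j _ => hlow j)
    rw [Fin.sum_univ_eq_sum_range
      (fun j => if j < a then β * ((j : ℝ) - β) / 2 else β * (a - β)) r,
      ← Finset.sum_range_add_sum_Ico _ har]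
    congr 1
    · exact Finset.sum_congr rfl fun j hj => by rw [if_pos (Finset.mem_range.1 hj)]
    · rw [Finset.sum_congr rfl fun j hj => if_neg (Finset.mem_Ico.1 hj).1.not_gt]
      simp [Nat.cast_sub har]
  refine hsum.trans ?_
  have hsplit : ∑ w ∈ T, g w =
      β * (a - β) * (T.filter (· ∈ U)).card + (∑ w ∈ T.filter (· ∉ U), (d w : ℝ)) / 2 := by
    simp only [g]
    rw [Finset.sum_ite, Finset.sum_const, nsmul_eq_mul, Finset.sum_div, mul_comm]
  have hhigh := hU (T.filter (· ∈ U)) fun w hw => (Finset.mem_filter.1 hw).2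
  have hlowT := sum_degree_le_two_mul_card hE (T := T.filter (· ∉ U)) fun e he hsub =>
    hT e (Finset.mem_of_mem_filter e he) (hsub.trans (Finset.filter_subset _ _))
  have hdisj : Disjoint (G.edges.filter (fun e => ¬ Disjoint e (T.filter (· ∈ U))))
      (E.filter (fun e => ¬ Disjoint e (T.filter (· ∉ U)))) := by
    refine Finset.disjoint_left.2 fun e he he' => ?_
    obtain ⟨w, hw, hwT⟩ := Finset.not_disjoint_iff.1 (Finset.mem_filter.1 he).2
    exact Finset.disjoint_left.1 (Finset.mem_filter.1 (Finset.mem_of_mem_filter e he')).2 hw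
      (Finset.mem_filter.1 hwT).2
  have hsub : G.edges.filter (fun e => ¬ Disjoint e (T.filter (· ∈ U))) ∪
      E.filter (fun e => ¬ Disjoint e (T.filter (· ∉ U))) ⊆
        G.edges.filter (fun e => ¬ Disjoint e T) := by
    refine Finset.union_subset (fun e he => ?_) (fun e he => ?_) <;> rw [Finset.mem_filter] at he
    · exact Finset.mem_filter.2 ⟨he.1, fun h => he.2 (h.mono_right (Finset.filter_subset _ _))⟩
    · exact Finset.mem_filter.2 ⟨Finset.mem_of_mem_filter e he.1,
        fun h => he.2 (h.mono_right (Finset.filter_subset _ _))⟩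
  have hcard := Finset.card_le_card hsub
  rw [Finset.card_union_of_disjoint hdisj] at hcard
  have hcard' : ((G.edges.filter (fun e => ¬ Disjoint e (T.filter (· ∈ U)))).card : ℝ) +
      (E.filter (fun e => ¬ Disjoint e (T.filter (· ∉ U)))).card ≤
        (G.edges.filter (fun e => ¬ Disjoint e T)).card := by exact_mod_cast hcard
  have hlowT' : (∑ w ∈ T.filter (· ∉ U), (d w : ℝ)) ≤
      2 * ((E.filter (fun e => ¬ Disjoint e (T.filter (· ∉ U)))).card : ℝ) := by
    exact_mod_cast hlowT
  rw [hsplit]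
  linarith

theorem card_deleteMeeting_add {G : ThreeGraph} (T : Finset (Fin G.n)) :
    (G.deleteMeeting T).edges.card + (G.edges.filter (fun e => ¬ Disjoint e T)).card =
      G.edges.card :=
  Finset.card_filter_add_card_filter_not (fun e => Disjoint e T)

theorem exists_indepSet_cubic {G : ThreeGraph} (hG : G.Free H7) {r a : ℕ}
    (hcol : ¬ G.Colorable r) (ha : 0 < a) (har : a ≤ r) :
    ∃ T : Finset (Fin G.n), G.IndepSet T ∧
      (a : ℝ) ^ 2 * (8 * r - 7 * a - 3) / 36 ≤
        (G.edges.filter (fun e => ¬ Disjoint e T)).card := by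
  have ha' : (0 : ℝ) < a := by exact_mod_cast ha
  obtain ⟨T, hT, h⟩ := exists_indepSet_meeting_many hG hcol har (β := a / 3) (by positivity)
    (by linarith)
  refine ⟨T, hT, le_trans (le_of_eq ?_) h⟩
  have hgauss : ∑ j ∈ Finset.range a, (j : ℝ) = a * (a - 1) / 2 := by
    clear * -
    induction a with
    | zero => simp
    | succ a ih => rw [Finset.sum_range_succ, ih]; push_cast; ring
  rw [← Finset.sum_div, ← Finset.mul_sum, Finset.sum_sub_distrib, hgauss, Finset.sum_const,
    Finset.card_range, nsmul_eq_mul]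
  ring

end ThreeGraph

theorem quartic_step_lt {C : ℝ} (hC₀ : 0 < C) (hC : C < 0.00944) (r : ℕ) (hr : 2 ≤ r) :
    ∃ a : ℕ, 0 < a ∧ a ≤ r ∧
      C * ((r : ℝ) ^ 4 - ((r - 1 : ℕ) : ℝ) ^ 4) < (a : ℝ) ^ 2 * (8 * r - 7 * a - 3) / 36 := by
  have hpow : 0 < (r : ℝ) ^ 4 - ((r - 1 : ℕ) : ℝ) ^ 4 := by
    rw [sub_pos]
    exact pow_lt_pow_left₀ (by exact_mod_cast (by omega : r - 1 < r)) (by positivity) (by norm_num)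
  suffices h : ∃ a : ℕ, 0 < a ∧ a ≤ r ∧
      0.00944 * ((r : ℝ) ^ 4 - ((r - 1 : ℕ) : ℝ) ^ 4) ≤
        (a : ℝ) ^ 2 * (8 * r - 7 * a - 3) / 36 by
    obtain ⟨a, h0, h1, h2⟩ := h
    exact ⟨a, h0, h1, (mul_lt_mul_of_pos_right hC hpow).trans_le h2⟩
  rw [Nat.cast_sub (by omega : 1 ≤ r), Nat.cast_one]
  obtain ⟨q, hq⟩ : ∃ q, r = 4 * q + 2 ∨ r = 4 * q + 3 ∨ r = 4 * q + 4 ∨ r = 4 * q + 5 :=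
    ⟨(r - 2) / 4, by omega⟩
  have hq0 : (0 : ℝ) ≤ q := Nat.cast_nonneg q
  have hq2 : (0 : ℝ) ≤ (q : ℝ) ^ 2 := by positivity
  have hq3 : (0 : ℝ) ≤ (q : ℝ) ^ 3 := by positivity
  rcases hq with rfl | rfl | rfl | rfl
  · refine ⟨3 * q + 1, by omega, by omega, ?_⟩
    push_cast
    ring_nf
    linarith
  · refine ⟨3 * q + 2, by omega, by omega, ?_⟩
    push_cast
    ring_nf
    linarith
  · refine ⟨3 * q + 3, by omega, by omega, ?_⟩
    push_cast
    ring_nf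
    linarith
  · refine ⟨3 * q + 3, by omega, by omega, ?_⟩
    push_cast
    ring_nf
    linarith

/-- For all `r ≥ 1`, `m_{H7}(r) > (e/288)·r^4`: every `H7`-free 3-graph
with chromatic number `> r` has more than `(e/288)·r^4` edges. -/
theorem mH_H7_lower :
    ∀ r : ℕ, 1 ≤ r → ∀ G : ThreeGraph, G.Free H7 → ¬ G.Colorable r →
      Real.exp 1 / 288 * (r : ℝ) ^ 4 < (G.edges.card : ℝ) := by
  intro r hr
  have hC : Real.exp 1 / 288 < 0.00944 := by
    have := Real.exp_one_lt_d9
    linarith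
  induction r, hr using Nat.le_induction with
  | base =>
    intro G _ hcol
    have hne : G.edges.Nonempty := by
      by_contra h
      exact hcol ⟨fun _ => 0, fun e he => absurd ⟨e, he⟩ h⟩
    have h1 : (1 : ℝ) ≤ G.edges.card := by exact_mod_cast hne.card_pos
    norm_num
    linarith
  | succ r hr ih =>
    intro G hG hcol
    obtain ⟨a, ha, har, hstep⟩ :=
      quartic_step_lt (by positivity : 0 < Real.exp 1 / 288) hC (r + 1) (by omega)
    obtain ⟨T, hT, hcard⟩ := ThreeGraph.exists_indepSet_cubic hG hcol ha har
    have hrec := ih (G.deleteMeeting T) (hG.deleteMeeting T) fun h => hcol (hT.colorable_succ h)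
    have hsum : ((G.deleteMeeting T).edges.card : ℝ) +
        (G.edges.filter (fun e => ¬ Disjoint e T)).card = G.edges.card := by
      exact_mod_cast ThreeGraph.card_deleteMeeting_add T
    rw [Nat.add_sub_cancel, mul_sub] at hstep
    linarith
end

section
/- Let H be a 3-graph with t = |V(H)| vertices and |E(H)| = t − 2 edges. Suppose there is an ordering h_1, …, h_{t−2} of its edges such that for each i > 1 one can write h_i = {a_i, b_i, c_i}, where {a_i, b_i} ⊆ h_{j(i)} for some j(i) < i, and c_i does not belong to h_j for any j < i. Then for all integers n ≥ 1, ex(n, H) ≤ (t − 3)·C(n, 2), where C(n,2) is the binomial coefficient n choose 2. -/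
/-- A set system whose size exceeds `d` times the number of available pairs contains a nonempty
subsystem in which every pair lying in a member lies in more than `d` members. -/
theorem exists_subset_forall_pair_lt_card {α : Type*} [DecidableEq α] (d : ℕ)
    (P : Finset (Finset α)) (E : Finset (Finset α))
    (hP : ∀ e ∈ E, ∀ p ⊆ e, p.card = 2 → p ∈ P) (hcard : d * P.card < E.card) :
    ∃ F ⊆ E, F.Nonempty ∧
      ∀ e ∈ F, ∀ p ⊆ e, p.card = 2 → d < (F.filter (fun x => p ⊆ x)).card := by
  induction hk : P.card generalizing P E with
  | zero =>
    refine ⟨E, subset_rfl, Finset.card_pos.mp (by omega), fun e he p hp hp2 => ?_⟩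
    have hmem := hP e he p hp hp2
    rw [Finset.card_eq_zero.mp hk] at hmem
    simp at hmem
  | succ k ih =>
    by_cases hgood : ∀ e ∈ E, ∀ p ⊆ e, p.card = 2 → d < (E.filter (fun x => p ⊆ x)).card
    · exact ⟨E, subset_rfl, Finset.card_pos.mp (by omega), hgood⟩
    push Not at hgood
    obtain ⟨e, he, p, hpe, hp2, hdeg⟩ := hgood
    have hpP : p ∈ P := hP e he p hpe hp2
    have hPk : (P.erase p).card = k := by rw [Finset.card_erase_of_mem hpP]; omega
    have hsplit := Finset.card_filter_add_card_filter_not (s := E) (fun x => p ⊆ x)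
    obtain ⟨F, hF, hne, hall⟩ := ih (P.erase p) (E.filter (fun x => ¬ p ⊆ x))
      (fun x hx q hq hq2 => by
        rw [Finset.mem_filter] at hx
        refine Finset.mem_erase.mpr ⟨?_, hP x hx.1 q hq hq2⟩
        rintro rfl
        exact hx.2 hq)
      (by rw [hk, mul_add] at hcard; rw [hPk]; omega) hPk
    exact ⟨F, hF.trans (Finset.filter_subset _ _), hne, hall⟩

/-- A pair contained in more triples of `F` than there are points in `T \ p` extends to a triple
of `F` by a point outside `T`. -/
theorem exists_notMem_insert_mem {α : Type*} [DecidableEq α] {F : Finset (Finset α)}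
    (hF : ∀ e ∈ F, e.card = 3) {p T : Finset α} (hp : p.card = 2)
    (hcard : (T \ p).card < (F.filter (fun x => p ⊆ x)).card) :
    ∃ v ∉ T, insert v p ∈ F := by
  by_contra! hno
  refine hcard.not_ge ?_
  have hsub : F.filter (fun x => p ⊆ x) ⊆ (T \ p).image (fun v => insert v p) := by
    intro e he
    obtain ⟨heF, hpe⟩ := Finset.mem_filter.mp he
    obtain ⟨v, hvp, hv⟩ : ∃ v ∉ p, insert v p = e :=
      Finset.exists_eq_insert_iff.mpr ⟨hpe, by rw [hp, hF e heF]⟩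
    refine Finset.mem_image.mpr ⟨v, Finset.mem_sdiff.mpr ⟨?_, hvp⟩, hv⟩
    by_contra hvT
    exact hno v hvT (hv ▸ heF)
  exact (Finset.card_le_card hsub).trans Finset.card_image_le

/-- Two triples can be matched by a map injective on the first. -/
theorem exists_injOn_image_eq_of_card_eq_three {α β : Type*} [DecidableEq α] [DecidableEq β]
    {s : Finset α} {e : Finset β} (hs : s.card = 3) (he : e.card = 3) :
    ∃ f : α → β, Set.InjOn f s ∧ s.image f = e := by
  obtain ⟨x, y, z, hxy, hxz, hyz, rfl⟩ := Finset.card_eq_three.mp hs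
  obtain ⟨u, v, w, huv, huw, hvw, rfl⟩ := Finset.card_eq_three.mp he
  refine ⟨fun r => if r = x then u else if r = y then v else w, ?_, ?_⟩
  · intro a ha b hb hab
    simp only [Finset.coe_insert, Finset.coe_singleton, Set.mem_insert_iff,
      Set.mem_singleton_iff] at ha hb
    grind
  · simp [Finset.image_insert, hxy.symm, hxz.symm, hyz.symm]

/-- Greedy embedding of the edge ordering into a triple system of large pair degrees. -/
theorem exists_injOn_image_mem_of_edge_ordering {α β : Type*} [DecidableEq α] [DecidableEq β]
    {m : ℕ} (h : Fin m → Finset α) (h3 : ∀ i, (h i).card = 3)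
    (horder : ∀ i : Fin m, 0 < i.val →
      ∃ a b c : α, h i = {a, b, c} ∧
        (∃ j : Fin m, j < i ∧ ({a, b} : Finset α) ⊆ h j) ∧
        (∀ j : Fin m, j < i → c ∉ h j))
    {F : Finset (Finset β)} (hF3 : ∀ e ∈ F, e.card = 3) (hne : F.Nonempty)
    (hdeg : ∀ e ∈ F, ∀ p ⊆ e, p.card = 2 → m - 1 < (F.filter (fun x => p ⊆ x)).card)
    (k : ℕ) (hk : k + 1 ≤ m) :
    ∃ (S : Finset α) (f : α → β), S.card = k + 3 ∧ Set.InjOn f S ∧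
      ∀ j : Fin m, j.val ≤ k → h j ⊆ S ∧ (h j).image f ∈ F ∧
        ∀ x ∈ S, ∃ i : Fin m, i.val ≤ k ∧ x ∈ h i := by
  induction k with
  | zero =>
    obtain ⟨e, he⟩ := hne
    obtain ⟨f, hf, hfe⟩ := exists_injOn_image_eq_of_card_eq_three (h3 ⟨0, hk⟩) (hF3 e he)
    refine ⟨h ⟨0, hk⟩, f, h3 _, hf, fun j hj => ?_⟩
    obtain rfl : j = ⟨0, hk⟩ := Fin.ext (by simpa using hj)
    exact ⟨subset_rfl, hfe ▸ he, fun x hx => ⟨_, le_rfl, hx⟩⟩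
  | succ k ih =>
    obtain ⟨S, f, hS, hf, hall⟩ := ih (by omega)
    obtain ⟨a, b, c, habc, ⟨j, hj, hab⟩, hc⟩ := horder ⟨k + 1, hk⟩ (Nat.succ_pos k)
    have hjk : j.val ≤ k := Nat.lt_succ_iff.mp hj
    obtain ⟨hjS, hjF, hcov⟩ := hall j hjk
    have hcS : c ∉ S := fun hcS => by
      obtain ⟨i, hi, hci⟩ := hcov c hcS
      exact hc i (Nat.lt_succ_iff.mpr hi) hci
    have ha : a ∈ S := hjS (hab (by simp))
    have hb : b ∈ S := hjS (hab (by simp))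
    have hab_ne : a ≠ b := by
      rintro rfl
      have h3' := h3 ⟨k + 1, hk⟩
      rw [habc, Finset.insert_eq_of_mem (Finset.mem_insert_self _ _)] at h3'
      exact absurd (h3' ▸ Finset.card_le_two) (by omega)
    have hfab : f a ≠ f b := fun hEq => hab_ne (hf ha hb hEq)
    have hp2 : ({f a, f b} : Finset β).card = 2 := Finset.card_pair hfab
    have hpsub : ({f a, f b} : Finset β) ⊆ (h j).image f := by
      rw [← Finset.image_singleton, ← Finset.image_insert]
      exact Finset.image_subset_image hab
    have hpS : ({f a, f b} : Finset β) ⊆ S.image f :=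
      hpsub.trans (Finset.image_subset_image hjS)
    obtain ⟨v, hv, hvF⟩ := exists_notMem_insert_mem hF3 (T := S.image f) hp2 (by
      have hlt := hdeg _ hjF _ hpsub hp2
      have hle : (S.image f).card ≤ S.card := Finset.card_image_le
      rw [Finset.card_sdiff_of_subset hpS, hp2]
      omega)
    have hupd : ∀ x ∈ S, Function.update f c v x = f x := fun x hx =>
      Function.update_of_ne (by rintro rfl; exact hcS hx) _ _
    refine ⟨insert c S, Function.update f c v, ?_, ?_, ?_⟩
    · rw [Finset.card_insert_of_notMem hcS, hS]
    · rw [Finset.coe_insert, Set.injOn_insert (by simpa using hcS)]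
      refine ⟨fun x hx y hy hxy => hf hx hy ?_, ?_⟩
      · rwa [hupd x hx, hupd y hy] at hxy
      · rintro ⟨x, hx, hxv⟩
        rw [hupd x hx, Function.update_self] at hxv
        exact hv (Finset.mem_image.mpr ⟨x, hx, hxv⟩)
    · have hcov' : ∀ x ∈ insert c S, ∃ i : Fin m, i.val ≤ k + 1 ∧ x ∈ h i := by
        intro x hx
        rcases Finset.mem_insert.mp hx with rfl | hx
        · exact ⟨⟨k + 1, hk⟩, le_rfl, by simp [habc]⟩
        · obtain ⟨i, hi, hxi⟩ := hcov x hx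
          exact ⟨i, by omega, hxi⟩
      intro i hi
      rcases Nat.lt_or_ge k i.val with hik | hik
      · obtain rfl : i = ⟨k + 1, hk⟩ := Fin.ext (by simp; omega)
        refine ⟨?_, ?_, hcov'⟩
        · rw [habc]
          simp [Finset.insert_subset_iff, ha, hb]
        · have himg : ({a, b, c} : Finset α).image (Function.update f c v)
              = insert v {f a, f b} := by
            simp only [Finset.image_insert, Finset.image_singleton, hupd a ha, hupd b hb,
              Function.update_self]
            ext x
            simp only [Finset.mem_insert, Finset.mem_singleton]
            tauto
          rwa [habc, himg]
      · obtain ⟨hiS, hiF, -⟩ := hall i hik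
        refine ⟨hiS.trans (Finset.subset_insert _ _), ?_, hcov'⟩
        rwa [Finset.image_congr (fun x hx => hupd x (hiS hx))]

/-- Let `H` be a 3-graph with `t` vertices and `t − 2` edges admitting an
ordering `h 0, …, h (t−3)` of its edges such that each later edge `h i = {a, b, c}` has two of
its vertices `{a, b}` inside some earlier edge and its third vertex `c` outside all earlier
edges. Then `ex(n, H) ≤ (t − 3)·C(n, 2)`: every `H`-free 3-graph on `n` vertices has at most
`(t − 3)·C(n, 2)` edges. -/
theorem turan_of_edge_ordering
    (H : ThreeGraph) (t : ℕ) (ht : H.n = t) (hE : H.edges.card = t - 2)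
    (h : Fin (t - 2) → Finset (Fin H.n))
    (hinj : Function.Injective h) (hmem : ∀ i, h i ∈ H.edges)
    (horder : ∀ i : Fin (t - 2), 0 < i.val →
      ∃ a b c : Fin H.n, h i = {a, b, c} ∧
        (∃ j : Fin (t - 2), j < i ∧ ({a, b} : Finset (Fin H.n)) ⊆ h j) ∧
        (∀ j : Fin (t - 2), j < i → c ∉ h j)) :
    ∀ n : ℕ, 1 ≤ n → ∀ G : ThreeGraph, G.n = n → G.Free H →
      G.edges.card ≤ (t - 3) * n.choose 2 := by
  rintro n - G rfl hfree
  by_contra! hlt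
  apply hfree
  have hP : ((Finset.univ : Finset (Fin G.n)).powersetCard 2).card = G.n.choose 2 := by
    simp
  obtain ⟨F, hFG, hne, hdeg⟩ := exists_subset_forall_pair_lt_card (t - 3)
    ((Finset.univ : Finset (Fin G.n)).powersetCard 2) G.edges
    (fun e _ p _ hp2 => Finset.mem_powersetCard.mpr ⟨Finset.subset_univ _, hp2⟩)
    (by rwa [hP])
  have hF3 : ∀ e ∈ F, e.card = 3 := fun e he => G.card_eq e (hFG he)
  have hedge : ∀ e ∈ H.edges, ∃ i, h i = e := by
    have himg : Finset.univ.image h = H.edges := by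
      refine Finset.eq_of_subset_of_card_le ?_ ?_
      · exact Finset.image_subset_iff.mpr fun i _ => hmem i
      · rw [Finset.card_image_of_injective _ hinj, hE, Finset.card_fin]
    intro e he
    rw [← himg] at he
    simpa using he
  rcases Nat.lt_or_ge 2 t with h2 | h2
  · obtain ⟨S, f, hS, hf, hall⟩ := exists_injOn_image_mem_of_edge_ordering h
      (fun i => H.card_eq _ (hmem i)) horder hF3 hne
      (by simpa only [Nat.sub_sub] using hdeg) (t - 3) (by omega)
    have hSuniv : S = Finset.univ := by
      rw [← Finset.card_eq_iff_eq_univ, hS, Fintype.card_fin]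
      omega
    rw [hSuniv, Finset.coe_univ, Set.injOn_univ] at hf
    refine ⟨⟨f, hf⟩, fun e he => ?_⟩
    obtain ⟨i, rfl⟩ := hedge e he
    exact hFG (hall i (by omega)).2.1
  · obtain ⟨e, he⟩ := hne
    have hn : 3 ≤ G.n := by
      simpa [hF3 e he] using Finset.card_le_univ e
    refine ⟨Fin.castLEEmb (by omega), fun e he => ?_⟩
    obtain ⟨i, -⟩ := hedge e he
    have := i.isLt
    omega
end
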